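/- There exist constants α₀ > 0 and C such that for every t ≥ 2 there is a real number α_t with α₀ ≤ α_t and |α_t − 1| ≤ C/log t, such that uniformly for all x ≥ 1, with v = log x / log t, one has | T(x,t) − x α_t (log t) λ(v) | ≤ C x. -/

import Mathlib

open Real MeasureTheory

/-- `n` is `t`-dense: `n ≥ 1` and the ratios of consecutive divisors of `n` are all `≤ t`,
i.e. every divisor `d < n` is followed by another divisor in the interval `(d, t·d]`. -/
def IsDense (n : ℕ) (t : ℝ) : Prop :=
  0 < n ∧ ∀ d : ℕ, d ∣ n → d < n → ∃ e : ℕ, e ∣ n ∧ d < e ∧ (e : ℝ) ≤ t * d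

open Classical in
/-- `T x t = ∑_{n ≤ x, n t-dense} τ(n)`. -/
noncomputable def T (x t : ℝ) : ℝ :=
  ∑ n ∈ (Finset.Icc 1 ⌊x⌋₊).filter (fun n => IsDense n t), (n.divisors.card : ℝ)

open Set Filter
open intervalIntegral renaming integral_const_mul → icm, integral_add_adjacent_intervals → iadj, integral_add → iadd, integral_congr → icg, integral_of_le → iole, integral_mono_on → imon, integral_const → icst, integral_sub → isb, integral_nonneg → inn
open _root_ renaming mul_le_mul_of_nonneg_left → mnl, mul_le_mul_of_nonneg_right → mnr, intervalIntegrable_iff_integrableOn_Ioc_of_le → iio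
local notation "bL" => by linarith
local notation "bP" => by positivity
local notation "bN" => by norm_num
open MeasureTheory renaming setIntegral_congr_fun → scf, integral_Ioc_eq_integral_Ioo → ioo, ae_restrict_iff' → ari

noncomputable def Hf (n : ℕ) (s : ℂ) : ℂ :=
  (s - 1) * (n + 1) ^ (-s) - ((n + 1) ^ (1 - s) - (n + 2) ^ (1 - s))

noncomputable def Zf (s : ℂ) : ℂ := 1 + ∑' n : ℕ, Hf n s

lemma Hf_bound n {s : ℂ} (hs : 0 < s.re) :
    ‖Hf n s‖ ≤ ‖s - 1‖ * (‖s‖ * (n + 1) ^ (-s.re - 1)) := by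
  have hn : 0 < (n:Real) + 1 := bP
  have hsub : ∀ x ∈ Icc ((n:Real)+1) (n+2), 0 < x := fun x hx => hn.trans_le hx.1
  have h1 : ∀ x ∈ Icc ((n:Real)+1) (n+2),
      ‖((n:ℂ)+1)^(-s) - x^(-s)‖ ≤ ‖s‖ * (n + 1) ^ (-s.re - 1) := by
    intro x hx
    have := (convex_Icc ((n:Real)+1) (n+2)).norm_image_sub_le_of_norm_hasDerivWithin_le
      (f' := fun x : Real => (-s) * x^(-s-1))
      (C := ‖s‖ * ((n:Real) + 1) ^ (-s.re - 1))
      (fun y hy => (by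
        exact (hasDerivAt_ofReal_cpow_const (hsub y hy).ne'
          (by intro h; have := congrArg Complex.re h; simp at this; linarith)).hasDerivWithinAt))
      (fun y hy => by
        rw [norm_mul, norm_neg, Complex.norm_cpow_eq_rpow_re_of_pos (hsub y hy)]
        gcongr
        simp only [Complex.sub_re, Complex.neg_re, Complex.one_re]
        exact rpow_le_rpow_of_nonpos hn hy.1 bL) hx ⟨le_refl _, by linarith⟩
    refine le_trans (by push_cast; rfl) (this.trans ?_)
    have : ‖n+1 - x‖ ≤ 1 := by rw [norm_eq_abs, abs_le]; constructor <;> linarith [hx.1, hx.2]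
    exact mul_le_of_le_one_right bP this
  by_cases hs1 : s = 1
  · simp [Hf, hs1]
  have h1s : (1 - s) ≠ 0 := sub_ne_zero.2 (Ne.symm hs1)
  have := (convex_Icc ((n:Real)+1) (n+2)).norm_image_sub_le_of_norm_hasDerivWithin_le
      (f := fun x : Real => (s-1)*((n:ℂ)+1)^(-s) * x + (x:ℂ)^(1-s))
      (f' := fun x : Real => (s-1) * ((n+1)^(-s) - x^(-s)))
      (C := ‖s-1‖ * (‖s‖ * (n + 1) ^ (-s.re - 1)))
      (fun y hy => (by
        have a := (hasDerivAt_ofReal_cpow_const (hsub y hy).ne' h1s)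
        have b := (Complex.ofRealCLM.hasDerivAt (x := y)).const_mul ((s-1)*(n+1)^(-s))
        have c := b.add a
        refine (c.congr_deriv ?_).hasDerivWithinAt
        rw [show 1 - s - 1 = -s by ring]; simp; ring))
      (fun y hy => by
        rw [norm_mul]; gcongr; exact h1 y hy) ⟨le_refl _, by linarith⟩ ⟨by linarith, le_refl _⟩
  refine le_trans (le_of_eq ?_) (this.trans (le_of_eq ?_))
  · congr 1; simp only [Hf]; push_cast; ring
  · rw [show (n:Real)+2-(n+1) = 1 by ring]; simp

lemma summ_rpow {a : Real} (ha : 0 < a) : Summable (fun n : ℕ => ((n:Real) + 1) ^ (-a - 1)) := by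
  have := (summable_nat_add_iff 1).2 (summable_nat_rpow.2 (show -a - 1 < -1 by linarith))
  simpa using this

lemma Hf_summable {s : ℂ} (hs : 0 < s.re) : Summable (fun n => Hf n s) :=
  Summable.of_norm_bounded (((summ_rpow hs).mul_left _).mul_left _) (fun n => Hf_bound n hs)

lemma Hf_diff n : Differentiable ℂ (Hf n) := by
  have h1 : ((n:ℂ) + 1) ≠ 0 := by exact_mod_cast n.succ_ne_zero
  have h2 : ((n:ℂ) + 2) ≠ 0 := by exact_mod_cast (n+1).succ_ne_zero
  unfold Hf
  intro s
  refine ((differentiableAt_id.sub_const 1).mul ?_).sub (DifferentiableAt.sub ?_ ?_)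
  · exact (differentiableAt_id.neg).const_cpow (Or.inl h1)
  · exact (differentiableAt_id.const_sub 1).const_cpow (Or.inl h1)
  · exact (differentiableAt_id.const_sub 1).const_cpow (Or.inl h2)

lemma Zf_diff {s : ℂ} (hs : 1/2 < s.re) : DifferentiableAt ℂ Zf s := by
  set U : Set ℂ := {z | 1/2 < z.re} ∩ Metric.ball 0 (‖s‖+1)
  have hU : IsOpen U := (isOpen_lt continuous_const Complex.continuous_re).inter Metric.isOpen_ball
  have hsU : s ∈ U := ⟨hs, by simp⟩
  have : DifferentiableOn ℂ (fun z => ∑' n, Hf n z) U := by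
    refine Complex.differentiableOn_tsum_of_summable_norm
      (u := fun n : ℕ => (‖s‖+2) * ((‖s‖+1) * (n+1)^(-(1/2:Real)-1)))
      (((summ_rpow bN).mul_left _).mul_left _)
      (fun n => (Hf_diff n).differentiableOn) hU (fun n w hw => ?_)
    have hw2 : ‖w‖ ≤ ‖s‖+1 := by have := hw.2; simp at this; exact this.le
    refine (Hf_bound n (lt_trans bN hw.1)).trans ?_
    have : ‖w - 1‖ ≤ ‖s‖+2 := (norm_sub_le _ _).trans (by simp; linarith)
    have h3 : 1/2 < w.re := hw.1
    gcongr
    linarith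
  exact ((this.differentiableAt (hU.mem_nhds hsU)).const_add 1)

lemma tele (s : ℂ) N : ∑ n ∈ Finset.range N, ((n + 1) ^ (1 - s) - ((n:ℂ) + 2) ^ (1 - s))
    = 1 - (N+1)^(1-s) := by
  have := Finset.sum_range_sub' (fun n : ℕ => ((n:ℂ)+1)^(1-s)) N
  simp only [Nat.cast_zero, zero_add, Complex.one_cpow] at this
  grind

lemma Zf_eq {s : ℂ} (hs : 1 < s.re) : Zf s = (s - 1) * riemannZeta s := by
  have h1 : HasSum (fun n : ℕ => ((n:ℂ)+1)^(-s)) (riemannZeta s) := by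
    rw [zeta_eq_tsum_one_div_nat_add_one_cpow hs]
    have : Summable (fun n : ℕ => 1 / ((n:ℂ)+1)^s) := by
      have := (summable_nat_add_iff 1).2 (Complex.summable_one_div_nat_cpow.2 hs)
      simpa using this
    convert this.hasSum using 2 with n
    rw [Complex.cpow_neg, one_div]
  have h2 := (Hf_summable (show 0 < s.re by linarith)).hasSum.tendsto_sum_nat
  have h3 := (h1.mul_left (s-1)).tendsto_sum_nat
  have h4 : Tendsto (fun N : ℕ => ((N:ℂ)+1)^(1-s)) atTop (nhds 0) := by
    rw [tendsto_zero_iff_norm_tendsto_zero]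
    have : Tendsto (fun N : ℕ => ((N:Real)+1)^(-(s.re-1))) atTop (nhds 0) :=
      (tendsto_rpow_neg_atTop (show 0 < s.re - 1 by linarith)).comp
        (tendsto_atTop_add_const_right _ _ tendsto_natCast_atTop_atTop)
    refine this.congr fun N => ?_
    have := Complex.norm_cpow_eq_rpow_re_of_pos (show 0 < (N:Real)+1 by positivity) (1-s)
    push_cast at this; rw [this]; simp
  have h5 := h3.sub (h4.const_sub 1)
  have h6 : (fun N => ∑ n ∈ Finset.range N, Hf n s) = fun N =>
     (∑ n ∈ Finset.range N, (s-1)*(n+1)^(-s)) - (1 - (N+1)^(1-s)) := by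
    ext N; simp only [Hf, Finset.sum_sub_distrib, ← tele s N]
  rw [h6] at h2
  have := tendsto_nhds_unique h2 h5
  rw [Zf, this]; ring

lemma Zf_analytic : AnalyticOnNhd ℂ Zf {z | 1/2 < z.re} :=
  DifferentiableOn.analyticOnNhd (fun _ hz => (Zf_diff hz).differentiableWithinAt)
    (isOpen_lt continuous_const Complex.continuous_re)

lemma Zf_ne {s : ℂ} (hs : 1 ≤ s.re) : Zf s ≠ 0 := by
  have hE : EqOn Zf (DirichletCharacter.LFunctionTrivChar₁ 1) {z | 1/2 < z.re} := by
    refine Zf_analytic.eqOn_of_preconnected_of_eventuallyEq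
      (fun z _ => ((DirichletCharacter.differentiable_LFunctionTrivChar₁ 1).analyticAt z))
      (convex_halfSpace_re_gt _).isPreconnected (z₀ := 2) (by simp; norm_num) ?_
    filter_upwards [(isOpen_lt continuous_const Complex.continuous_re).mem_nhds
      (show 2 ∈ {z : ℂ | 1 < z.re} by simp)] with z hz
    rw [Zf_eq hz, DirichletCharacter.LFunctionTrivChar₁, Function.update_of_ne]
    · simp
    · rintro rfl; simp at hz
  rw [hE (show 1/2 < s.re by linarith)]
  by_cases h1 : s = 1
  · subst h1; simp
  · rw [DirichletCharacter.LFunctionTrivChar₁, Function.update_of_ne h1]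
    simp only [DirichletCharacter.LFunction_modOne_eq]
    exact mul_ne_zero (sub_ne_zero.2 h1) (riemannZeta_ne_zero_of_one_le_re hs)

noncomputable def LL (τ : Real) : Real := log (|τ| + 10)

lemma LL_two τ : 2 ≤ LL τ := by
  unfold LL
  rw [le_log_iff_exp_le bP]
  have h := exp_one_lt_d9
  have : exp 2 = exp 1 * exp 1 := by rw [← exp_add]; norm_num
  have h0 := exp_pos 1
  nlinarith [abs_nonneg τ]

lemma tail_rpow {a : Real} (ha : 0 < a) N (hN : 0 < N) :
    ∑' n : ℕ, ((n + N : ℕ) + 1 : Real) ^ (-a - 1) ≤ N ^ (-a) / a := by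
  refine tsum_le_of_sum_range_le (fun n => by positivity) fun K => ?_
  have hstep : ∀ n : ℕ, ((n + N : ℕ) + 1 : Real) ^ (-a - 1) ≤
      (((n + N : ℕ):Real) ^ (-a) - (((n + 1) + N : ℕ):Real) ^ (-a)) / a := by
    intro n
    set m : Real := ((n + N : ℕ):Real) with hm
    have hm0 : 0 < m := bP
    have e1 : (((n + 1) + N : ℕ):Real) = m + 1 := by grind
    rw [e1, le_div_iff₀ ha, rpow_sub_one bP]
    have h2 : m ^ (-a) = (m+1)^(-a) * exp (-a * log (m/(m+1))) := by
      rw [rpow_def_of_pos hm0, rpow_def_of_pos bP, ← exp_add,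
        log_div hm0.ne' bP]
      ring_nf
    have h3 : log (m/(m+1)) ≤ m/(m+1) - 1 := log_le_sub_one_of_pos bP
    have h4 := add_one_le_exp (-a * log (m/(m+1)))
    have h5 : m/(m+1) - 1 = -(1/(m+1)) := by grind
    have h6 : 1 + a/(m+1) ≤ exp (-a * log (m/(m+1))) := by
      rw [h5] at h3
      have := mnl h3 ha.le
      grind
    have h7 : 0 < (m+1)^(-a) := bP
    rw [h2]
    have := mnl h6 h7.le
    grind
  refine (Finset.sum_le_sum fun n _ => hstep n).trans ?_
  rw [← Finset.sum_div, Finset.sum_range_sub' (fun n : ℕ => (((n + N : ℕ):Real) ^ (-a)))]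
  have : 0 ≤ ((K+N:ℕ):Real)^(-a) := bP
  simp only [zero_add]
  gcongr
  linarith

lemma Zf_upper {s : ℂ} (h1 : 1 - 1 / LL s.im ≤ s.re) (h3 : s.re ≤ 3) :
    ‖Zf s‖ ≤ 60 * ((|s.im| + 10) * LL s.im) := by
  set L := LL s.im with hL
  set y := |s.im| + 10 with hy
  have hL2 : 2 ≤ L := LL_two _
  have hy10 : 10 ≤ y := by grind
  have hLi : 1 / L ≤ 1/2 := one_div_le_one_div_of_le bN hL2
  have hσ : 1/2 ≤ s.re := bL
  have hs : ‖s‖ ≤ y := by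
    have := Complex.norm_le_abs_re_add_abs_im s
    grind
  have hs1 : ‖s - 1‖ ≤ y := by
    have := Complex.norm_le_abs_re_add_abs_im (s - 1)
    have h : |s.re - 1| ≤ 2 := by grind
    simp at this; linarith
  have hyL : y ^ (1/L) = exp 1 := by
    rw [rpow_def_of_pos bL, hL, LL, ← hy, mul_one_div_cancel]
    positivity
  have he : exp 1 ≤ 2.7182818286 := exp_one_lt_d9.le
  have he0 := exp_pos 1
  set N := ⌊y⌋₊ with hN
  have hNy : (N:Real) ≤ y := Nat.floor_le (by linarith)
  have hyN : y < N + 1 := Nat.lt_floor_add_one y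
  have hN9 : (9:Real) < N := by linarith
  have hN0 : 0 < N := by exact_mod_cast (by linarith : (0:Real) < N)
  have hpow : ∀ x : Real, 1 ≤ x → x ≤ y → x ^ (1 - s.re) ≤ exp 1 := fun x hx hxy => by
    rw [← hyL]
    exact (rpow_le_rpow_of_exponent_le hx (by linarith)).trans
      (rpow_le_rpow (by linarith) hxy (by positivity))
  have hsplit : Zf s = (s-1) * ∑ n ∈ Finset.range N, ((n:ℂ)+1)^(-s) + (N+1)^(1-s)
      + ∑' n, Hf (n + N) s := by
    rw [Zf, ← (Hf_summable (show 0 < s.re by linarith)).sum_add_tsum_nat_add N]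
    simp only [Hf, Finset.sum_sub_distrib, tele s N]
    rw [Finset.mul_sum]; ring
  have hA : ‖∑ n ∈ Finset.range N, ((n:ℂ)+1)^(-s)‖ ≤ exp 1 * (1 + L) := by
    have hh := harmonic_le_one_add_log N
    have hlog : log N ≤ L := log_le_log (by linarith) hNy
    refine le_trans (norm_sum_le_of_le _ (n := fun n : ℕ => Real.exp 1 * ((n:Real)+1)⁻¹) fun n hn => ?_) ?_
    · have hn' : (n:Real) + 1 ≤ N := by exact_mod_cast Finset.mem_range.1 hn
      have := Complex.norm_cpow_eq_rpow_re_of_pos (show 0 < (n:Real)+1 by positivity) (-s)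
      push_cast at this; rw [this]
      have := hpow (n+1) (by linarith) (by linarith)
      rw [show (-s).re = (1 - s.re) - 1 by simp, rpow_sub_one (by positivity)]
      rw [div_eq_mul_inv]; gcongr
    · rw [← Finset.mul_sum]
      gcongr
      have e : ((harmonic N : ℚ) : Real) = ∑ n ∈ Finset.range N, ((n:Real)+1)⁻¹ := by
        simp [harmonic]
      linarith
  have hB : ‖((N:ℂ)+1)^(1-s)‖ ≤ 8 := by
    have := Complex.norm_cpow_eq_rpow_re_of_pos (show 0 < (N:Real)+1 by positivity) (1-s)
    push_cast at this; rw [this]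
    have h2 : (N+1) ^ (1-s.re) ≤ (y^2)^(1/L) :=
      (rpow_le_rpow_of_exponent_le (by linarith) (by linarith)).trans
      (rpow_le_rpow (by linarith) (by nlinarith) (by positivity))
    have h3 : (y^2)^(1/L) = exp 1 ^ 2 := by
      rw [← hyL, ← rpow_natCast, ← rpow_natCast, ← rpow_mul (by linarith),
        ← rpow_mul (by linarith), mul_comm]
    rw [h3] at h2
    simp only [Complex.sub_re, Complex.one_re]
    nlinarith
  have hC : ‖∑' n, Hf (n + N) s‖ ≤ y * (y * (2 * (exp 1 / N))) := by
    have hb := fun n : ℕ => Hf_bound (n+N) (show 0 < s.re by linarith)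
    have hsum : Summable (fun n : ℕ => ((n + N : ℕ) + 1 : Real) ^ (-s.re - 1)) :=
      (summable_nat_add_iff N).2 (summ_rpow (by linarith))
    refine (tsum_of_norm_bounded ((hsum.mul_left ‖s‖).mul_left ‖s-1‖).hasSum hb).trans ?_
    rw [tsum_mul_left, tsum_mul_left]
    gcongr
    refine (tail_rpow (by linarith) N hN0).trans ?_
    have e : (N:Real)^(-s.re) = (N:Real)^(1-s.re) / N := by
      rw [← Real.rpow_sub_one (by positivity)]; ring_nf
    rw [e, div_le_iff₀ (by linarith)]
    have := hpow N (by linarith) hNy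
    have h5 : (N:Real)^(1-s.re)/N ≤ Real.exp 1 / N := by gcongr
    have h6 : 0 ≤ Real.exp 1 / N := by positivity
    nlinarith
  have hC2 : y * (y * (2 * (Real.exp 1 / N))) ≤ y * 7 := by
    gcongr
    have : y * (2 * (Real.exp 1 / N)) = (2 * Real.exp 1) * (y / N) := by ring
    rw [this]
    have : y / N ≤ 10/9 := by rw [div_le_iff₀ (by linarith)]; linarith
    nlinarith [div_nonneg (show 0 ≤ y by linarith) (show (0:Real) ≤ N by linarith)]
  rw [hsplit]
  refine (norm_add_le _ _).trans ((add_le_add_left (norm_add_le _ _) _).trans ?_)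
  rw [norm_mul]
  have h9 : ‖s-1‖ * ‖∑ n ∈ Finset.range N, ((n:ℂ)+1)^(-s)‖ ≤ y * (Real.exp 1 * (1+L)) := by gcongr
  have h10 : y * (Real.exp 1 * (1+L)) ≤ y * (3 * (1.5 * L)) := by
    gcongr
    · linarith
    · linarith
  nlinarith [mul_nonneg (show 0 ≤ y - 10 by linarith) (show 0 ≤ L - 2 by linarith)]

lemma LL_close {τ τ' : Real} (h : |τ' - τ| ≤ 1) :
    LL τ' ≤ 1.1 * LL τ ∧ |τ'| + 10 ≤ 1.1 * (|τ| + 10) := by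
  have h1 : |τ'| ≤ |τ| + 1 := by
    have := abs_add_le τ (τ' - τ); simp at this; linarith
  have h2 : |τ'| + 10 ≤ 1.1 * (|τ| + 10) := by grind
  refine ⟨?_, h2⟩
  have : LL τ' ≤ log 1.1 + LL τ := by
    unfold LL
    rw [← log_mul bN bP]
    exact log_le_log bP h2
  have h3 : log 1.1 ≤ 1.1 - 1 := log_le_sub_one_of_pos bN
  linarith [LL_two τ]

lemma Zf_deriv {s : ℂ} (h1 : 1 - 1 / (3 * LL s.im) ≤ s.re) (h3 : s.re ≤ 2) :
    ‖deriv Zf s‖ ≤ 240 * ((|s.im| + 10) * LL s.im ^ 2) := by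
  set L := LL s.im with hL
  have hL2 : 2 ≤ L := LL_two _
  have hr : 0 < 1 / (3 * L) := bP
  have hr6 : 1 / (3 * L) ≤ 1 / 6 := one_div_le_one_div_of_le bN bL
  have hball : ∀ z ∈ Metric.closedBall s (1 / (3 * L)), |z.im - s.im| ≤ 1 ∧
      |z.re - s.re| ≤ 1 / (3 * L) := by
    intro z hz
    rw [Metric.mem_closedBall, Complex.dist_eq] at hz
    have a := Complex.abs_im_le_norm (z - s)
    have b := Complex.abs_re_le_norm (z - s)
    simp only [Complex.sub_im, Complex.sub_re] at a b
    grind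
  have key := Complex.norm_deriv_le_of_forall_mem_sphere_norm_le (f := Zf) (c := s) hr
    (C := 60 * ((1.1 * (|s.im| + 10)) * (1.1 * L))) ?_ ?_
  · refine key.trans ?_
    rw [div_div_eq_mul_div, div_one]
    have : 0 ≤ (|s.im|+10) * L^2 := bP
    nlinarith
  · refine DifferentiableOn.diffContOnCl fun z hz => (Zf_diff ?_).differentiableWithinAt
    rw [closure_ball s hr.ne'] at hz
    grind
  · intro z hz
    obtain ⟨b1, b2⟩ := hball z (Metric.sphere_subset_closedBall hz)
    obtain ⟨c1, c2⟩ := LL_close b1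
    have d := abs_le.1 b2
    refine (Zf_upper ?_ bL).trans ?_
    · have : 1 / (1.1 * L) ≤ 1 / LL z.im :=
        one_div_le_one_div_of_le (by linarith [LL_two z.im]) c1
      have e1 : 1 / (1.1 * L) = (1 / L) / 1.1 := by field_simp
      have e2 : 1 / (3 * L) = (1 / L) / 3 := by field_simp
      grind
    · have := LL_two z.im
      gcongr

lemma Zf_341 : ∃ κ : Real, 0 < κ ∧ ∀ x τ : Real, 0 < x → x ≤ 1 → 1 ≤ |τ| →
    x ^ 3 ≤ κ ^ 4 * LL τ * (‖Zf (1 + x + Complex.I * τ)‖ / |τ|) ^ 4 := by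
  have hK : 0 < 600 * LL 0 := by have := LL_two 0; positivity
  refine ⟨(600 * LL 0) * 1440, by positivity, fun x τ hx hx1 hτ => ?_⟩
  have h := DirichletCharacter.norm_LFunction_product_ge_one (N := 1) 1 hx τ
  simp only [DirichletCharacter.LFunction_modOne_eq,
    norm_mul, norm_pow] at h
  have hz : ∀ w : ℂ, w.re = 0 → riemannZeta (1 + x + w) = Zf (1 + x + w) / (x + w) := fun w hw => by
    rw [Zf_eq (by simp [hw, hx])]
    have : x + w ≠ 0 := fun h => by
      have := congrArg Complex.re h; simp at this; linarith
    grind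
  have z0 := hz 0 (by simp)
  have z1 := hz (Complex.I * τ) (by simp)
  have z2 := hz (2 * Complex.I * τ) (by simp)
  rw [add_zero] at z0
  rw [z0, z1, z2, add_zero] at h
  simp only [norm_div] at h
  have u0 : ‖Zf (1 + x)‖ / ‖(x:ℂ)‖ ≤ (600 * LL 0) / x := by
    have := Zf_upper (s := 1 + x) (by
      simp; have := LL_two 0; have : 0 < (LL 0)⁻¹ := bP
      linarith) (by simp; linarith)
    simp at this
    simp [abs_of_pos hx]
    gcongr
    linarith
  have hL := LL_two τ
  have u2 : ‖Zf (1 + x + 2 * Complex.I * τ)‖ / ‖x + 2 * Complex.I * τ‖ ≤ 1440 * LL τ := by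
    have e := Zf_upper (s := 1 + x + 2 * Complex.I * τ) (by
      simp; have := LL_two (2*τ); have : 0 < (LL (2*τ))⁻¹ := by positivity
      linarith) (by simp; linarith)
    simp at e
    have a : LL (2*τ) ≤ 2 * LL τ := by
      unfold LL
      rw [abs_mul]
      have := log_le_log (x := |2| * |τ| + 10) (y := (|τ|+10)^2) bP (by
        rw [abs_two]; nlinarith)
      rw [log_pow] at this; exact_mod_cast this
    have b : 2 * |τ| ≤ ‖x + 2 * Complex.I * τ‖ := by
      have := Complex.abs_im_le_norm (x + 2 * Complex.I * τ)
      simpa using this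
    rw [div_le_iff₀ bL]
    refine e.trans ?_
    have c : (2*|τ|+10) * LL (2*τ) ≤ 12*|τ| * (2 * LL τ) := by
      have := LL_two (2*τ)
      gcongr <;> linarith
    nlinarith
  have u1 : ‖Zf (1 + x + Complex.I * τ)‖ / ‖x + Complex.I * τ‖ ≤
      ‖Zf (1 + x + Complex.I * τ)‖ / |τ| := by
    gcongr
    have := Complex.abs_im_le_norm (x + Complex.I * τ)
    simpa using this
  set b := ‖Zf (1 + x + Complex.I * τ)‖ / |τ|
  have hb : 0 ≤ b := bP
  have : 1 ≤ ((600 * LL 0) / x)^3 * b^4 * (1440 * LL τ) := by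
    refine le_trans h ?_
    gcongr
  rw [div_pow, div_mul_eq_mul_div, div_mul_eq_mul_div, le_div_iff₀ bP, one_mul] at this
  refine this.trans ?_
  have h0 := LL_two 0
  have : 1 ≤ 600 * LL 0 * 1440 ^ 3 := bL
  have hp : 0 ≤ (600 * LL 0) ^ 3 * b^4 * (1440 * LL τ) := bP
  calc _ ≤ ((600 * LL 0) ^ 3 * b^4 * (1440 * LL τ)) * (600 * LL 0 * 1440 ^ 3) :=
        le_mul_of_one_le_right hp this
    _ = _ := by ring

lemma Zf_lower : ∃ a c : Real, 0 < a ∧ a ≤ 1/6 ∧ 0 < c ∧ ∀ s : ℂ, 1 ≤ |s.im| →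
    1 - a / LL s.im ^ 9 ≤ s.re → s.re ≤ 2 → c * |s.im| / LL s.im ^ 7 ≤ ‖Zf s‖ := by
  obtain ⟨κ, hκ, h341⟩ := Zf_341
  set δ := min (1/2) (1 / (10560 * κ)) with hδ
  have hδ0 : 0 < δ := bP
  have hδ1 : δ ≤ 1/2 := min_le_left _ _
  have hδ2 : 10560 * κ * δ ≤ 1 := by
    have := min_le_right (1/2) (1 / (10560 * κ))
    rw [← hδ, le_div_iff₀ bP] at this; linarith
  have hd4 : δ^4 ≤ 1/16 := by
    have := pow_le_pow_left₀ hδ0.le hδ1 4; norm_num at this ⊢; linarith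
  refine ⟨δ^4, δ^3/(2*κ), by positivity, by linarith, by positivity, fun s hs h1 h2 => ?_⟩
  set L := LL s.im with hLd
  have hL := LL_two s.im
  rw [← hLd] at hL
  set η := δ^4 / L^9 with hη
  have hη0 : 0 < η := bP
  have hL8 : 256 ≤ L^8 := by have := pow_le_pow_left₀ bN hL 8; norm_num at this ⊢; linarith
  have hηL : η ≤ 1/(3*L) := by
    rw [hη, div_le_div_iff₀ bP bP]
    have : L^9 = L * L^8 := by ring
    rw [this]; nlinarith
  have hη1 : η ≤ 1 := hηL.trans (by rw [div_le_one (by positivity)]; linarith)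
  have hright : ∀ x : Real, η ≤ x → x ≤ 1 → δ^3/κ * |s.im| / L^7 ≤ ‖Zf (1 + x + Complex.I * s.im)‖ := by
    intro x hx hx1
    have := h341 x s.im bL hx1 hs
    have hx3 : η^3 ≤ x^3 := by gcongr
    set b := ‖Zf (1 + x + Complex.I * s.im)‖ / |s.im| with hb
    have : (δ^3/(κ*L^7))^4 ≤ b^4 := by
      have e : (δ^3/(κ*L^7))^4 = η^3/(κ^4*L) := by grind
      rw [e, div_le_iff₀ (by positivity)]; linarith
    have := le_of_pow_le_pow_left₀ (by norm_num) (by positivity) this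
    rw [hb, le_div_iff₀ (by linarith)] at this
    refine le_trans (le_of_eq ?_) this
    field_simp
  have hs_eq : ∀ w : ℂ, w.im = s.im → w = 1 + ((w.re - 1 : Real):ℂ) + Complex.I * s.im := fun w hw => by
    apply Complex.ext <;> simp [hw]
  have hhalf : δ^3/(2*κ) * |s.im| / L^7 = (δ^3/κ * |s.im| / L^7) / 2 := by field_simp
  have hpos : 0 < δ^3/κ * |s.im| / L^7 := by positivity
  by_cases hc : 1 + η ≤ s.re
  · grind
  · push Not at hc
    set w : ℂ := 1 + η + Complex.I * s.im with hw
    have hwre : w.re = 1 + η := by simp [hw]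
    have hwim : w.im = s.im := by simp [hw]
    have hw1 := hright η le_rfl hη1
    have hconv : Convex Real (Icc (1-η) (1+η) ×ℂ {s.im}) :=       ((convex_Icc _ _).linear_preimage Complex.reLm).inter
        ((convex_singleton _).linear_preimage Complex.imLm)
    have := hconv.norm_image_sub_le_of_norm_deriv_le
      (fun z hz => Zf_diff (by
        have := hz.1.1; have h6 : 1/(3*L) ≤ 1/6 := one_div_le_one_div_of_le (by norm_num) (by linarith)
        linarith))
      (fun z hz => by
        have hz2 : z.im = s.im := hz.2
        have := Zf_deriv (by rw [hz2, ← hLd]; linarith [hz.1.1]) (by linarith [hz.1.2])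
        rwa [hz2] at this)
      ⟨⟨by linarith, hc.le⟩, rfl⟩ ⟨⟨by linarith, by linarith⟩, hwim⟩
    have hdist : ‖w - s‖ ≤ 2 * η := by
      have := Complex.norm_le_abs_re_add_abs_im (w - s)
      simp only [Complex.sub_re, Complex.sub_im, hwim, sub_self, abs_zero] at this
      rw [abs_of_nonneg (by linarith)] at this; linarith
    have hb : 240 * ((|s.im| + 10) * L ^ 2) * ‖w - s‖ ≤ δ^3/(2*κ) * |s.im| / L^7 := by
      calc _ ≤ 240 * ((11 * |s.im|) * L^2) * (2 * η) := by gcongr; linarith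
        _ = (5280 * δ * κ) * (δ^3/κ * |s.im| / L^7) := by rw [hη]; field_simp; ring
        _ ≤ (1/2) * (δ^3/κ * |s.im| / L^7) := by gcongr; linarith
        _ = _ := by rw [hhalf]; ring
    have h9 := norm_sub_norm_le (Zf w) (Zf s)
    linarith

noncomputable def Wf (s : ℂ) : ℂ := (-(deriv Zf s) / Zf s - 1) / (s * (s + 1))

lemma Wf_an {s : ℂ} (h1 : 1/2 < s.re) (h2 : Zf s ≠ 0) : AnalyticAt ℂ Wf s := by
  have hZ := Zf_analytic s h1
  have hs : s * (s + 1) ≠ 0 := by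
    refine mul_ne_zero ?_ ?_ <;> intro h <;> have := congrArg Complex.re h <;> simp at this <;> linarith
  exact ((hZ.deriv.neg.div hZ h2).sub analyticAt_const).div
    (analyticAt_id.mul (analyticAt_id.add analyticAt_const)) hs

lemma Wf_bound : ∃ a C : Real, 0 < a ∧ a ≤ 1/6 ∧ 0 < C ∧ ∀ s : ℂ, 1 ≤ |s.im| →
    1 - a / LL s.im ^ 9 ≤ s.re → s.re ≤ 2 →
    Zf s ≠ 0 ∧ 1/2 < s.re ∧ ‖Wf s‖ ≤ C * LL s.im ^ 9 / |s.im| ^ 2 := by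
  obtain ⟨a, c, ha, ha6, hc, h⟩ := Zf_lower
  refine ⟨a, 2640/c + 1, ha, ha6, by positivity, fun s hs h1 h2 => ?_⟩
  have hl := h s hs h1 h2
  have hL := LL_two s.im
  set L := LL s.im with hLd
  have hlp : 0 < c * |s.im| / L ^ 7 := bP
  have hZ : 0 < ‖Zf s‖ := hlp.trans_le hl
  have hL8 : 1 ≤ L^8 := one_le_pow₀ bL
  have haL : a / L^9 ≤ 1/(3*L) := by
    rw [div_le_div_iff₀ bP bP]
    have : L^9 = L * L^8 := by ring
    rw [this]; nlinarith
  have h6 : 1/(3*L) ≤ 1/6 := one_div_le_one_div_of_le bN bL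
  refine ⟨norm_pos_iff.1 hZ, by linarith, ?_⟩
  have hd := Zf_deriv (by rw [← hLd]; linarith) h2
  rw [← hLd] at hd
  have hn : ‖-(deriv Zf s) / Zf s - 1‖ ≤ (2640/c + 1) * L^9 := by
    have h1 : ‖-(deriv Zf s) / Zf s‖ ≤ 2640/c * L^9 := by
      rw [norm_div, norm_neg, div_le_iff₀ hZ]
      calc _ ≤ 240 * ((|s.im| + 10) * L ^ 2) := hd
        _ ≤ 240 * ((11 * |s.im|) * L ^ 2) := by gcongr; linarith
        _ = 2640/c * L^9 * (c * |s.im| / L ^ 7) := by field_simp; ring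
        _ ≤ _ := by gcongr
    have := norm_sub_le (-(deriv Zf s) / Zf s) 1
    have hL9 : 1 ≤ L^9 := one_le_pow₀ bL
    rw [norm_one] at this
    linarith
  have hd2 : |s.im|^2 ≤ ‖s * (s+1)‖ := by
    rw [norm_mul, sq]
    have a := Complex.abs_im_le_norm s
    have b := Complex.abs_im_le_norm (s+1)
    simp at b
    gcongr
  rw [Wf, norm_div]
  gcongr

lemma LL_pow τ k (hk : k ≤ 45) : LL τ ^ k ≤ 90 ^ 45 * (|τ| + 10) ^ (1/2 : Real) := by
  have h := LL_two τ
  have hy : 0 < |τ| + 10 := bP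
  have h1 : LL τ ≤ (|τ|+10)^(1/90:Real) / (1/90) := log_le_rpow_div hy.le bN
  calc LL τ ^ k ≤ LL τ ^ 45 := pow_le_pow_right₀ bL hk
    _ ≤ ((|τ|+10)^(1/90:Real) / (1/90))^45 := by gcongr
    _ = _ := by
      rw [div_pow, ← rpow_natCast (((|τ|+10)^(1/90:Real))), ← rpow_mul hy.le]
      grind

lemma Wf_deriv_far n (hn : n ≤ 4) : ∃ C : Real, ∀ s : ℂ, 2 ≤ |s.im| → 1 ≤ s.re → s.re ≤ 3/2 →
    ‖iteratedDeriv n Wf s‖ ≤ C * (1 + |s.im|) ^ (-(3/2) : Real) := by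
  obtain ⟨a, C, ha, ha6, hC, h⟩ := Wf_bound
  refine ⟨n.factorial * (4 * (C * 4)) * (4/a)^n * (90^45 * 4 * 2.25), fun s hs h1 h2 => ?_⟩
  have hL := LL_two s.im
  set L := LL s.im with hLd
  set r := a / L^9 / 4 with hr
  have hr0 : 0 < r := by positivity
  have hL9 : 1 ≤ L^9 := one_le_pow₀ (by linarith)
  have hr1 : r ≤ 1/24 := by
    have : a / L^9 ≤ a := div_le_self ha.le hL9
    linarith
  have hball : ∀ z ∈ Metric.closedBall s r, 1 ≤ |z.im| ∧ 1 - a / LL z.im ^ 9 ≤ z.re ∧ z.re ≤ 2 ∧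
      LL z.im ≤ 1.1 * L ∧ |s.im| ≤ 2 * |z.im| := by
    intro z hz
    rw [Metric.mem_closedBall, Complex.dist_eq] at hz
    have a1 := Complex.abs_im_le_norm (z - s)
    have b1 := Complex.abs_re_le_norm (z - s)
    simp only [Complex.sub_im, Complex.sub_re] at a1 b1
    have hh : |z.im - s.im| ≤ 1 := by linarith
    have c1 := LL_close hh
    have d1 : |s.im| ≤ |z.im| + 1 := by grind
    have e := abs_le.1 (b1.trans hz)
    have hLz := LL_two z.im
    refine ⟨by linarith, ?_, by linarith, c1.1, by linarith⟩
    have : r ≤ a / LL z.im ^ 9 := by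
      rw [hr, div_div]
      refine div_le_div_of_nonneg_left ha.le (by positivity) ?_
      calc LL z.im ^ 9 ≤ (1.1 * L)^9 := by gcongr; exact c1.1
        _ = 1.1^9 * L^9 := by ring
        _ ≤ L^9 * 4 := by nlinarith
    linarith
  have key := Complex.norm_iteratedDeriv_le_of_forall_mem_sphere_norm_le (f := Wf) (c := s)
    (C := C * (4 * L^9) / (|s.im|/2)^2) n hr0 ?_ ?_
  · refine key.trans ?_
    have e1 : n.factorial * (C * (4 * L^9) / (|s.im|/2)^2) / r^n =
        n.factorial * (4 * (C * 4)) * (4/a)^n * (L^(9+9*n) / |s.im|^2) := by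
      have e0 : r = 1 / ((4/a) * L^9) := by grind
      have e2 : r^n = 1 / ((4/a)^n * L^(9*n)) := by rw [e0, div_pow, one_pow, mul_pow, ← pow_mul]
      grind
    rw [e1, mul_assoc _ (90^45 * 4 * 2.25)]
    refine mul_le_mul_of_nonneg_left ?_ (by positivity)
    have hp := LL_pow s.im (9+9*n) (by omega)
    rw [← hLd] at hp
    have h3 : (|s.im|+10)^(1/2:Real) ≤ 4 * (1+|s.im|)^(1/2:Real) := by
      have : (4:Real) = 16^(1/2:Real) := by linarith
      rw [this, ← mul_rpow (by norm_num) (by positivity)]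
      exact rpow_le_rpow (by positivity) (by linarith) (by norm_num)
    have h4 : (1+|s.im|)^(1/2:Real) = (1+|s.im|)^(-(3/2):Real) * (1+|s.im|)^2 := by
      rw [← rpow_natCast (1+|s.im|) 2, ← rpow_add (by positivity)]; norm_num
    rw [div_le_iff₀ (by positivity)]
    have h5 : (1+|s.im|)^2 ≤ 2.25 * |s.im|^2 := by nlinarith
    calc L^(9+9*n) ≤ 90^45 * (4 * ((1+|s.im|)^(-(3/2):Real) * (2.25 * |s.im|^2))) := by
          refine hp.trans ?_
          gcongr 90^45 * ?_
          refine h3.trans ?_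
          rw [h4]
          gcongr
      _ = _ := by ring
  · refine DifferentiableOn.diffContOnCl fun z hz => ?_
    rw [closure_ball s hr0.ne'] at hz
    obtain ⟨p1, p2, p3, p4, p5⟩ := hball z hz
    obtain ⟨q1, q2, q3⟩ := h z p1 p2 p3
    exact (Wf_an q2 q1).differentiableAt.differentiableWithinAt
  · intro z hz
    obtain ⟨p1, p2, p3, p4, p5⟩ := hball z (Metric.sphere_subset_closedBall hz)
    obtain ⟨q1, q2, q3⟩ := h z p1 p2 p3
    have hLz := LL_two z.im
    refine q3.trans ?_
    gcongr
    · calc LL z.im ^ 9 ≤ (1.1 * L)^9 := by gcongr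
        _ = 1.1^9 * L^9 := by ring
        _ ≤ 4 * L^9 := by nlinarith
    · linarith

lemma Wf_deriv n (hn : n ≤ 4) : ∃ C : Real, ∀ s : ℂ, 1 ≤ s.re → s.re ≤ 3/2 →
    ‖iteratedDeriv n Wf s‖ ≤ C * (1 + |s.im|) ^ (-(3/2) : Real) := by
  obtain ⟨C, hC⟩ := Wf_deriv_far n hn
  have hcomp : IsCompact (Icc 1 (3/2) ×ℂ Icc (-2:Real) 2) := isCompact_Icc.reProdIm isCompact_Icc
  obtain ⟨B, hB⟩ := hcomp.exists_bound_of_continuousOn (f := iteratedDeriv n Wf) fun z hz => by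
    have h1 : 1 ≤ z.re := hz.1.1
    rw [iteratedDeriv_eq_iterate]
    exact ((Wf_an bL (Zf_ne h1)).iterated_deriv n).continuousAt.continuousWithinAt
  refine ⟨max C (|B| * 3 ^ (3/2:Real)), fun s h1 h2 => ?_⟩
  have hp : 0 < (1 + |s.im|) ^ (-(3/2) : Real) := bP
  by_cases hs : 2 ≤ |s.im|
  · exact (hC s hs h1 h2).trans (by gcongr; exact le_max_left _ _)
  · push Not at hs
    have hs' := abs_le.1 hs.le
    have h3 : 1 ≤ 3^(3/2:Real) * (1 + |s.im|) ^ (-(3/2) : Real) := by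
      rw [rpow_neg bP, ← div_eq_mul_inv, one_le_div bP]
      exact rpow_le_rpow bP bL bN
    calc _ ≤ B := hB s ⟨⟨h1, h2⟩, hs'⟩
      _ ≤ |B| * 1 := by rw [mul_one]; exact le_abs_self B
      _ ≤ |B| * (3^(3/2:Real) * (1 + |s.im|) ^ (-(3/2) : Real)) := by gcongr
      _ = (|B| * 3^(3/2:Real)) * (1 + |s.im|) ^ (-(3/2) : Real) := by ring
      _ ≤ _ := by gcongr; exact le_max_right _ _

open scoped FourierTransform

lemma psi_lin : ∃ K : Real, 1 ≤ K ∧ ∀ u : Real, |Chebyshev.psi (rexp u) - rexp u| ≤ K * rexp u := by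
  refine ⟨log 4 + 4, by have := log_nonneg (show 1 ≤ 4 by norm_num); linarith, fun u => ?_⟩
  have h1 := Chebyshev.psi_le_const_mul_self (exp_pos u).le
  have h2 := Chebyshev.psi_nonneg (rexp u)
  have h3 := exp_pos u
  have := log_nonneg (show 1 ≤ 4 by norm_num)
  rw [abs_le]; constructor <;> nlinarith

lemma psi_exp_meas : Measurable fun u : Real => Chebyshev.psi (rexp u) - rexp u :=
  ((Chebyshev.psi_mono.measurable).comp measurable_exp).sub measurable_exp

noncomputable def HH (σ : Real) : Real → ℂ :=
  indicator (Ioi 0) fun u => (((Chebyshev.psi (rexp u) - rexp u) * rexp (-σ * u) : Real) : ℂ)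

noncomputable def EE (σ : Real) : Real → ℂ :=
  indicator (Ioi 0) fun u => ((rexp (-(σ+1) * u) : Real) : ℂ)

lemma HH_int {σ : Real} (hσ : 1 < σ) : Integrable (HH σ) := by
  obtain ⟨K, hK1, hK⟩ := psi_lin
  rw [HH, integrable_indicator_iff measurableSet_Ioi]
  have h1 : IntegrableOn (fun u : Real => K * rexp (-(σ-1) * u)) (Ioi 0) :=
    (exp_neg_integrableOn_Ioi 0 bL).const_mul _
  refine h1.mono' ?_ ?_
  · exact (Complex.measurable_ofReal.comp (psi_exp_meas.mul (by fun_prop))).aestronglyMeasurable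
  · refine Eventually.of_forall fun u => ?_
    rw [Complex.norm_real, norm_mul, norm_eq_abs, norm_eq_abs, abs_exp]
    calc _ ≤ (K * rexp u) * rexp (-σ * u) := by gcongr; exact hK u
      _ = _ := by rw [mul_assoc, ← exp_add]; ring_nf

lemma EE_int {σ : Real} (hσ : 1 < σ) : Integrable (EE σ) := by
  rw [EE, integrable_indicator_iff measurableSet_Ioi]
  exact (exp_neg_integrableOn_Ioi 0 bL).ofReal

lemma EE_four {σ : Real} (hσ : 1 < σ) x : 𝓕 (EE σ) x = 1 / (σ + 2 * π * x * Complex.I + 1) := by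
  rw [fourier_real_eq_integral_exp_smul, EE]
  have : (fun v : Real => Complex.exp (↑(-2 * π * v * x) * Complex.I) • indicator (Ioi 0) (fun u => ((rexp (-(σ+1) * u) : Real) : ℂ)) v)
     = indicator (Ioi 0) fun v : Real => Complex.exp (-(σ + 2 * π * x * Complex.I + 1) * v) := by
    funext v
    by_cases hv : v ∈ Ioi 0
    · simp only [indicator_of_mem hv, smul_eq_mul, Complex.ofReal_exp, ← Complex.exp_add]
      congr 1; push_cast; ring
    · simp [Set.indicator_of_notMem hv]
  rw [this, integral_indicator measurableSet_Ioi, integral_exp_mul_complex_Ioi (by simp; linarith)]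
  simp
  rw [neg_div, ← div_neg, neg_add, neg_add, neg_neg, one_div]; simp; ring_nf

lemma psi_LS {s : ℂ} (hs : 1 < s.re) :
    ∫ t in Ioi 1, ((Chebyshev.psi t - t : Real) : ℂ) * t ^ (-(s+1)) = (-(deriv Zf s) / Zf s - 1) / s := by
  have hs0 : s ≠ 0 := by intro h; rw [h] at hs; simp at hs; linarith
  have hs1 : s - 1 ≠ 0 := by intro h; rw [sub_eq_zero.1 h] at hs; simp at hs
  have hz : riemannZeta s ≠ 0 := riemannZeta_ne_zero_of_one_le_re hs.le
  have hsum : ∀ t : Real, (∑ k ∈ Finset.Icc 1 ⌊t⌋₊, ((ArithmeticFunction.vonMangoldt k : Real) : ℂ)) = ((Chebyshev.psi t : Real) : ℂ) := by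
    intro t; rw [Chebyshev.psi, ← Complex.ofReal_sum]; rfl
  have h1 := LSeries_eq_mul_integral_of_nonneg (fun n => ArithmeticFunction.vonMangoldt n) zero_le_one hs
    (by
      refine Asymptotics.IsBigO.of_bound (log 4 + 4) (Eventually.of_forall fun n => ?_)
      have h2 := Chebyshev.psi_le_const_mul_self (Nat.cast_nonneg n)
      have h3 := Chebyshev.psi_nonneg n
      have e : ∑ k ∈ Finset.Icc 1 n, ArithmeticFunction.vonMangoldt k = Chebyshev.psi n := by
        rw [Chebyshev.psi, Nat.floor_natCast]; rfl
      rw [e]; simp only [rpow_one, norm_eq_abs, abs_of_nonneg h3, Nat.abs_cast]; exact h2)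
    (fun n => ArithmeticFunction.vonMangoldt_nonneg)
  simp only [hsum] at h1
  rw [ArithmeticFunction.LSeries_vonMangoldt_eq_deriv_riemannZeta_div hs] at h1
  have hd : deriv Zf s = riemannZeta s + (s-1) * deriv riemannZeta s := by
    have : Zf =ᶠ[nhds s] fun z => (z - 1) * riemannZeta z := by
      filter_upwards [(isOpen_lt continuous_const Complex.continuous_re).mem_nhds hs] with z hz
      exact Zf_eq hz
    rw [this.deriv_eq]
    have hh := ((hasDerivAt_id s).sub_const 1).mul (differentiableAt_riemannZeta (sub_ne_zero.1 hs1)).hasDerivAt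
    have := hh.deriv
    simp only [id] at this
    rw [show (fun z => (z - 1) * riemannZeta z) = (fun x : ℂ => x - 1) * riemannZeta from rfl, this]; ring
  have i2 : IntegrableOn (fun t : Real => (t:ℂ) ^ (-s)) (Set.Ioi 1) :=
    integrableOn_Ioi_cpow_of_lt (by simpa using hs) one_pos
  have e2 : ∫ t in Set.Ioi (1:Real), (t:ℂ) * (t:ℂ) ^ (-(s+1)) = 1 / (s - 1) := by
    rw [setIntegral_congr_fun (g := fun t : Real => (t:ℂ) ^ (-s)) measurableSet_Ioi, integral_Ioi_cpow_of_lt (by simpa using hs) one_pos]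
    · simp; rw [show -s + 1 = -(s-1) by ring, neg_div_neg_eq, one_div]
    · intro t ht
      have : (t:ℂ) ≠ 0 := by simp only [Set.mem_Ioi] at ht; exact_mod_cast (by linarith : t ≠ 0)
      simp only
      rw [show -s = 1 + -(s+1) by ring, Complex.cpow_add _ _ this, Complex.cpow_one]
  have i3 : IntegrableOn (fun t : Real => (t:ℂ) * (t:ℂ) ^ (-(s+1))) (Set.Ioi 1) := by
    refine i2.congr_fun (fun t ht => ?_) measurableSet_Ioi
    have : (t:ℂ) ≠ 0 := by simp only [Set.mem_Ioi] at ht; exact_mod_cast (by linarith : t ≠ 0)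
    simp only
    rw [show -s = 1 + -(s+1) by ring, Complex.cpow_add _ _ this, Complex.cpow_one]
  have i1 : IntegrableOn (fun t : Real => ((Chebyshev.psi t : Real):ℂ) * (t:ℂ) ^ (-(s+1))) (Set.Ioi 1) := by
    refine (i3.norm.const_mul (log 4 + 4)).mono' ?_ ?_
    · exact ((Complex.measurable_ofReal.comp Chebyshev.psi_mono.measurable).mul (by fun_prop)).aestronglyMeasurable
    · refine (ae_restrict_iff' measurableSet_Ioi).2 (Filter.Eventually.of_forall fun t ht => ?_)
      have ht0 : (0:Real) ≤ t := by simp only [Set.mem_Ioi] at ht; linarith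
      rw [norm_mul, norm_mul, Complex.norm_real, Complex.norm_real, norm_of_nonneg (Chebyshev.psi_nonneg t), norm_of_nonneg ht0, ← mul_assoc]
      gcongr
      exact Chebyshev.psi_le_const_mul_self ht0
  have : ∫ t in Set.Ioi (1:Real), ((Chebyshev.psi t - t : Real) : ℂ) * (t:ℂ) ^ (-(s+1)) =
     (∫ t in Set.Ioi (1:Real), ((Chebyshev.psi t : Real):ℂ) * (t:ℂ) ^ (-(s+1))) - 1 / (s-1) := by
    rw [← e2, ← integral_sub i1 i3]
    congr 1; funext t; push_cast; ring
  rw [this, hd, Zf_eq hs]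
  have h1' : (∫ t in Set.Ioi (1:Real), ((Chebyshev.psi t : Real):ℂ) * (t:ℂ) ^ (-(s+1))) = -deriv riemannZeta s / riemannZeta s / s := by
    rw [h1]; field_simp
  rw [h1']; field_simp; ring

lemma HH_four {σ : Real} (hσ : 1 < σ) x : 𝓕 (HH σ) x =
    (-(deriv Zf (σ + 2 * π * x * Complex.I)) / Zf (σ + 2 * π * x * Complex.I) - 1) / (σ + 2 * π * x * Complex.I) := by
  rw [← psi_LS (by simpa using hσ), fourier_real_eq_integral_exp_smul, HH]
  rw [show 1 = rexp 0 by simp, ← integral_comp_exp_Ioi, ← integral_indicator measurableSet_Ioi]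
  congr 1; funext v
  by_cases hv : v ∈ Ioi 0
  · simp only [indicator_of_mem hv, Complex.real_smul]
    rw [Complex.ofReal_exp, Complex.cpow_def_of_ne_zero (Complex.exp_ne_zero _), ← Complex.ofReal_exp, ← Complex.ofReal_log (exp_pos v).le, log_exp]
    push_cast
    have : Complex.exp (-2 * π * v * x * Complex.I) * Complex.exp (-σ * v) = Complex.exp v * Complex.exp (v * (-(σ + 2 * π * x * Complex.I + 1))) := by
      rw [← Complex.exp_add, ← Complex.exp_add]; congr 1; ring
    linear_combination ((Chebyshev.psi (rexp v) : ℂ) - Complex.exp v) * this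
  · simp [Set.indicator_of_notMem hv]

noncomputable def SS (u : Real) : Real := ∫ v in 0..u, (Chebyshev.psi (rexp v) - rexp v) * rexp v

lemma SS_int (a b : Real) : IntervalIntegrable (fun v => (Chebyshev.psi (rexp v) - rexp v) * rexp v) volume a b := by
  have h1 : Monotone fun v => Chebyshev.psi (rexp v) := Chebyshev.psi_mono.comp exp_monotone
  exact ((h1.intervalIntegrable).sub (continuous_exp.intervalIntegrable _ _)).mul_continuousOn (continuous_exp.continuousOn)

lemma conv_eq {σ u : Real} (hu : 0 < u) :
    convolution (HH σ) (EE σ) (ContinuousLinearMap.mul ℂ ℂ) volume u = ((rexp (-(σ+1)*u) * SS u : Real) : ℂ) := by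
  rw [convolution_def, SS, iole hu.le, ← integral_Ioc_eq_integral_Ioo.symm, ← integral_const_mul,
    ← integral_complex_ofReal, ← integral_indicator measurableSet_Ioo]
  congr 1; funext v
  simp only [HH, EE, ContinuousLinearMap.mul_apply']
  by_cases h1 : 0 < v
  · by_cases h2 : v < u
    · rw [indicator_of_mem (show v ∈ Ioi 0 from h1), indicator_of_mem (show u - v ∈ Ioi 0 from sub_pos.2 h2),
        indicator_of_mem (show v ∈ Ioo 0 u from ⟨h1, h2⟩), ← Complex.ofReal_mul]
      congr 1
      rw [mul_assoc, ← exp_add, mul_left_comm, ← exp_add]; ring_nf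
    · rw [indicator_of_notMem (show u - v ∉ Ioi 0 from fun h => h2 (sub_pos.1 h)),
        indicator_of_notMem (show v ∉ Ioo 0 u from fun h => h2 h.2), mul_zero]
  · rw [indicator_of_notMem (show v ∉ Ioi 0 from h1),
        indicator_of_notMem (show v ∉ Ioo 0 u from fun h => h1 h.1), zero_mul]

lemma Wf_line n {σ : Real} (hσ : 1 < σ) :
    iteratedDeriv n (fun x : Real => Wf (σ + 2 * π * x * Complex.I)) =
      (fun x : Real => (2 * π * Complex.I : ℂ)^n * iteratedDeriv n Wf (σ + 2 * π * x * Complex.I)) ∧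
    ∀ x : Real, DifferentiableAt Real (iteratedDeriv n (fun x : Real => Wf (σ + 2 * π * x * Complex.I))) x := by
  have key : ∀ n : ℕ, ∀ x : Real, HasDerivAt (fun x : Real => iteratedDeriv n Wf (σ + 2 * π * x * Complex.I))
      (iteratedDeriv (n+1) Wf (σ + 2 * π * x * Complex.I) * (2 * π * Complex.I)) x := by
    intro n x
    have h1 : DifferentiableAt ℂ (iteratedDeriv n Wf) ((σ:ℂ) + 2 * π * x * Complex.I) := by
      rw [iteratedDeriv_eq_iterate]
      exact ((Wf_an (by simp; linarith) (Zf_ne (by simp; linarith))).iterated_deriv n).differentiableAt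
    have h2 : HasDerivAt (fun x : Real => σ + 2 * π * x * Complex.I) (2 * π * Complex.I) x := by
      have := (((Complex.ofRealCLM.hasDerivAt (x := x)).const_mul (2 * π : ℂ)).mul_const Complex.I).const_add (σ:ℂ)
      simpa using this
    have h3 := h1.hasDerivAt.comp x h2
    rw [← iteratedDeriv_succ] at h3
    exact h3
  have e : ∀ n : ℕ, iteratedDeriv n (fun x : Real => Wf (σ + 2 * π * x * Complex.I)) =
      fun x : Real => (2 * π * Complex.I : ℂ)^n * iteratedDeriv n Wf (σ + 2 * π * x * Complex.I) := by
    intro n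
    induction n with
    | zero => simp
    | succ n ih =>
      rw [iteratedDeriv_succ, ih]; funext x
      rw [((key n x).const_mul _).deriv]; ring
  refine ⟨e n, fun x => ?_⟩
  rw [e n]
  exact ((key n x).const_mul _).differentiableAt

lemma Wf_line_bd n (hn : n ≤ 4) : ∃ C : Real, 0 ≤ C ∧ ∀ σ : Real, 1 < σ → σ ≤ 3/2 → ∀ x : Real,
    ‖iteratedDeriv n (fun x : Real => Wf (σ + 2 * π * x * Complex.I)) x‖ ≤ C * (1 + ‖x‖) ^ (-(3/2) : Real) := by
  obtain ⟨C, hC⟩ := Wf_deriv n hn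
  refine ⟨(2*π)^n * |C|, by positivity, fun σ h1 h2 x => ?_⟩
  rw [(Wf_line n h1).1]
  have hn2 : ‖(2 * π * Complex.I : ℂ)^n‖ = (2*π)^n := by simp [abs_of_pos pi_pos]
  simp only [norm_mul]
  rw [hn2, mul_assoc ((2*π)^n)]
  refine mnl ?_ (show 0 ≤ (2*π)^n by positivity)
  refine (hC (σ + 2 * π * x * Complex.I) (by simp; linarith) (by simp; linarith)).trans ?_
  have e : (σ + 2 * π * x * Complex.I).im = 2 * π * x := by simp
  rw [e]
  calc _ ≤ |C| * (1 + |2 * π * x|) ^ (-(3/2) : Real) := by gcongr; exact le_abs_self C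
    _ ≤ _ := by
      gcongr |C| * ?_
      refine rpow_le_rpow_of_nonpos bP ?_ bN
      rw [abs_mul, abs_of_pos (by positivity), norm_eq_abs]
      have := pi_gt_three
      nlinarith [abs_nonneg x]

lemma SS_bound_aux : ∃ C : Real, ∀ σ : Real, 1 < σ → σ ≤ 3/2 → ∀ u : Real, 0 < u →
    u^4 * (rexp (-(σ+1)*u) * |SS u|) ≤ C := by
  obtain ⟨C, hC0, hC⟩ := Wf_line_bd 4 le_rfl
  have hI : Integrable (fun x : Real => (1 + ‖x‖) ^ (-(3/2) : Real)) := integrable_one_add_norm bN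
  refine ⟨∫ x : Real, C * (1 + ‖x‖) ^ (-(3/2) : Real), fun σ h1 h2 u hu => ?_⟩
  set g : Real → ℂ := fun x : Real => Wf (σ + 2 * π * x * Complex.I) with hg
  set cv := convolution (HH σ) (EE σ) (ContinuousLinearMap.mul ℂ ℂ) volume with hcv
  have f1 : 𝓕 cv = g := by
    funext x
    rw [hcv, fourier_mul_convolution_eq (HH_int h1) (EE_int h1), HH_four h1, EE_four h1, hg]; simp only [Wf]
    rw [div_mul_div_comm, mul_one]
  have gsm : ContDiff Real (4:ℕ∞) g := contDiff_of_differentiable_iteratedDeriv fun m _ x => (Wf_line m h1).2 x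
  have gint : ∀ n : ℕ, (n:ℕ∞) ≤ 4 → Integrable (iteratedDeriv n g) := by
    intro n hn
    have hn' : n ≤ 4 := by exact_mod_cast hn
    obtain ⟨D, -, hD⟩ := Wf_line_bd n hn'
    refine (hI.const_mul D).mono' ?_ (Eventually.of_forall fun x => hD σ h1 h2 x)
    exact (continuous_iff_continuousAt.2 fun x => ((Wf_line n h1).2 x).continuousAt).aestronglyMeasurable
  have cint : Integrable cv := (HH_int h1).integrable_convolution _ (EE_int h1)
  have cc : ContinuousAt cv u := by
    have : (fun u : Real => ((rexp (-(σ+1)*u) * SS u : Real) : ℂ)) =ᶠ[nhds u] cv := by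
      filter_upwards [lt_mem_nhds hu] with v hv
      rw [hcv, conv_eq hv]
    refine ContinuousAt.congr ?_ this
    have c2 : Continuous SS := intervalIntegral.continuous_primitive SS_int 0
    exact (Complex.continuous_ofReal.comp ((by fun_prop : Continuous fun u => rexp (-(σ+1)*u)).mul c2)).continuousAt
  have g0 : Integrable g := by have := gint 0 (by simp); simpa using this
  have inv := Integrable.fourierInv_fourier_eq cint (by rw [f1]; exact g0) cc
  rw [f1, fourierInv_eq_fourier_neg, hcv, conv_eq hu] at inv
  have f4 := congrFun (fourier_iteratedDeriv gsm gint (n := 4) (by simp)) (-u)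
  rw [inv] at f4
  have b1 : ‖𝓕 (iteratedDeriv 4 g) (-u)‖ ≤ ∫ x : Real, C * (1 + ‖x‖) ^ (-(3/2) : Real) := by
    rw [fourier_real_eq_integral_exp_smul]
    refine (norm_integral_le_integral_norm _).trans (integral_mono_of_nonneg (Eventually.of_forall fun x => norm_nonneg _) (hI.const_mul C) (Eventually.of_forall fun x => ?_))
    simp only [norm_smul, Complex.norm_exp_ofReal_mul_I, one_mul]
    exact hC σ h1 h2 x
  rw [f4, norm_smul, Complex.norm_real, norm_mul, norm_eq_abs, norm_eq_abs, abs_exp] at b1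
  refine le_trans ?_ b1
  gcongr
  simp only [norm_pow, norm_mul, Complex.norm_I, Complex.norm_real, norm_of_nonneg pi_pos.le, Complex.norm_ofNat, norm_eq_abs, abs_neg, abs_of_pos hu]
  gcongr
  have := pi_gt_three
  nlinarith

lemma SS_bound : ∃ C : Real, 0 ≤ C ∧ ∀ u : Real, 0 < u → |SS u| ≤ C * rexp (2*u) / u^4 := by
  obtain ⟨C, hC⟩ := SS_bound_aux
  refine ⟨max C 0, le_max_right _ _, fun u hu => ?_⟩
  have h1 : u^4 * (rexp (-(1+1)*u) * |SS u|) ≤ C := by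
    have ht : Tendsto (fun σ : Real => u^4 * (rexp (-(σ+1)*u) * |SS u|)) (nhdsWithin 1 (Ioi 1)) (nhds (u^4 * (rexp (-(1+1)*u) * |SS u|))) := by
      apply Tendsto.mono_left _ nhdsWithin_le_nhds
      exact (by fun_prop : Continuous fun σ : Real => u^4 * (rexp (-(σ+1)*u) * |SS u|)).tendsto 1
    refine le_of_tendsto ht ?_
    filter_upwards [Ioo_mem_nhdsGT (show 1 < 3/2 by norm_num)] with σ hσ
    exact hC σ hσ.1 hσ.2.le u hu
  rw [le_div_iff₀ bP]
  have e : rexp (2*u) * rexp (-(1+1)*u) = 1 := by rw [← exp_add]; ring_nf; simp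
  calc |SS u| * u^4 = rexp (2*u) * (u^4 * (rexp (-(1+1)*u) * |SS u|)) := by linear_combination (-|SS u| * u^4) * e
    _ ≤ rexp (2*u) * max C 0 := by gcongr; exact h1.trans (le_max_left _ _)
    _ = _ := mul_comm _ _

lemma pnt_alg {X p P C δ : Real} (hC0 : 0 ≤ C) (hX0 : 0 < X) (hδ0 : 0 < δ) (hδ1 : δ ≤ 1/4) (p1 : 1 + δ ≤ p) (p2 : p ≤ 1 + 2*δ)
    (g1 : P * (X * p - X) ≤ 5 * (C * X^2*δ^2) + (X^2*p^2 - X^2)/2)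
    (g2 : (X^2 - X^2/p^2)/2 - 17 * (C * X^2*δ^2) ≤ P * (X - X/p)) : |P - X| ≤ (100 * C + 100) * X * δ := by
  have ppos : 0 < p := bL
  have hq : 0 < X * (p - 1) := by apply mul_pos hX0; linarith
  have h1 : P - X ≤ (5*C + 1) * X * δ := by
    have : P * (X * (p-1)) ≤ (X + (5*C+1)*X*δ) * (X * (p-1)) := by
      have w1 : 5 * (C * X^2*δ^2) ≤ 5 * C * X^2 * δ * (p-1) := by
        have := mnl (show δ ≤ p - 1 by linarith) (show 0 ≤ C * X^2 * δ by positivity)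
        nlinarith
      have w2 : X^2 * (p-1)^2 / 2 ≤ X^2 * δ * (p-1) := by
        have h0 : 0 ≤ p - 1 := bL
        have := mnl (show p - 1 ≤ 2 * δ by linarith) (show 0 ≤ X^2 * (p-1) by positivity)
        linarith
      linarith
    have := le_of_mul_le_mul_right this hq
    linarith
  have h2 : -((17*C*2 + 2) * X * δ) ≤ P - X := by
    have : (X - (17*C*2+2)*X*δ) * (X * (p-1)) ≤ P * (X * (p-1)) := by
      have g3 : ((X^2 - X^2/p^2)/2 - 17 * (C * X^2*δ^2)) * p ≤ P * (X - X/p) * p := by gcongr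
      have r1 : P * (X - X/p) * p = P * (X * (p-1)) := by field_simp
      rw [← r1]; refine le_trans ?_ g3
      have r2 : (X^2 - X^2/p^2)/2 * p = X^2 * (p-1) * (p+1) / (2 * p) := by field_simp; ring
      have r3 : X^2 * (p-1) * (1 - δ * 2) ≤ X^2 * (p-1) * (p+1) / (2 * p) := by
        rw [mul_div_assoc]
        have : 0 ≤ p - 1 := bL
        gcongr
        rw [le_div_iff₀ bP]
        nlinarith
      have w1 : 17 * (C * X^2*δ^2) * p ≤ 17 * C * 2 * X^2 * δ * (p-1) := by
        have : 0 ≤ C * X^2 * δ := bP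
        have h9 : δ * p ≤ 2 * (p-1) := by nlinarith
        have := mnl h9 this
        linarith
      rw [sub_mul, sub_mul, r2]
      linarith
    have := le_of_mul_le_mul_right this hq
    linarith
  rw [abs_le]
  have : 0 ≤ C * X * δ := bP
  have : 0 ≤ X * δ := bP
  constructor <;> linarith

lemma pnt_exp : ∃ C : Real, 0 ≤ C ∧ ∀ u : Real, 2 ≤ u → |Chebyshev.psi (rexp u) - rexp u| ≤ C * rexp u / u^2 := by
  obtain ⟨C, hC0, hC⟩ := SS_bound
  refine ⟨100 * C + 100, by positivity, fun u hu => ?_⟩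
  set δ := 1 / u^2 with hδ
  have hu2 : 4 ≤ u^2 := by nlinarith
  have hδ0 : 0 < δ := by positivity
  have hδ1 : δ ≤ 1/4 := by rw [hδ]; gcongr
  have key : ∀ a b : Real, SS b - SS a = (∫ v in a..b, Chebyshev.psi (rexp v) * rexp v) - (rexp (2*b) - rexp (2*a))/2 := by
    intro a b
    have i1 : IntervalIntegrable (fun v => Chebyshev.psi (rexp v) * rexp v) volume a b :=
      (Chebyshev.psi_mono.comp exp_monotone).intervalIntegrable.mul_continuousOn continuous_exp.continuousOn
    have i2 : IntervalIntegrable (fun v => rexp (2*v)) volume a b := (by fun_prop : Continuous fun v => rexp (2*v)).intervalIntegrable _ _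
    have e2 : ∫ v in a..b, rexp (2*v) = (rexp (2*b) - rexp (2*a))/2 := by
      rw [intervalIntegral.integral_comp_mul_left (fun v => rexp v) two_ne_zero, integral_exp]; simp; ring
    rw [SS, SS, intervalIntegral.integral_interval_sub_left (SS_int _ _) (SS_int _ _), ← e2, ← intervalIntegral.integral_sub i1 i2]
    congr 1; funext v; rw [sub_mul, ← exp_add]; ring_nf
  have i1 : ∀ a b, IntervalIntegrable (fun v => Chebyshev.psi (rexp v) * rexp v) volume a b := fun a b =>
      (Chebyshev.psi_mono.comp exp_monotone).intervalIntegrable.mul_continuousOn continuous_exp.continuousOn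
  have k1 : Chebyshev.psi (rexp u) * (rexp (u+δ) - rexp u) ≤ ∫ v in u..(u+δ), Chebyshev.psi (rexp v) * rexp v := by
    rw [← integral_exp, ← intervalIntegral.integral_const_mul]
    refine intervalIntegral.integral_mono_on (by linarith) ((by fun_prop : Continuous fun v => Chebyshev.psi (rexp u) * rexp v).intervalIntegrable _ _) (i1 _ _) fun v hv => ?_
    gcongr; exact hv.1
  have k2 : (∫ v in (u-δ)..u, Chebyshev.psi (rexp v) * rexp v) ≤ Chebyshev.psi (rexp u) * (rexp u - rexp (u-δ)) := by
    rw [← integral_exp, ← intervalIntegral.integral_const_mul]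
    refine intervalIntegral.integral_mono_on (by linarith) (i1 _ _) ((by fun_prop : Continuous fun v => Chebyshev.psi (rexp u) * rexp v).intervalIntegrable _ _) fun v hv => ?_
    gcongr; exact hv.2
  have a1 := hC u (by linarith)
  have a2 := hC (u+δ) (by linarith)
  have a3 := hC (u-δ) (by linarith)
  have q1 := key u (u+δ)
  have q2 := key (u-δ) u
  set X := rexp u with hX
  set p := rexp δ with hp
  set P := Chebyshev.psi X
  have hX0 : 0 < X := exp_pos u
  have e1 : rexp (u+δ) = X * p := exp_add _ _
  have e2 : rexp (u-δ) = X / p := exp_sub _ _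
  have e3 : rexp (2*u) = X^2 := by rw [hX, ← exp_nat_mul]; norm_num
  have e4 : rexp (2*(u+δ)) = X^2 * p^2 := by rw [mul_add, exp_add, e3, hp, ← exp_nat_mul δ]; norm_num
  have e5 : rexp (2*(u-δ)) = X^2 / p^2 := by rw [mul_sub, exp_sub, e3, hp, ← exp_nat_mul δ]; norm_num
  have p1 : 1 + δ ≤ p := by have := add_one_le_exp δ; linarith
  have p2 : p ≤ 1 + 2*δ := by
    have := Real.abs_exp_sub_one_le (x := δ) (by rw [abs_of_pos hδ0]; linarith)
    rw [abs_of_pos hδ0] at this; have := (abs_le.1 this).2; linarith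
  have ppos : 0 < p := by linarith
  have b4 : 1/u^4 = δ^2 := by rw [hδ]; ring
  have s1 : |SS u| ≤ C * X^2 * δ^2 := by grind
  have s2 : |SS (u+δ)| ≤ 4 * (C * X^2 * δ^2) := by
    rw [e4] at a2
    calc _ ≤ _ := a2
      _ ≤ C * (X^2 * 2^2) / u^4 := by gcongr <;> linarith
      _ = 4 * (C * X^2 * (1/u^4)) := by ring
      _ = _ := by rw [b4]
  have s3 : |SS (u-δ)| ≤ 16 * (C * X^2 * δ^2) := by
    rw [e5] at a3
    have : u / 2 ≤ u - δ := by linarith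
    calc _ ≤ _ := a3
      _ ≤ C * (X^2 / 1^2) / (u/2)^4 := by gcongr; linarith
      _ = 16 * (C * X^2 * (1/u^4)) := by ring
      _ = _ := by rw [b4]
  rw [e3, e4] at q1
  rw [e3, e5] at q2
  rw [e1] at k1
  rw [e2] at k2
  have g1 : P * (X * p - X) ≤ 5 * (C * X^2*δ^2) + (X^2*p^2 - X^2)/2 := by grind
  have g2 : (X^2 - X^2/p^2)/2 - 17 * (C * X^2*δ^2) ≤ P * (X - X/p) := by grind
  have e : (100 * C + 100) * X / u^2 = (100 * C + 100) * X * δ := by grind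
  rw [e]
  exact pnt_alg hC0 hX0 hδ0 hδ1 p1 p2 g1 g2

theorem pnt : ∃ C : Real, 0 < C ∧ ∀ x : Real, 2 ≤ x → |Chebyshev.psi x - x| ≤ C * x / (log x)^2 := by
  obtain ⟨C, hC0, hC⟩ := pnt_exp
  obtain ⟨K, hK1, hK⟩ := psi_lin
  refine ⟨C + 4 * K, by positivity, fun x hx => ?_⟩
  have hx0 : 0 < x := by linarith
  have hl : 0 < log x := log_pos (by linarith)
  by_cases h : 2 ≤ log x
  · have := hC (log x) h
    rw [exp_log hx0] at this
    refine this.trans ?_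
    gcongr; linarith
  · push Not at h
    have := hK (log x)
    rw [exp_log hx0] at this
    refine this.trans ?_
    rw [le_div_iff₀ bP]
    have : (log x)^2 ≤ 4 := by nlinarith
    have : 0 ≤ C * x := bP
    calc K * x * (log x)^2 ≤ K * x * 4 := by gcongr
      _ ≤ _ := by nlinarith

structure XI (ξ : Real → Real) : Prop where
  z : ∀ u : Real, u < 1 → ξ u = 0
  e : ∀ u : Real, 1 ≤ u → u * ξ u = 2 + 2 * ∫ t in 1..(u - 1), ξ t

noncomputable def DX (ξ : Real → Real) (u : Real) : Real := 1 + ∫ t in 1..u, ξ t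

noncomputable def PP (u : Real) : Real := (u+1)*(u+3)/2

section

variable {ξ : Real → Real} (h : XI ξ)

include h

lemma XI.intOn {B : Real} (hc : ContinuousOn ξ (Icc 1 B)) : IntegrableOn ξ (Iic B) := by
  have h1 : IntegrableOn ξ (Iio 1) := (integrableOn_zero (ε' := Real)).congr_fun (fun u hu => (h.z u hu).symm) measurableSet_Iio
  have h2 : IntegrableOn ξ (Icc 1 B) := hc.integrableOn_Icc
  refine (h1.union h2).mono_set fun u hu => ?_
  rcases lt_or_ge u 1 with h3 | h3
  · exact Or.inl h3
  · exact Or.inr ⟨h3, hu⟩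

lemma XI.cont_aux (n : ℕ) : ContinuousOn ξ (Icc 1 (n+1)) := by
  induction n with
  | zero => simp
  | succ n ih =>
    have h1 := h.intOn ih
    have h2 : ContinuousOn (fun u => ∫ t in 1..u, ξ t) (uIcc 0 (n+1)) := by
      refine intervalIntegral.continuousOn_primitive_interval' ?_ ?_
      · rw [intervalIntegrable_iff_integrableOn_Icc_of_le bP]
        exact h1.mono_set Icc_subset_Iic_self
      · rw [uIcc_of_le bP]; exact ⟨by norm_num, by linarith⟩
    rw [uIcc_of_le bP] at h2
    have h3 : ContinuousOn (fun u => (2 + 2 * ∫ t in 1..(u-1), ξ t) / u) (Icc 1 ((n+1:ℕ)+1)) := by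
      refine ContinuousOn.div ?_ continuousOn_id fun u hu => by have := hu.1; show u ≠ 0; linarith
      refine continuousOn_const.add (continuousOn_const.mul ?_)
      refine h2.comp (by fun_prop) fun u hu => ?_
      have := hu.1; have h4 := hu.2; push_cast at h4
      exact ⟨by linarith, by linarith⟩
    refine h3.congr fun u hu => ?_
    have h5 := h.e u hu.1
    have : u ≠ 0 := by linarith [hu.1]
    rw [eq_div_iff this]; linarith

lemma XI.cont : ContinuousOn ξ (Ici 1) := by
  intro u hu
  obtain ⟨n, hn⟩ := exists_nat_gt u
  have := h.cont_aux n u ⟨hu, by linarith⟩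
  refine this.mono_of_mem_nhdsWithin ?_
  have : Icc 1 ((n:Real)+1) = Ici 1 ∩ Iic ((n:Real)+1) := rfl
  rw [this]
  exact inter_mem self_mem_nhdsWithin (mem_nhdsWithin_of_mem_nhds (Iic_mem_nhds bL))

lemma XI.int (a b : Real) : IntervalIntegrable ξ volume a b := by
  rw [intervalIntegrable_iff]
  exact (h.intOn (h.cont.mono fun u hu => hu.1)).mono_set fun u hu => hu.2

lemma XI.meas : Measurable ξ := by
  have e : ξ = (Ici 1).piecewise ξ (fun _ => 0) := by
    funext u
    by_cases hu : u ∈ Ici 1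
    · simp [hu]
    · rw [piecewise_eq_of_notMem _ _ _ hu]; exact h.z u (not_le.1 hu)
  rw [e]
  exact h.cont.measurable_piecewise continuousOn_const measurableSet_Ici

lemma XI.DXcont : Continuous (DX ξ) := continuous_const.add (intervalIntegral.continuous_primitive h.int 1)

lemma XI.DX1 {u : Real} (hu : u ≤ 1) : DX ξ u = 1 := by
  have : ∫ t in 1..u, ξ t = 0 := by
    rw [intervalIntegral.integral_symm, neg_eq_zero, iole hu, ← integral_Ioc_eq_integral_Ioo.symm,
      scf measurableSet_Ioo (fun t ht => h.z t ht.2)]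
    simp
  rw [DX, this, add_zero]

lemma XI.eq {u : Real} (hu : 1 ≤ u) : ξ u = 2 * DX ξ (u-1) / u := by
  have := h.e u hu
  rw [eq_div_iff bL, DX]; linarith

lemma XI.DXd {u : Real} (hu : 1 < u) : HasDerivAt (DX ξ) (ξ u) u := by
  refine HasDerivAt.const_add _ ?_
  refine intervalIntegral.integral_hasDerivAt_right (h.int _ _) (h.meas.stronglyMeasurable.stronglyMeasurableAtFilter) ?_
  exact h.cont.continuousAt (Ici_mem_nhds hu)

lemma XI.v12 {u : Real} (h1 : 1 ≤ u) (h2 : u ≤ 2) : ξ u = 2 / u := by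
  rw [h.eq h1, h.DX1 bL, mul_one]

lemma XI.D12 {u : Real} (h1 : 1 ≤ u) (h2 : u ≤ 2) : DX ξ u = 1 + 2 * log u := by
  rw [DX, icg]
  · rw [icm, integral_inv_of_pos one_pos bL, div_one]
  · intro t ht
    rw [uIcc_of_le h1] at ht
    simp only
    rw [h.v12 ht.1 (ht.2.trans h2)]; rfl

lemma XI.v23 {u : Real} (h1 : 2 ≤ u) (h2 : u ≤ 3) : ξ u = (2 + 4 * log (u-1)) / u := by
  rw [h.eq bL, h.D12 bL bL]; ring

lemma XI.d {u : Real} (hu : 1 < u) (hu2 : u ≠ 2) : HasDerivAt ξ ((2 * ξ (u-1) - ξ u)/u) u := by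
  have hd : HasDerivAt (DX ξ) (ξ (u-1)) (u-1) := by
    rcases lt_or_gt_of_ne hu2 with h3 | h3
    · rw [h.z (u-1) (by linarith)]
      refine (hasDerivAt_const (u-1) (1:Real)).congr_of_eventuallyEq ?_
      filter_upwards [Iio_mem_nhds (show u - 1 < 1 by linarith)] with v hv
      exact h.DX1 (le_of_lt hv)
    · exact h.DXd (by linarith)
  have h1 : HasDerivAt (fun v => 2 * DX ξ (v-1) / v) ((2 * ξ (u-1) * u - 2 * DX ξ (u-1) * 1) / u^2) u := by
    have h2 : HasDerivAt (fun v => DX ξ (v-1)) (ξ (u-1)) u := by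
      have := HasDerivAt.comp u (h₂ := DX ξ) (h := fun v => v - 1) (by simpa using hd) ((hasDerivAt_id u).sub_const 1)
      simpa using! this
    exact (h2.const_mul 2).div (hasDerivAt_id u) (by linarith)
  have h4 : HasDerivAt ξ ((2 * ξ (u-1) * u - 2 * DX ξ (u-1) * 1) / u^2) u := by
    refine h1.congr_of_eventuallyEq ?_
    filter_upwards [Ioi_mem_nhds hu] with v hv
    exact h.eq (le_of_lt hv)
  convert h4 using 1
  have := h.eq hu.le
  have h0 : u ≠ 0 := by linarith
  rw [this]; field_simp

lemma XI.step {a b n : Real} (hn : 1 ≤ n) (hb : ∀ u, n ≤ u → u ≤ n+1 → a * PP u ≤ DX ξ u ∧ DX ξ u ≤ b * PP u) :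
    ∀ u, n+1 ≤ u → u ≤ n+2 → DX ξ (n+1) + a * (PP u - PP (n+1)) ≤ DX ξ u ∧ DX ξ u ≤ DX ξ (n+1) + b * (PP u - PP (n+1)) := by
  intro u h1 h2
  have key : ∀ s, ∀ x, HasDerivAt (fun u => DX ξ (n+1) + s * (PP u - PP (n+1))) (s * (x+2)) x := by
    intro s x
    have : HasDerivAt PP (x+2) x := by
      have := ((((hasDerivAt_id x).add_const 1).mul ((hasDerivAt_id x).add_const 3)).div_const 2)
      refine this.congr_deriv ?_
      simp only [id]; ring
    exact ((this.sub_const _).const_mul s).const_add _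
  have hP : ∀ x, 0 < x → 2 * PP (x-1) / x = x + 2 := by intro x hx; rw [PP]; field_simp; ring
  have hx : ∀ x, n+1 ≤ x → x ≤ n+2 → a * (x+2) ≤ ξ x ∧ ξ x ≤ b * (x+2) := by
    intro x h3 h4
    have := hb (x-1) (by linarith) (by linarith)
    rw [h.eq (by linarith), ← hP x (by linarith)]
    have hx0 : 0 < x := by linarith
    constructor
    · rw [mul_div_assoc', div_le_div_iff_of_pos_right hx0]; linarith
    · rw [mul_div_assoc', div_le_div_iff_of_pos_right hx0]; linarith
  have hc : ∀ s : Real, ContinuousOn (fun u => DX ξ (n+1) + s * (PP u - PP (n+1))) (Set.Icc (n+1) (n+2)) := by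
    intro s x _; exact (key s x).continuousAt.continuousWithinAt
  constructor
  · refine image_le_of_deriv_right_le_deriv_boundary (f := fun u => DX ξ (n+1) + a * (PP u - PP (n+1))) (f' := fun x => a * (x+2)) (B := DX ξ) (B' := ξ) (a := n+1) (b := n+2) (hc a)
      (fun x _ => (key a x).hasDerivWithinAt) (by simp) h.DXcont.continuousOn (fun x hx' => (h.DXd (by linarith [hx'.1])).hasDerivWithinAt)
      (fun x hx' => (hx x hx'.1 hx'.2.le).1) ⟨h1, h2⟩
  · refine image_le_of_deriv_right_le_deriv_boundary (B := fun u => DX ξ (n+1) + b * (PP u - PP (n+1))) (B' := fun x => b * (x+2)) (f := DX ξ) (f' := ξ) (a := n+1) (b := n+2) h.DXcont.continuousOn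
      (fun x hx' => (h.DXd (by linarith [hx'.1])).hasDerivWithinAt) (by simp) (hc b) (fun x _ => (key b x).hasDerivWithinAt)
      (fun x hx' => (hx x hx'.1 hx'.2.le).2) ⟨h1, h2⟩

end

lemma log_lo {y : Real} (hy : 0 ≤ y) : 3*y*(y+2)/(y^2+6*y+6) ≤ log (1+y) := by
  have key := image_le_of_deriv_right_le_deriv_boundary (f := fun y : Real => 3*y*(y+2)/(y^2+6*y+6)) (f' := fun y => ((6*y+6)*(y^2+6*y+6) - 3*y*(y+2)*(2*y+6))/(y^2+6*y+6)^2)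
    (B := fun y => log (1+y)) (B' := fun y => 1/(1+y)) ?_ ?_ (by simp) ?_ ?_ ?_ ⟨hy, le_rfl⟩
  · exact key
  · intro x hx; have := hx.1
    have : x^2+6*x+6 ≠ 0 := bP
    fun_prop
  · intro x hx
    have := hx.1
    have h0 : x^2+6*x+6 ≠ 0 := bP
    have h1 : HasDerivAt (fun y : Real => 3*y*(y+2)) (6*x+6) x :=
      (((hasDerivAt_id x).const_mul 3).mul ((hasDerivAt_id x).add_const 2)).congr_deriv (by simp only [id]; ring)
    have h2 : HasDerivAt (fun y : Real => y^2+6*y+6) (2*x+6) x :=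
      (((hasDerivAt_pow 2 x).add ((hasDerivAt_id x).const_mul 6)).add_const 6).congr_deriv (by simp)
    exact (h1.div h2 h0).hasDerivWithinAt
  · intro x hx; have := hx.1
    have : 1 + x ≠ 0 := by positivity
    fun_prop
  · intro x hx; have := hx.1
    exact (((hasDerivAt_id x).const_add 1).log (by simp; positivity)).hasDerivWithinAt
  · intro x hx; have := hx.1
    rw [div_le_div_iff₀ bP bP]
    nlinarith

lemma log_up {y : Real} (hy : 0 ≤ y) : log (1+y) ≤ y*(30+21*y+y^2)/(30+36*y+9*y^2) := by
  have key := image_le_of_deriv_right_le_deriv_boundary (B := fun y : Real => y*(30+21*y+y^2)/(30+36*y+9*y^2)) (B' := fun y => ((30+42*y+3*y^2)*(30+36*y+9*y^2) - y*(30+21*y+y^2)*(36+18*y))/(30+36*y+9*y^2)^2)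
    (f := fun y => log (1+y)) (f' := fun y => 1/(1+y)) ?_ ?_ (by simp) ?_ ?_ ?_ ⟨hy, le_rfl⟩
  · exact key
  · intro x hx; have := hx.1
    have : 1 + x ≠ 0 := bP
    fun_prop
  · intro x hx; have := hx.1
    exact (((hasDerivAt_id x).const_add 1).log (by simp; positivity)).hasDerivWithinAt
  · intro x hx; have := hx.1
    have : 30+36*x+9*x^2 ≠ 0 := bP
    fun_prop
  · intro x hx
    have := hx.1
    have h0 : 30+36*x+9*x^2 ≠ 0 := bP
    have h1 : HasDerivAt (fun y : Real => y*(30+21*y+y^2)) (30+42*x+3*x^2) x :=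
      ((hasDerivAt_id x).mul ((((hasDerivAt_id x).const_mul 21).const_add 30).add (hasDerivAt_pow 2 x))).congr_deriv (by simp; ring)
    have h2 : HasDerivAt (fun y : Real => 30+36*y+9*y^2) (36+18*x) x :=
      ((((hasDerivAt_id x).const_mul 36).const_add 30).add ((hasDerivAt_pow 2 x).const_mul 9)).congr_deriv (by simp; ring)
    exact (h1.div h2 h0).hasDerivWithinAt
  · intro x hx; have := hx.1
    rw [div_le_div_iff₀ bP bP]
    nlinarith [pow_nonneg this 5]

noncomputable def Il (y : Real) : Real := y+0.7045*y^2-(1.234/3)*y^3+0.1035*y^4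

noncomputable def lo (y : Real) : Real := 1+1.409*y-1.234*y^2+0.414*y^3

lemma Il_d (y s : Real) : HasDerivAt (fun y => Il y + s * y) (lo y + s) y := by
  have := ((((hasDerivAt_id y).add ((hasDerivAt_pow 2 y).const_mul 0.7045)).sub ((hasDerivAt_pow 3 y).const_mul (1.234/3))).add ((hasDerivAt_pow 4 y).const_mul 0.1035)).add ((hasDerivAt_id y).const_mul s)
  refine this.congr_deriv ?_
  simp [lo]; ring

lemma lo_poly {y : Real} (h0 : 0 ≤ y) (h1 : y ≤ 1) :
    (2+y)*lo y*(y^2+6*y+6) ≤ 2*(y^2+6*y+6)+12*y*(y+2) := by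
  unfold lo
  rcases le_total y (1/2) with hy | hy
  · obtain ⟨s, rfl⟩ : ∃ s, y = s/2 := ⟨2*y, by ring⟩
    have hs : 0 ≤ s := bL
    have hs1 : 0 ≤ 1 - s := bL
    have : 0 ≤ 273/500*(s^1*(1-s)^5) + 3183/2000*(s^2*(1-s)^4) + 611/400*(s^3*(1-s)^3) + 8907/16000*(s^4*(1-s)^2) + 1631/16000*(s^5*(1-s)^1) + 133/6400*(s^6*(1-s)^0) := bP
    linarith
  · obtain ⟨s, rfl⟩ : ∃ s, y = (1+s)/2 := ⟨2*y-1, by ring⟩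
    have hs : 0 ≤ s := bL
    have hs1 : 0 ≤ 1 - s := bL
    have : 0 ≤ 133/6400*(s^0*(1-s)^6) + 2359/16000*(s^1*(1-s)^5) + 12547/16000*(s^2*(1-s)^4) + 4347/2000*(s^3*(1-s)^3) + 5239/2000*(s^4*(1-s)^2) + 1139/1000*(s^5*(1-s)^1) + 29/1000*(s^6*(1-s)^0) := bP
    linarith

lemma hi_poly {y : Real} (h0 : 0 ≤ y) (h1 : y ≤ 1) :
    2*(30+36*y+9*y^2)+4*y*(30+21*y+y^2) ≤ (2+y)*(lo y+0.008)*(30+36*y+9*y^2) := by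
  unfold lo
  rcases le_total y (1/2) with hy | hy
  · obtain ⟨s, rfl⟩ : ∃ s, y = s/2 := ⟨2*y, by ring⟩
    have hs : 0 ≤ s := bL
    have hs1 : 0 ≤ 1 - s := bL
    have : 0 ≤ 12/25*(s^0*(1-s)^6) + 279/500*(s^1*(1-s)^5) + 447/400*(s^2*(1-s)^4) + 961/160*(s^3*(1-s)^3) + 143373/16000*(s^4*(1-s)^2) + 77031/16000*(s^5*(1-s)^1) + 5623/6400*(s^6*(1-s)^0) := by positivity
    linarith
  · obtain ⟨s, rfl⟩ : ∃ s, y = (1+s)/2 := ⟨2*y-1, by ring⟩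
    have hs : 0 ≤ s := by linarith
    have hs1 : 0 ≤ 1 - s := by linarith
    have : 0 ≤ 5623/6400*(s^0*(1-s)^6) + 91659/16000*(s^1*(1-s)^5) + 216513/16000*(s^2*(1-s)^4) + 54711/4000*(s^3*(1-s)^3) + 5847/1000*(s^4*(1-s)^2) + 1059/500*(s^5*(1-s)^1) + 53/40*(s^6*(1-s)^0) := by positivity
    linarith

section

variable {ξ : Real → Real} (h : XI ξ)

include h

lemma XI.lohi {y : Real} (h0 : 0 ≤ y) (h1 : y ≤ 1) : lo y ≤ ξ (2+y) ∧ ξ (2+y) ≤ lo y + 0.008 := by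
  rw [h.v23 (by linarith) (by linarith), show 2 + y - 1 = 1 + y by ring]
  constructor
  · rw [le_div_iff₀ (by linarith)]
    have h3 := log_lo h0
    have h4 := lo_poly h0 h1
    have hp : 0 < y^2+6*y+6 := by positivity
    have : lo y * (2+y) ≤ 2 + 4 * (3*y*(y+2)/(y^2+6*y+6)) := by
      rw [← mul_div_assoc, ← sub_le_iff_le_add', le_div_iff₀ hp]; linarith
    linarith
  · rw [div_le_iff₀ (by linarith)]
    have h3 := log_up h0
    have h4 := hi_poly h0 h1
    have hp : 0 < 30+36*y+9*y^2 := by positivity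
    have : 2 + 4 * (y*(30+21*y+y^2)/(30+36*y+9*y^2)) ≤ (lo y+0.008) * (2+y) := by
      rw [← mul_div_assoc, ← le_sub_iff_add_le', div_le_iff₀ hp]; linarith
    linarith

lemma XI.Dlohi {y z : Real} (h0 : 0 ≤ y) (hyz : y ≤ z) (h1 : z ≤ 1) :
    Il z - Il y ≤ DX ξ (2+z) - DX ξ (2+y) ∧ DX ξ (2+z) - DX ξ (2+y) ≤ Il z - Il y + 0.008*(z-y) := by
  have hd : ∀ x, 0 ≤ x → HasDerivAt (fun x => DX ξ (2+x)) (ξ (2+x)) x := by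
    intro x hx
    have := HasDerivAt.comp x (h := fun v => 2 + v) (h.DXd bL) ((hasDerivAt_id x).const_add 2)
    simpa using! this
  have m1 : MonotoneOn (fun x => DX ξ (2+x) - (Il x + 0 * x)) (Icc 0 1) := by
    refine monotoneOn_of_hasDerivWithinAt_nonneg (f' := fun x => ξ (2+x) - (lo x + 0)) (convex_Icc 0 1) (fun x hx => ((hd x hx.1).sub (Il_d x 0)).continuousAt.continuousWithinAt) ?_ ?_
    · intro x hx; rw [interior_Icc] at hx; exact ((hd x hx.1.le).sub (Il_d x 0)).hasDerivWithinAt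
    · intro x hx; rw [interior_Icc] at hx; linarith [(h.lohi hx.1.le hx.2.le).1]
  have m2 : MonotoneOn (fun x => (Il x + 0.008 * x) - DX ξ (2+x)) (Icc 0 1) := by
    refine monotoneOn_of_hasDerivWithinAt_nonneg (f' := fun x => (lo x + 0.008) - ξ (2+x)) (convex_Icc 0 1) (fun x hx => ((Il_d x 0.008).sub (hd x hx.1)).continuousAt.continuousWithinAt) ?_ ?_
    · intro x hx; rw [interior_Icc] at hx; exact ((Il_d x 0.008).sub (hd x hx.1.le)).hasDerivWithinAt
    · intro x hx; rw [interior_Icc] at hx; linarith [(h.lohi hx.1.le hx.2.le).2]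
  have a1 := m1 ⟨h0, hyz.trans h1⟩ ⟨h0.trans hyz, h1⟩ hyz
  have a2 := m2 ⟨h0, hyz.trans h1⟩ ⟨h0.trans hyz, h1⟩ hyz
  grind

lemma XI.base {u : Real} (h2 : 2 ≤ u) (h3 : u ≤ 3) : 0.3131 * PP u ≤ DX ξ u ∧ DX ξ u ≤ 0.3182 * PP u := by
  obtain ⟨y, rfl⟩ : ∃ y, u = 2 + y := ⟨u - 2, by ring⟩
  have h0 : 0 ≤ y := bL
  have h1 : y ≤ 1 := bL
  have := h.Dlohi le_rfl h0 h1
  have e : DX ξ (2+0) = 1 + 2 * log 2 := by rw [add_zero]; exact h.D12 bN le_rfl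
  have l1 := log_two_gt_d9
  have l2 := log_two_lt_d9
  rw [e] at this
  have e2 : Il 0 = 0 := by simp [Il]
  rw [e2] at this
  have hP : PP (2+y) = 7.5+4*y+0.5*y^2 := by rw [PP]; ring
  rw [hP]
  have q1 : 0.3131 * (7.5+4*y+0.5*y^2) ≤ 2.38629 + Il y := by
    rw [Il]
    have hq : 0 ≤ (y-0.36)^2 * (0.1035*y^2-0.3368*y+0.3) := by
      apply mul_nonneg (sq_nonneg _); nlinarith
    nlinarith
  have q2 : 2.386295 + Il y + 0.008 * y ≤ 0.3182 * (7.5+4*y+0.5*y^2) := by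
    rw [Il]
    have hq : 0 ≤ y * (0.2648-0.5454*y+0.4113*y^2-0.1035*y^3) := by
      apply mul_nonneg h0; nlinarith [mul_nonneg h0 (sub_nonneg.2 h1)]
    nlinarith
  grind

end

noncomputable def abn (ξ : Real → Real) : ℕ → Real × Real
  | 0 => (0.3131, 0.3182)
  | (n+1) => ((abn ξ n).1 + (DX ξ (n+3) / PP (n+3) - (abn ξ n).1) * (PP (n+3) / PP (n+4)),
     (abn ξ n).2 - ((abn ξ n).2 - DX ξ (n+3) / PP (n+3)) * (PP (n+3) / PP (n+4)))

lemma PP_pos {u : Real} (hu : 0 ≤ u) : 0 < PP u := by unfold PP; positivity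

lemma PP_mono {u v : Real} (hu : 0 ≤ u) (h : u ≤ v) : PP u ≤ PP v := by unfold PP; nlinarith

section

variable {ξ : Real → Real} (h : XI ξ)

include h

lemma XI.abn_prop (n : ℕ) : ∀ u, (n:Real)+2 ≤ u → u ≤ n+3 → (abn ξ n).1 * PP u ≤ DX ξ u ∧ DX ξ u ≤ (abn ξ n).2 * PP u := by
  induction n with
  | zero => intro u h1 h2; simp only [Nat.cast_zero, zero_add] at h1 h2; exact h.base h1 h2
  | succ n ih =>
    intro u h1 h2
    push_cast at h1 h2
    have hn : 0 ≤ n := n.cast_nonneg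
    have hs := h.step bL (fun u h1 h2 => ih u h1 bL) u bL bL
    have h3 := ih (n+3) bL le_rfl
    rw [show (n:Real)+2+1 = n+3 by ring] at hs
    have p3 := PP_pos (u := (n:Real)+3) bL
    have p4 := PP_pos (u := (n:Real)+4) bL
    have pu := PP_mono (u := u) (v := n+4) bL bL
    have h6 : PP u / PP (n+4) ≤ 1 := by rw [div_le_one p4]; exact pu
    simp only [abn]
    set a := (abn ξ n).1
    set b := (abn ξ n).2
    constructor
    · refine le_trans ?_ hs.1
      have h5 : 0 ≤ DX ξ (n+3) - a * PP (n+3) := by linarith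
      have : (a + (DX ξ (n+3) / PP (n+3) - a) * (PP (n+3) / PP (n+4))) * PP u = a * PP u + (DX ξ (n+3) - a * PP (n+3)) * (PP u / PP (n+4)) := by
        field_simp
      rw [this]
      nlinarith
    · refine le_trans hs.2 ?_
      have h5 : 0 ≤ b * PP (n+3) - DX ξ (n+3) := by linarith
      have : (b - (b - DX ξ (n+3) / PP (n+3)) * (PP (n+3) / PP (n+4))) * PP u = b * PP u - (b * PP (n+3) - DX ξ (n+3)) * (PP u / PP (n+4)) := by
        field_simp
      rw [this]
      nlinarith

lemma XI.abn_m n : (abn ξ n).1 ≤ DX ξ (n+3) / PP (n+3) ∧ DX ξ (n+3) / PP (n+3) ≤ (abn ξ n).2 := by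
  have h3 := h.abn_prop n (n+3) bL le_rfl
  have p3 := PP_pos (u := (n:Real)+3) bP
  rw [le_div_iff₀ p3, div_le_iff₀ p3]; exact h3

lemma XI.abn_len n : (abn ξ n).2 - (abn ξ n).1 ≤ 0.0051 * (1/3)^n := by
  induction n with
  | zero => simp [abn]; norm_num
  | succ n ih =>
    have := h.abn_m n
    have e : (abn ξ (n+1)).2 - (abn ξ (n+1)).1 = ((abn ξ n).2 - (abn ξ n).1) * (1 - PP (n+3) / PP (n+4)) := by
      simp only [abn]; ring
    rw [e, pow_succ]
    have : 1 - PP (n+3) / PP (n+4) ≤ 1/3 := by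
      have p4 := PP_pos (u := (n:Real)+4) bP
      rw [sub_le_iff_le_add, ← sub_le_iff_le_add', le_div_iff₀ p4]
      have hn : (0:Real) ≤ n := n.cast_nonneg
      unfold PP; nlinarith
    nlinarith

lemma XI.exc : ∃ c, (0.3131 ≤ c ∧ c ≤ 0.3182) ∧ ∀ n : ℕ, ∀ u : Real, n+2 ≤ u → |DX ξ u - c * PP u| ≤ 0.0051 * (1/3)^n * PP u := by
  have r : ∀ n : ℕ, 0 ≤ PP (n+3) / PP (n+4) := fun n => div_nonneg (PP_pos bP).le (PP_pos bP).le
  have hm : Monotone (fun n => (abn ξ n).1) := by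
    refine monotone_nat_of_le_succ fun n => ?_
    simp only [abn]
    nlinarith [h.abn_m n, r n]
  have ha : Antitone (fun n => (abn ξ n).2) := by
    refine antitone_nat_of_succ_le fun n => ?_
    simp only [abn]
    nlinarith [h.abn_m n, r n]
  have hab : (fun n => (abn ξ n).1) ≤ (fun n => (abn ξ n).2) := fun n => (h.abn_m n).1.trans (h.abn_m n).2
  have hc := hm.ciSup_mem_iInter_Icc_of_antitone ha hab
  rw [mem_iInter] at hc
  refine ⟨_, ⟨(hc 0).1, (hc 0).2⟩, ?_⟩
  set c := ⨆ n, (fun n => (abn ξ n).1) n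
  intro n u hu
  obtain ⟨N, hN⟩ : ∃ N : ℕ, N = ⌊u⌋₊ - 2 := ⟨_, rfl⟩
  have hu2 : 2 ≤ u := bL
  have hfl : n + 2 ≤ ⌊u⌋₊ := Nat.le_floor (by push_cast; exact hu)
  have hN2 : (N:Real) + 2 = ⌊u⌋₊ := by
    have : N + 2 = ⌊u⌋₊ := by omega
    exact_mod_cast this
  have hnN : n ≤ N := by omega
  have hp := h.abn_prop N u (by rw [hN2]; exact Nat.floor_le (by linarith)) (by linarith [Nat.lt_floor_add_one u])
  have hl := h.abn_len N
  have hP := PP_pos (u := u) (by linarith)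
  have h1 : (0.0051:Real) * (1/3)^N ≤ 0.0051 * (1/3)^n := by
    apply mul_le_mul_of_nonneg_left _ (by norm_num)
    exact pow_le_pow_of_le_one (by norm_num) (by norm_num) hnN
  have hcN := hc N
  have hcN1 := hcN.1
  have hcN2 := hcN.2
  rw [abs_le]
  constructor <;> nlinarith

end

noncomputable def ep (ξ : Real → Real) (c u : Real) : Real := ξ u - c * (u+2)

structure XC (ξ : Real → Real) (c : Real) : Prop extends XI ξ where
  c1 : 0.3131 ≤ c
  c2 : c ≤ 0.3182
  ap : ∀ n : ℕ, ∀ u : Real, n+2 ≤ u → |DX ξ u - c * PP u| ≤ 0.0051 * (1/3)^n * PP u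

section

variable {ξ : Real → Real} {c : Real} (h : XC ξ c)

include h

lemma XC.epint (a b : Real) : IntervalIntegrable (ep ξ c) volume a b :=
  (h.int a b).sub ((by fun_prop : Continuous fun u => c * (u+2)).intervalIntegrable a b)

lemma XC.abs_int (a b : Real) : IntervalIntegrable (fun u => |ep ξ c u|) volume a b := (h.epint a b).abs

lemma XC.prim (a b : Real) : ∫ u in a..b, ep ξ c u = (DX ξ b - c * PP b) - (DX ξ a - c * PP a) := by
  unfold ep
  rw [isb (h.int a b) ((by fun_prop : Continuous fun u => c * (u+2)).intervalIntegrable a b)]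
  have e1 : ∫ u in a..b, c * (u+2) = c * (PP b - PP a) := by
    rw [icm, iadd (by simp) (by simp)]
    rw [integral_id, icst, smul_eq_mul, PP, PP]; ring
  have e2 := iadj (h.int 1 a) (h.int a b)
  rw [e1, DX, DX, ← e2]; ring

lemma XC.ep_eq {u : Real} (hu : 1 ≤ u) : ep ξ c u = 2 * (DX ξ (u-1) - c * PP (u-1)) / u := by
  rw [ep, h.eq hu, PP]; field_simp; ring

lemma XC.tailpt (n : ℕ) {u : Real} (hu : n+3 ≤ u) : |ep ξ c u| ≤ 0.0051 * (1/3)^n * (u+2) := by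
  have hu0 : 0 < u := bL
  rw [h.ep_eq (by linarith), abs_div, abs_mul, abs_of_pos hu0, div_le_iff₀ hu0]
  have := h.ap n (u-1) bL
  have e : 2 * PP (u-1) = u * (u+2) := by unfold PP; ring
  calc |2| * |DX ξ (u-1) - c * PP (u-1)| ≤ 2 * (0.0051 * (1/3)^n * PP (u-1)) := by rw [abs_two]; gcongr
    _ = _ := by grind

lemma XC.tail (N : ℕ) : ∫ u in 3..(3+N), |ep ξ c u| ≤ 0.0051 * (9 - (9+1.5*N)*(1/3)^N) := by
  induction N with
  | zero => simp
  | succ N ih =>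
    rw [← iadj (h.abs_int 3 (3+N)) (h.abs_int (3+N) _)]
    have : ∫ u in (3+N:Real)..(3+(N+1:ℕ)), |ep ξ c u| ≤ ∫ u in (3+N:Real)..(3+(N+1:ℕ)), 0.0051 * (1/3)^N * (u+2) := by
      refine imon (by push_cast; linarith) (h.abs_int _ _) (by apply Continuous.intervalIntegrable; fun_prop) fun u hu => h.tailpt N (by linarith [hu.1])
    have e : ∫ u in (3+N:Real)..(3+(N+1:ℕ)), 0.0051 * (1/3)^N * (u+2) = 0.0051 * (1/3)^N * (N + 5.5) := by
      rw [icm, iadd (by simp) (by simp)]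
      rw [integral_id, icst, smul_eq_mul]; push_cast; ring
    rw [e] at this
    refine (add_le_add ih this).trans (le_of_eq ?_)
    push_cast; ring

lemma XC.piece_pos {a b δ : Real} (hab : a ≤ b) (hδ : 0 ≤ δ) (hp : ∀ u, a ≤ u → u ≤ b → -δ ≤ ep ξ c u) :
    ∫ u in a..b, |ep ξ c u| ≤ (DX ξ b - c * PP b) - (DX ξ a - c * PP a) + 2 * δ * (b - a) := by
  rw [← h.prim]
  have e : 2 * δ * (b - a) = ∫ u in a..b, 2 * δ := by rw [icst, smul_eq_mul]; ring
  rw [e, ← iadd (h.epint a b) (by simp)]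
  refine imon hab (h.abs_int _ _) ((h.epint a b).add (by simp)) fun u hu => ?_
  grind

lemma XC.piece_neg {a b : Real} (hab : a ≤ b) (hp : ∀ u, a ≤ u → u ≤ b → ep ξ c u ≤ 0) :
    ∫ u in a..b, |ep ξ c u| ≤ (DX ξ a - c * PP a) - (DX ξ b - c * PP b) := by
  have := h.prim a b
  rw [← neg_sub, ← this, ← intervalIntegral.integral_neg]
  refine imon hab (h.abs_int _ _) (h.epint a b).neg fun u hu => ?_
  rw [abs_of_nonpos (hp u hu.1 hu.2)]

lemma XC.piece_abs {a b δ : Real} (hab : a ≤ b) (hp : ∀ u, a ≤ u → u ≤ b → |ep ξ c u| ≤ δ) :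
    ∫ u in a..b, |ep ξ c u| ≤ δ * (b - a) := by
  have e : δ * (b - a) = ∫ u in a..b, δ := by rw [icst, smul_eq_mul]; ring
  rw [e]
  exact imon hab (h.abs_int _ _) (by simp) fun u hu => hp u hu.1 hu.2

lemma XC.pos1 {u : Real} (h1 : 1 ≤ u) (h2 : u ≤ 1.69) : 0 ≤ ep ξ c u := by
  rw [ep, h.v12 h1 bL, sub_nonneg, le_div_iff₀ bL]
  have := h.c2
  have := h.c1
  have : (u+2)*u ≤ 6.2361 := by nlinarith
  nlinarith

lemma XC.A_lo : 1.0489 - 2.30805 * c ≤ ∫ u in 1..1.69, |ep ξ c u| := by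
  have hA : ∫ u in 1..1.69, |ep ξ c u| = ∫ u in 1..1.69, ep ξ c u := by
    refine icg fun u hu => ?_
    rw [uIcc_of_le bN] at hu
    exact abs_of_nonneg (h.pos1 hu.1 hu.2)
  rw [hA, h.prim, h.D12 bN bN, h.DX1 le_rfl]
  have := log_lo (y := 0.69) bN
  norm_num [PP] at this ⊢
  linarith

lemma XC.lohi' {u : Real} (h0 : 2 ≤ u) (h1 : u ≤ 3) : lo (u-2) ≤ ξ u ∧ ξ u ≤ lo (u-2) + 0.008 := by
  have := h.lohi (y := u-2) bL bL
  rwa [show 2 + (u-2) = u by ring] at this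

lemma XC.E3 : ∫ u in (1:Real)..3, |ep ξ c u| ≤ 1.2724 - 2.6627 * c := by
  have c1 := h.c1
  have c2 := h.c2
  have b1 := h.piece_pos (a := 1) (b := 1.69) (δ := 0) (by norm_num) le_rfl (fun u h1 h2 => by rw [neg_zero]; exact h.pos1 h1 h2)
  have b2 := h.piece_abs (a := 1.69) (b := 1.73) (δ := 0.031) (by norm_num) (fun u h1 h2 => by
    rw [ep, h.v12 (by linarith) (by linarith), abs_le]
    constructor
    · have : 1.156 ≤ 2/u := by rw [le_div_iff₀ (by linarith)]; linarith
      nlinarith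
    · have : 2/u ≤ 1.18344 := by rw [div_le_iff₀ (by linarith)]; linarith
      nlinarith)
  have b3 := h.piece_neg (a := 1.73) (b := 2) (by norm_num) (fun u h1 h2 => by
    rw [ep, h.v12 (by linarith) h2, sub_nonpos, div_le_iff₀ (by linarith)]
    have : 6.45 ≤ (u+2)*u := by nlinarith
    nlinarith)
  have b4 := h.piece_neg (a := 2) (b := 2.3) (by norm_num) (fun u h1 h2 => by
    have := (h.lohi' h1 (by linarith)).2
    obtain ⟨y, rfl⟩ : ∃ y, u = 2 + y := ⟨u - 2, by ring⟩
    rw [show 2 + y - 2 = y by ring] at this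
    have hy : 0 ≤ y := by linarith
    have h5 : lo y + 0.008 ≤ 0.3131 * (4+y) := by unfold lo; nlinarith [mul_nonneg hy (sub_nonneg.2 h2), mul_nonneg hy hy]
    have : 0.3131 * (4+y) ≤ c * (2+y+2) := by nlinarith
    rw [ep]; linarith)
  have b5 := h.piece_abs (a := 2.3) (b := 2.44) (δ := 0.046) (by norm_num) (fun u h1 h2 => by
    have := (h.lohi' (by linarith : 2 ≤ u) (by linarith))
    obtain ⟨y, rfl⟩ : ∃ y, u = 2 + y := ⟨u - 2, by ring⟩
    rw [show 2 + y - 2 = y by ring] at this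
    have hy : 0.3 ≤ y := by linarith
    have hy2 : y ≤ 0.44 := by linarith
    have h5 : lo y + 0.008 ≤ 0.3131 * (4+y) + 0.046 := by unfold lo; nlinarith [mul_nonneg (sub_nonneg.2 hy) (sub_nonneg.2 hy2)]
    have h6 : 0.3182 * (4+y) - 0.046 ≤ lo y := by unfold lo; nlinarith [mul_nonneg (sub_nonneg.2 hy) (sub_nonneg.2 hy2), mul_nonneg (mul_nonneg (sub_nonneg.2 hy) (sub_nonneg.2 hy2)) (sub_nonneg.2 hy)]
    rw [ep, abs_le]; constructor <;> nlinarith)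
  have b6 := h.piece_pos (a := 2.44) (b := 3) (δ := 0.002) (by norm_num) (by norm_num) (fun u h1 h2 => by
    have := (h.lohi' (by linarith : 2 ≤ u) (by linarith)).1
    obtain ⟨y, rfl⟩ : ∃ y, u = 2 + y := ⟨u - 2, by ring⟩
    rw [show 2 + y - 2 = y by ring] at this
    have hy : 0.44 ≤ y := by linarith
    have hy2 : y ≤ 1 := by linarith
    have h6 : 0.3182 * (4+y) - 0.002 ≤ lo y := by unfold lo; nlinarith [mul_nonneg (sub_nonneg.2 hy) (sub_nonneg.2 hy2), mul_nonneg (mul_nonneg (sub_nonneg.2 hy) (sub_nonneg.2 hy2)) (sub_nonneg.2 hy2), mul_nonneg (mul_nonneg (sub_nonneg.2 hy) (sub_nonneg.2 hy2)) (sub_nonneg.2 hy)]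
    rw [ep]; nlinarith)
  have d1 := (h.Dlohi (y := 0) (z := 0.3) le_rfl (by norm_num) (by norm_num)).1
  have d2 := (h.Dlohi (y := 0.44) (z := 1) (by norm_num) (by norm_num) (by norm_num)).2
  have D2 : DX ξ 2 = 1 + 2 * log 2 := h.D12 (by norm_num) le_rfl
  have D3 : DX ξ 1.73 = 1 + 2 * log (1 + 0.73) := by rw [h.D12 (by norm_num) (by norm_num)]; norm_num
  have D4 : DX ξ 1.69 = 1 + 2 * log (1 + 0.69) := by rw [h.D12 (by norm_num) (by norm_num)]; norm_num
  have D1 : DX ξ 1 = 1 := h.DX1 le_rfl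
  have l1 := log_up (y := 0.69) (by norm_num)
  have l2 := log_up (y := 0.73) (by norm_num)
  have l3 := log_two_gt_d9
  rw [D2, D3] at b3
  rw [D2] at b4
  rw [D4, D1] at b1
  rw [show (2:Real) + 0 = 2 by norm_num, show (2:Real)+0.3 = 2.3 by norm_num, D2] at d1
  rw [show (2:Real) + 0.44 = 2.44 by norm_num, show (2:Real)+1 = 3 by norm_num] at d2
  have tot : ∫ u in (1:Real)..3, |ep ξ c u| = (∫ u in (1:Real)..1.69, |ep ξ c u|) + (∫ u in (1.69:Real)..1.73, |ep ξ c u|) + (∫ u in (1.73:Real)..2, |ep ξ c u|) + (∫ u in (2:Real)..2.3, |ep ξ c u|) + (∫ u in (2.3:Real)..2.44, |ep ξ c u|) + (∫ u in (2.44:Real)..3, |ep ξ c u|) := by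
    rw [intervalIntegral.integral_add_adjacent_intervals (h.abs_int _ _) (h.abs_int _ _), intervalIntegral.integral_add_adjacent_intervals (h.abs_int _ _) (h.abs_int _ _), intervalIntegral.integral_add_adjacent_intervals (h.abs_int _ _) (h.abs_int _ _), intervalIntegral.integral_add_adjacent_intervals (h.abs_int _ _) (h.abs_int _ _), intervalIntegral.integral_add_adjacent_intervals (h.abs_int _ _) (h.abs_int _ _)]
  rw [tot]
  generalize log (1+0.69) = L1 at *
  generalize log (1+0.73) = L2 at *
  generalize log 2 = L3 at *
  clear tot D1 D2 D3 D4
  norm_num [PP, Il] at *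
  linarith

end

section

variable {ξ : Real → Real} {c : Real} (h : XC ξ c)

include h

lemma XC.Ebd w : ∫ u in 1..w, |ep ξ c u| ≤ 1.3183 - 2.6627 * c := by
  obtain ⟨N, hN⟩ := exists_nat_gt w
  have h1 : ∫ u in 1..w, |ep ξ c u| ≤ ∫ u in 1..(3+N), |ep ξ c u| := by
    rw [← iadj (h.abs_int 1 w) (h.abs_int w (3+N))]
    have : 0 ≤ ∫ u in w..(3+N), |ep ξ c u| := inn bL fun _ _ => abs_nonneg _
    linarith
  refine h1.trans ?_
  rw [← iadj (h.abs_int 1 3) (h.abs_int 3 _)]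
  have := h.tail N
  have : (0:Real) ≤ (9+1.5*N)*(1/3)^N := bP
  linarith [h.E3]

lemma XC.epI : IntegrableOn (ep ξ c) (Ioi 1) := by
  refine integrableOn_Ioi_of_intervalIntegral_norm_bounded (1.3183 - 2.6627 * c) 1 (fun w => ?_) tendsto_id (Eventually.of_forall fun w => ?_)
  · rcases le_total 1 w with hw | hw
    · exact (iio hw).1 (h.epint 1 w)
    · simp [Set.Ioc_eq_empty (not_lt.2 hw)]
  · exact h.Ebd w

lemma XC.E : ∫ u in Ioi 1, |ep ξ c u| ≤ 1.3183 - 2.6627 * c := by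
  have := intervalIntegral_tendsto_integral_Ioi 1 h.epI.norm tendsto_id
  exact le_of_tendsto this (Eventually.of_forall fun w => h.Ebd w)

lemma XC.Et : ∫ u in Ioi 1, ep ξ c u = 4 * c - 1 := by
  have h1 := intervalIntegral_tendsto_integral_Ioi (b := fun N : ℕ => (N:Real)+2) 1 h.epI (tendsto_atTop_add_const_right _ _ tendsto_natCast_atTop_atTop)
  refine tendsto_nhds_unique h1 ?_
  have e : ∀ N : ℕ, ∫ u in 1..(N+2), ep ξ c u = (DX ξ (N+2) - c * PP (N+2)) + (4*c-1) := by
    intro N; rw [h.prim, h.DX1 le_rfl]; unfold PP; ring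
  simp_rw [e]
  suffices hs : Tendsto (fun N : ℕ => DX ξ (N+2) - c * PP (N+2)) atTop (nhds 0) by
    simpa using hs.add_const (4*c-1)
  refine squeeze_zero_norm (a := fun N : ℕ => 0.0051 * (N^2*(1/3)^N/2 + 4*(N^1*(1/3)^N) + 7.5*(1/3)^N)) (fun N => ?_) ?_
  · refine (h.ap N (N+2) le_rfl).trans (le_of_eq ?_)
    unfold PP; ring
  · have t2 := tendsto_pow_const_mul_const_pow_of_abs_lt_one 2 (r := (1/3:Real)) (by rw [abs_of_pos] <;> norm_num)
    have t1 := tendsto_pow_const_mul_const_pow_of_abs_lt_one 1 (r := (1/3:Real)) (by rw [abs_of_pos] <;> norm_num)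
    have t0 := tendsto_pow_atTop_nhds_zero_of_lt_one (r := (1/3:Real)) bN bN
    have := (((t2.div_const 2).add (t1.const_mul 4)).add (t0.const_mul 7.5)).const_mul 0.0051
    simpa using this

lemma XC.epb {u : Real} (hu : 1 ≤ u) : |ep ξ c u| ≤ 6 / u := by
  have c1 := h.c1
  have c2 := h.c2
  have hu0 : 0 < u := bL
  rw [h.ep_eq hu, abs_div, abs_of_pos hu0]
  refine div_le_div_of_nonneg_right ?_ hu0.le
  rw [abs_mul, abs_two]
  suffices |DX ξ (u-1) - c * PP (u-1)| ≤ 3 by linarith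
  rcases le_total u 2 with h2 | h2
  · rw [h.DX1 bL, abs_le]
    have : PP (u-1) ≤ PP 1 := PP_mono bL bL
    have h3 : 0 < PP (u-1) := PP_pos bL
    have : PP 1 = 4 := by norm_num [PP]
    constructor <;> nlinarith
  · have h1 := h.prim 1 (u-1)
    rw [h.DX1 le_rfl, show PP 1 = 4 by norm_num [PP]] at h1
    have h2 := intervalIntegral.norm_integral_le_integral_norm (f := ep ξ c) (μ := volume) (a := 1) (b := u-1) bL
    have h3 := h.Ebd (u-1)
    simp only [norm_eq_abs] at h2
    grind

noncomputable def phi (ξ : Real → Real) (c p : Real) : Real := 1 + (∫ u in Ioi 1, ep ξ c u * (u+1)^(-p-1)) + c * (-(2^(1-p)/(1-p)) + 2^(-p)/p)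

lemma XC.epwI {p : Real} (hp : 0 ≤ p) : IntegrableOn (fun u => ep ξ c u * (u+1)^(-p-1)) (Ioi 1) := by
  refine Integrable.mul_bdd (c := 1) h.epI (Measurable.aestronglyMeasurable (by fun_prop)) ?_
  refine (ari measurableSet_Ioi).2 (Eventually.of_forall fun u hu => ?_)
  have hu1 : 1 < u := hu
  rw [norm_of_nonneg bP]
  exact rpow_le_one_of_one_le_of_nonpos bL bL

lemma XC.phi_cont : ContinuousOn (phi ξ c) (Set.Icc 0.7 0.9) := by
  unfold phi
  refine ContinuousOn.add (ContinuousOn.add continuousOn_const ?_) ?_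
  · refine continuousOn_of_dominated (fun p hp => (h.epwI (by linarith [hp.1])).aestronglyMeasurable) (fun p hp => ?_) h.epI.norm ?_
    · refine (ari measurableSet_Ioi).2 (Eventually.of_forall fun u hu => ?_)
      have hu1 : 1 < u := hu
      rw [norm_mul, norm_of_nonneg (by positivity : (0:Real) ≤ (u+1)^(-p-1))]
      exact mul_le_of_le_one_right (abs_nonneg _) (rpow_le_one_of_one_le_of_nonpos bL (by linarith [hp.1]))
    · refine (ari measurableSet_Ioi).2 (Eventually.of_forall fun u hu => ?_)
      have hu1 : 1 < u := hu
      refine continuousOn_const.mul (Continuous.continuousOn ?_)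
      refine Continuous.rpow continuous_const (by fun_prop) fun p => Or.inl bL
  · intro p hp
    have h1 : 1 - p ≠ 0 := by grind
    have h2 : p ≠ 0 := by grind
    refine ContinuousAt.continuousWithinAt ?_
    refine continuousAt_const.mul (ContinuousAt.add (ContinuousAt.neg (ContinuousAt.div ?_ (by fun_prop) h1)) (ContinuousAt.div ?_ continuousAt_id h2))
    · exact ContinuousAt.rpow continuousAt_const (by fun_prop) (Or.inl bN)
    · exact ContinuousAt.rpow continuousAt_const (by fun_prop) (Or.inl bN)

lemma XC.I_lo {p : Real} (hp : 0 ≤ p) : (2.69:Real)^(-p-1) * (2 * (∫ u in 1..1.69, |ep ξ c u|) - ∫ u in Ioi 1, |ep ξ c u|) ≤ ∫ u in Ioi 1, ep ξ c u * (u+1)^(-p-1) := by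
  set w := (2.69:Real)^(-p-1) with hw
  have hw0 : 0 < w := bP
  have e : Ioi (1:Real) = Ioc 1 1.69 ∪ Ioi 1.69 := (Ioc_union_Ioi_eq_Ioi bN).symm
  have i1 : IntegrableOn (fun u => |ep ξ c u|) (Ioc 1 1.69) := IntegrableOn.mono_set h.epI.norm Ioc_subset_Ioi_self
  have i2 : IntegrableOn (fun u => |ep ξ c u|) (Ioi 1.69) := IntegrableOn.mono_set h.epI.norm (Ioi_subset_Ioi bN)
  have j1 : IntegrableOn (fun u => ep ξ c u * (u+1)^(-p-1)) (Ioc 1 1.69) := (h.epwI hp).mono_set Ioc_subset_Ioi_self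
  have j2 : IntegrableOn (fun u => ep ξ c u * (u+1)^(-p-1)) (Ioi 1.69) := (h.epwI hp).mono_set (Ioi_subset_Ioi bN)
  rw [iole bN, e, setIntegral_union Ioc_disjoint_Ioi_same measurableSet_Ioi i1 i2, setIntegral_union Ioc_disjoint_Ioi_same measurableSet_Ioi j1 j2]
  have b1 : ∫ u in Ioc 1 1.69, w * |ep ξ c u| ≤ ∫ u in Ioc 1 1.69, ep ξ c u * (u+1)^(-p-1) := by
    refine setIntegral_mono_on (i1.const_mul w) j1 measurableSet_Ioc fun u hu => ?_
    have h0 := h.pos1 hu.1.le hu.2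
    rw [abs_of_nonneg h0, mul_comm]
    exact mnl (rpow_le_rpow_of_nonpos (by linarith [hu.1]) (by linarith [hu.2]) bL) h0
  have b2 : ∫ u in Ioi 1.69, -w * |ep ξ c u| ≤ ∫ u in Ioi 1.69, ep ξ c u * (u+1)^(-p-1) := by
    refine setIntegral_mono_on (i2.const_mul (-w)) j2 measurableSet_Ioi fun u hu => ?_
    have hu' : (1.69:Real) < u := hu
    have h1 : (u+1)^(-p-1) ≤ w := rpow_le_rpow_of_nonpos bN bL bL
    have h2 : 0 < (u+1)^(-p-1) := bP
    have h3 := neg_abs_le (ep ξ c u)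
    have h4 := abs_nonneg (ep ξ c u)
    nlinarith
  rw [integral_const_mul] at b1 b2
  linarith

lemma XC.I_up {p : Real} (hp : 0 ≤ p) : ∫ u in Ioi 1, ep ξ c u * (u+1)^(-p-1) ≤ ∫ u in Ioi 1, |ep ξ c u| := by
  refine setIntegral_mono_on (h.epwI hp) h.epI.norm measurableSet_Ioi fun u hu => ?_
  have hu1 : 1 < u := hu
  have h1 : (u+1)^(-p-1) ≤ 1 := rpow_le_one_of_one_le_of_nonpos bL bL
  have h2 : 0 < (u+1)^(-p-1) := bP
  have h3 := le_abs_self (ep ξ c u)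
  have h4 := abs_nonneg (ep ξ c u)
  nlinarith

lemma XC.exp0 : ∃ p, 0.7 ≤ p ∧ p ≤ 0.9 ∧ phi ξ c p = 0 := by
  have c1 := h.c1
  have c2 := h.c2
  have hE := h.E
  have hA := h.A_lo
  have f1 : 0 ≤ phi ξ c 0.7 := by
    have h1 := h.I_lo (p := 0.7) (by norm_num)
    have h2 : (0.185:Real) ≤ (2.69:Real)^(-0.7-1:Real) := by
      have : (2.69:Real)^(1.7:Real) ≤ 5.4 := by
        rw [show (1.7:Real) = (17:ℕ) * (1/10:Real) by norm_num, rpow_mul bN, rpow_natCast]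
        calc ((2.69:Real)^17)^(1/10:Real) ≤ ((5.4:Real)^10)^(1/10:Real) := by gcongr; norm_num
          _ = 5.4 := by rw [← rpow_natCast, ← rpow_mul bN]; norm_num
      rw [show (-0.7-1:Real) = -1.7 by norm_num, rpow_neg bN]
      calc (0.185:Real) ≤ 5.4⁻¹ := bN
        _ ≤ _ := by gcongr
    have h3 : (2:Real)^(0.3:Real) ≤ 1.2312 := by
        rw [show (0.3:Real) = (3:ℕ) * (1/10:Real) by norm_num, rpow_mul bN, rpow_natCast]
        calc ((2:Real)^3)^(1/10:Real) ≤ ((1.2312:Real)^10)^(1/10:Real) := by gcongr; norm_num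
          _ = 1.2312 := by linarith
    have h4 : (2:Real)^(-0.7:Real) = 2^(0.3:Real)/2 := by
      rw [show (-0.7:Real) = 0.3 - 1 by norm_num, rpow_sub_one (by norm_num)]
    unfold phi
    rw [h4, show (1-0.7:Real) = 0.3 by norm_num]
    set X := (2:Real)^(0.3:Real)
    have h5 : c * (-(X/0.3) + X/2/0.7) = - (c * X * (55/21)) := by ring
    rw [h5]
    have hX : 0 < X := by positivity
    have h6 : c * X ≤ c * 1.2312 := by gcongr
    have h7 : 0.185 * (2 * (∫ u in (1:Real)..1.69, |ep ξ c u|) - ∫ u in Set.Ioi 1, |ep ξ c u|) ≤ (2.69:Real)^(-0.7-1:Real) * (2 * (∫ u in (1:Real)..1.69, |ep ξ c u|) - ∫ u in Set.Ioi 1, |ep ξ c u|) := by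
      gcongr; linarith
    linarith
  have f2 : phi ξ c 0.9 ≤ 0 := by
    have h1 := h.I_up (p := 0.9) (by norm_num)
    have h4 : (2:Real)^(-0.9:Real) = 2^(0.1:Real)/2 := by
      rw [show (-0.9:Real) = 0.1 - 1 by norm_num, rpow_sub_one (by norm_num)]
    unfold phi
    rw [h4, show (1-0.9:Real) = 0.1 by norm_num]
    have h3 : (1:Real) ≤ 2^(0.1:Real) := one_le_rpow (by norm_num) (by norm_num)
    set X := (2:Real)^(0.1:Real)
    have h5 : c * (-(X/0.1) + X/2/0.9) = - (c * X * (85/9)) := by ring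
    rw [h5]
    have h6 : c * 1 ≤ c * X := by gcongr
    linarith
  have := intermediate_value_Icc' (by norm_num : (0.7:Real) ≤ 0.9) h.phi_cont ⟨f2, f1⟩
  grind

end

structure LB (f : Real → Real) : Prop where
  m : Measurable f
  z : ∀ s < 1, f s = 0
  b : ∀ W : Real, ∃ C, 0 ≤ C ∧ ∀ s ≤ W, |f s| ≤ C

noncomputable def MC (f g : Real → Real) (w : Real) : Real := ∫ s in Ioi 0, f s * g (w/s) / s

lemma LB.zero {f g : Real → Real} (hf : LB f) (hg : LB g) {w s : Real} (hs : 0 < s) (h : s ∉ Icc 1 w) : f s * g (w/s) / s = 0 := by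
  rcases lt_or_ge s 1 with h1 | h1
  · simp [hf.z s h1]
  · have : w < s := by by_contra h2; exact h ⟨h1, not_lt.1 h2⟩
    rw [hg.z (w/s) (by rw [div_lt_one hs]; exact this)]; simp

lemma LB.bd2 {f g : Real → Real} (hf : LB f) (hg : LB g) W : ∃ C, 0 ≤ C ∧ ∀ w ≤ W, ∀ s > 0, |f s * g (w/s) / s| ≤ C := by
  obtain ⟨C1, h1, b1⟩ := hf.b W
  obtain ⟨C2, h2, b2⟩ := hg.b W
  refine ⟨C1 * C2, by positivity, fun w hw s hs => ?_⟩
  by_cases h : s ∈ Icc 1 w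
  · rw [abs_div, abs_mul, abs_of_pos hs]
    have h3 : w / s ≤ w := div_le_self (by linarith [h.2]) h.1
    calc |f s| * |g (w/s)| / s ≤ |f s| * |g (w/s)| := div_le_self bP h.1
      _ ≤ C1 * C2 := mul_le_mul (b1 s (h.2.trans hw)) (b2 _ (h3.trans hw)) (abs_nonneg _) h1
  · rw [hf.zero hg hs h, abs_zero]; positivity

lemma LB.meas2 {f g : Real → Real} (hf : LB f) (hg : LB g) : Measurable fun q : Real × Real => f q.2 * g (q.1/q.2) / q.2 :=
  ((hf.m.comp measurable_snd).mul (hg.m.comp (measurable_fst.div measurable_snd))).div measurable_snd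

lemma LB.ig {f g : Real → Real} (hf : LB f) (hg : LB g) w : IntegrableOn (fun s => f s * g (w/s) / s) (Ioi 0) := by
  obtain ⟨C, _, hC⟩ := hf.bd2 hg w
  have h1 : IntegrableOn (fun s => f s * g (w/s) / s) (Icc 1 w) := by
    refine Measure.integrableOn_of_bounded (M := C) (by simp) ((hf.meas2 hg).comp (measurable_const.prodMk measurable_id)).aestronglyMeasurable ?_
    refine (ari measurableSet_Icc).2 (Eventually.of_forall fun s hs => hC w le_rfl s (by linarith [hs.1]))
  refine h1.of_forall_sdiff_eq_zero measurableSet_Ioi fun s hs => hf.zero hg hs.1 hs.2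

lemma MC_interval {f g : Real → Real} (hf : LB f) (hg : LB g) {w : Real} (hw : 1 ≤ w) : MC f g w = ∫ s in 1..w, f s * g (w/s) / s := by
  rw [iole hw, ← integral_Icc_eq_integral_Ioc, MC]
  exact setIntegral_eq_of_subset_of_forall_sdiff_eq_zero measurableSet_Ioi (fun s hs => lt_of_lt_of_le one_pos hs.1) fun s hs => hf.zero hg hs.1 hs.2

lemma MC_LB {f g : Real → Real} (hf : LB f) (hg : LB g) : LB (MC f g) := by
  refine ⟨?_, fun w hw => ?_, fun W => ?_⟩
  · exact ((hf.meas2 hg).stronglyMeasurable.integral_prod_right').measurable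
  · rw [MC, scf measurableSet_Ioi fun s hs => hf.zero hg hs fun h => by linarith [h.1, h.2]]
    simp
  · obtain ⟨C, hC0, hC⟩ := hf.bd2 hg W
    refine ⟨C * |W|, by positivity, fun w hw => ?_⟩
    rcases lt_or_ge w 1 with h1 | h1
    · have : MC f g w = 0 := by
        rw [MC, scf measurableSet_Ioi fun s hs => hf.zero hg hs fun h => by linarith [h.1, h.2]]
        simp
      rw [this, abs_zero]; positivity
    · rw [MC_interval hf hg h1]
      have := intervalIntegral.norm_integral_le_of_norm_le_const (f := fun s => f s * g (w/s) / s) fun s hs => by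
        rw [uIoc_of_le h1] at hs; exact hC w hw s (by linarith [hs.1])
      refine (norm_eq_abs _ ▸ this).trans ?_
      rw [abs_of_nonneg bL, abs_of_nonneg bL]
      gcongr; linarith

lemma Haar_mul (h : Real → Real) {a : Real} (ha : 0 < a) : ∫ s in Ioi 0, h (a*s) / s = ∫ s in Ioi 0, h s / s := by
  have := integral_comp_mul_left_Ioi (fun s => h s / s) 0 ha
  rw [mul_zero] at this
  have e : ∫ s in Ioi 0, h s / s = a * ∫ s in Ioi 0, h (a*s) / (a*s) := by
    rw [this, smul_eq_mul]; field_simp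
  rw [e, ← integral_const_mul]
  refine scf measurableSet_Ioi fun s hs => ?_
  grind

lemma Haar_inv (h : Real → Real) : ∫ s in Ioi 0, h (s⁻¹) / s = ∫ s in Ioi 0, h s / s := by
  rw [← integral_comp_rpow_Ioi (fun s => h s / s) (p := -1) bN]
  refine scf measurableSet_Ioi fun s hs => ?_
  have h0 : 0 < s := hs
  simp only [smul_eq_mul]
  rw [rpow_neg_one, show (-1 - 1 : Real) = -(2:ℕ) by norm_num, rpow_neg h0.le, rpow_natCast]
  grind

lemma MC_comm (f g : Real → Real) {w : Real} (hw : 0 < w) : MC f g w = MC g f w := by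
  unfold MC
  rw [← Haar_mul (fun s => f s * g (w/s)) hw, ← Haar_inv (fun s => f (w*s) * g (w/(w*s)))]
  refine scf measurableSet_Ioi fun s hs => ?_
  have h0 : 0 < s := hs
  rw [show w / (w * s⁻¹) = s by field_simp, mul_comm (f _)]; rfl

lemma MC_add_left {f f' g : Real → Real} (hf : LB f) (hf' : LB f') (hg : LB g) w : MC (fun s => f s + f' s) g w = MC f g w + MC f' g w := by
  unfold MC
  rw [← integral_add (hf.ig hg w) (hf'.ig hg w)]
  congr 1; ext s; ring

lemma MC_add_right {f g g' : Real → Real} (hf : LB f) (hg : LB g) (hg' : LB g') w : MC f (fun s => g s + g' s) w = MC f g w + MC f g' w := by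
  unfold MC
  rw [← integral_add (hf.ig hg w) (hf.ig hg' w)]
  grind

lemma LB.add {f g : Real → Real} (hf : LB f) (hg : LB g) : LB (fun s => f s + g s) := by
  refine ⟨hf.m.add hg.m, fun s hs => by rw [hf.z s hs, hg.z s hs, add_zero], fun W => ?_⟩
  obtain ⟨C1, h1, b1⟩ := hf.b W
  obtain ⟨C2, h2, b2⟩ := hg.b W
  exact ⟨C1 + C2, by positivity, fun s hs => (abs_add_le _ _).trans (add_le_add (b1 s hs) (b2 s hs))⟩

lemma LB.smul {f : Real → Real} (hf : LB f) a : LB (fun s => a * f s) := by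
  refine ⟨hf.m.const_mul a, fun s hs => by rw [hf.z s hs, mul_zero], fun W => ?_⟩
  obtain ⟨C1, h1, b1⟩ := hf.b W
  exact ⟨|a| * C1, by positivity, fun s hs => by rw [abs_mul]; gcongr; exact b1 s hs⟩

lemma MC_smul_right (f g : Real → Real) (a w : Real) : MC f (fun s => a * g s) w = a * MC f g w := by
  unfold MC
  rw [← integral_const_mul]
  grind

lemma MC_assoc {f g h : Real → Real} (hf : LB f) (hg : LB g) (hh : LB h) (w : Real) : MC f (MC g h) w = MC (MC f g) h w := by
  have e1 : MC (MC f g) h w = ∫ v in Set.Ioi 0, ∫ s in Set.Ioi 0, f s * g (v/s) / s * h (w/v) / v := by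
    unfold MC
    refine setIntegral_congr_fun measurableSet_Ioi fun v hv => ?_
    rw [← integral_mul_const, ← integral_div]
  have e2 : MC f (MC g h) w = ∫ s in Ioi 0, ∫ v in Ioi 0, f s * g (v/s) / s * h (w/v) / v := by
    unfold MC
    refine setIntegral_congr_fun measurableSet_Ioi fun s hs => ?_
    have hs0 : 0 < s := hs
    rw [← Haar_mul (fun v => f s * g (v/s) / s * h (w/v)) hs0, mul_div_right_comm, ← integral_const_mul]
    refine setIntegral_congr_fun measurableSet_Ioi fun r hr => ?_
    have hr0 : 0 < r := hr
    rw [mul_div_cancel_left₀ _ hs0.ne', div_div]; ring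
  rw [e1, e2]
  refine integral_integral_swap ?_
  obtain ⟨C, hC0, hC⟩ := hf.bd2 hg w
  obtain ⟨C2, hC20, hC2⟩ := hh.b w
  have hm : Measurable (Function.uncurry fun s v => f s * g (v/s) / s * h (w/v) / v) :=
    ((((hf.meas2 hg).comp measurable_swap)).mul (hh.m.comp (measurable_const.div measurable_snd))).div measurable_snd
  rw [Measure.prod_restrict]
  have h1 : IntegrableOn (Function.uncurry fun s v => f s * g (v/s) / s * h (w/v) / v) (Set.Icc 1 w ×ˢ Set.Icc 1 w) (volume.prod volume) := by
    refine Measure.integrableOn_of_bounded (M := C * C2) ?_ hm.aestronglyMeasurable ?_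
    · rw [Measure.prod_prod]; simp [ENNReal.mul_eq_top]
    refine (ae_restrict_iff' (measurableSet_Icc.prod measurableSet_Icc)).2 (Filter.Eventually.of_forall fun q hq => ?_)
    obtain ⟨⟨a1, a2⟩, a3, a4⟩ := hq
    have hv : 0 < q.2 := by linarith
    rw [Function.uncurry, norm_div, norm_mul, norm_eq_abs, norm_eq_abs, norm_eq_abs, abs_of_pos hv]
    calc _ ≤ |f q.1 * g (q.2/q.1) / q.1| * |h (w/q.2)| := div_le_self (by positivity) a3
      _ ≤ C * C2 := mul_le_mul (hC q.2 a4 q.1 (by linarith)) (hC2 _ (div_le_self (by linarith) a3)) (abs_nonneg _) hC0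
  refine h1.of_forall_sdiff_eq_zero (measurableSet_Ioi.prod measurableSet_Ioi) fun q hq => ?_
  obtain ⟨⟨b1, b2⟩, b3⟩ := hq
  have b1' : 0 < q.1 := b1
  have b2' : 0 < q.2 := b2
  simp only [Function.uncurry]
  by_cases h3 : q.2 ≤ w
  · by_cases h4 : q.1 ∈ Set.Icc 1 q.2
    · exact absurd ⟨⟨h4.1, h4.2.trans h3⟩, h4.1.trans h4.2, h3⟩ b3
    · rw [hf.zero hg b1' h4]; simp
  · rw [hh.z (w/q.2) (by rw [div_lt_one b2']; linarith)]; simp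

structure KD (ξ : Real → Real) (c p : Real) : Prop extends XC ξ c where
  p1 : 0.7 ≤ p
  p2 : p ≤ 0.9
  ph : phi ξ c p = 0

lemma XI.exKD {ξ : Real → Real} (h : XI ξ) : ∃ c p, KD ξ c p := by
  obtain ⟨c, ⟨c1, c2⟩, hc⟩ := h.exc
  have hC : XC ξ c := ⟨h, c1, c2, hc⟩
  obtain ⟨p, p1, p2, hp⟩ := hC.exp0
  exact ⟨c, p, hC, p1, p2, hp⟩

lemma shiftI (F : Real → Real) : ∫ u in Ioi 1, F (u+1) = ∫ s in Ioi 2, F s := by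
  have := (measurePreserving_add_right volume 1).setIntegral_preimage_emb (measurableEmbedding_addRight 1) F (Ioi 2)
  rw [← this]
  congr 2; ext x; simp; constructor <;> intro h <;> linarith

lemma shiftIn {F : Real → Real} (h : IntegrableOn (fun u => F (u+1)) (Set.Ioi 1)) : IntegrableOn F (Set.Ioi 2) := by
  have := (measurePreserving_add_right volume (1:Real)).integrableOn_comp_preimage (measurableEmbedding_addRight 1) (f := F) (s := Set.Ioi 2)
  have e : (fun x : Real => x + 1) ⁻¹' Set.Ioi 2 = Set.Ioi 1 := by grind
  rw [← this, e]
  exact h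

noncomputable def kap (ξ : Real → Real) (s : Real) : Real := ξ (s-1)

noncomputable def et (ξ : Real → Real) (c s : Real) : Real := ep ξ c (s-1)

noncomputable def jj (p s : Real) : Real := if s < 1 then 0 else -(p*(1-p)/(1+p)) * s^p - 2/(1+p)/s

noncomputable def kk (ξ : Real → Real) (p s : Real) : Real := jj p s + kap ξ s + MC (kap ξ) (jj p) s

section

variable {ξ : Real → Real} {c p : Real} (h : KD ξ c p)

include h

lemma KD.kap_et s : kap ξ s = et ξ c s + c * (s+1) := by rw [kap, et, ep]; ring

lemma KD.etm : Measurable (et ξ c) := by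
  unfold et ep
  exact (h.meas.comp (by fun_prop)).sub (by fun_prop)

lemma KD.et_b {s : Real} (hs : 2 ≤ s) : |et ξ c s| ≤ 12 / s := by
  refine (h.epb bL).trans ?_
  rw [div_le_div_iff₀ bL bL]; linarith

lemma KD.kapLB : LB (kap ξ) := by
  refine ⟨h.meas.comp (by fun_prop), fun s hs => h.z _ bL, fun W => ⟨6 + |W|, by positivity, fun s hs => ?_⟩⟩
  rcases lt_or_ge s 2 with h2 | h2
  · rw [kap, h.z _ bL, abs_zero]; positivity
  · rw [h.kap_et]
    have h1 := h.et_b h2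
    have h3 : 12 / s ≤ 6 := by rw [div_le_iff₀ bL]; linarith
    have c1 := h.c1
    have c2 := h.c2
    have h4 : |c * (s+1)| ≤ s := by rw [abs_of_nonneg (by nlinarith)]; nlinarith
    have := abs_add_le (et ξ c s) (c*(s+1))
    have := le_abs_self W
    linarith

lemma KD.jjLB : LB (jj p) := by
  have hp1 := h.p1
  have hp2 := h.p2
  refine ⟨Measurable.ite measurableSet_Iio measurable_const (by fun_prop), fun s hs => by simp [jj, hs], fun W => ⟨p*(1-p)/(1+p) * |W|^p + 2/(1+p), ?_, fun s hs => ?_⟩⟩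
  · have : 0 ≤ 1 - p := by linarith
    positivity
  · have : 0 ≤ 1 - p := by linarith
    unfold jj
    split_ifs with h1
    · rw [abs_zero]; positivity
    · push Not at h1
      have e : -(p*(1-p)/(1+p)) * s^p - 2/(1+p)/s = -(p*(1-p)/(1+p) * s^p + 2/(1+p)/s) := by ring
      rw [e, abs_neg, abs_of_nonneg (by positivity)]
      refine add_le_add ?_ (div_le_self (by positivity) h1)
      gcongr
      grind

lemma KD.kkLB : LB (kk ξ p) := (h.jjLB.add h.kapLB).add (MC_LB h.kapLB h.jjLB)

lemma KD.etI : IntegrableOn (et ξ c) (Ioi 2) := by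
  apply shiftIn; simpa [et] using h.epI

lemma KD.etpI : IntegrableOn (fun s => et ξ c s * s^(-p-1)) (Ioi 2) := by
  apply shiftIn; simpa [et] using h.epwI (by linarith [h.p1])

lemma KD.et_tot : ∫ s in Ioi 2, et ξ c s = 4*c-1 := by
  rw [← shiftI]; simpa [et] using h.Et

lemma KD.etp_tot : ∫ s in Ioi 2, et ξ c s * s^(-p-1) = -1 + c * (2^(1-p)/(1-p) - 2^(-p)/p) := by
  rw [← shiftI]
  have := h.ph
  unfold phi at this
  simp only [et, add_sub_cancel_right]
  linarith

lemma KD.E2 : ∫ s in Ioi 2, |et ξ c s| ≤ 0.485 := by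
  rw [← shiftI]
  have := h.E
  simp only [et, add_sub_cancel_right]
  linarith [h.c1]

noncomputable def SP (ξ : Real → Real) (c p w : Real) : Real := ∫ s in Ioi w, |et ξ c s| * s^(-p-1)

noncomputable def S0 (ξ : Real → Real) (c w : Real) : Real := ∫ s in Ioi w, |et ξ c s|

lemma KD.kk_form {w : Real} (hw : 2 ≤ w) : kk ξ p w = et ξ c w + p*(1-p)/(1+p) * w^p * (∫ s in Ioi w, et ξ c s * s^(-p-1)) + 2/(1+p)/w * (∫ s in Ioi w, et ξ c s) := by
  have hp1 := h.p1
  have hp2 := h.p2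
  have hw0 : 0 < w := bL
  have r1 := intervalIntegral.integral_Ioi_sub_Ioi h.etI hw
  have r2 := intervalIntegral.integral_Ioi_sub_Ioi h.etpI hw
  have i1 : IntervalIntegrable (et ξ c) volume 2 w := (iio hw).2 (h.etI.mono_set Ioc_subset_Ioi_self)
  have i2 : IntervalIntegrable (fun s => et ξ c s * s^(-p-1)) volume 2 w := (iio hw).2 (h.etpI.mono_set Set.Ioc_subset_Ioi_self)
  have ii : ∀ q : Real, IntervalIntegrable (fun s : Real => s^q) volume 2 w := fun q => intervalIntegral.intervalIntegrable_rpow (Or.inr (by rw [Set.uIcc_of_le hw]; intro hh; linarith [hh.1]))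
  have e1 : MC (kap ξ) (jj p) w = ∫ s in 2..w, (-(p*(1-p)/(1+p)) * w^p * (et ξ c s * s^(-p-1) + c * (s^(-p) + s^(-p-1))) + (- (2/(1+p)/w)) * (et ξ c s + c * (s+1))) := by
    rw [MC_interval h.kapLB h.jjLB bL]
    have z : ∫ s in 1..2, kap ξ s * jj p (w/s) / s = 0 := by
      rw [iole (by norm_num), integral_Ioc_eq_integral_Ioo, setIntegral_congr_fun (g := fun _ => (0:Real)) measurableSet_Ioo (fun s hs => by simp [kap, h.z (s-1) (by linarith [hs.2])])]
      simp
    have igr : IntegrableOn (fun s => kap ξ s * jj p (w/s) / s) (Set.Ioi 0) := h.kapLB.ig h.jjLB w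
    have ig : ∀ a b : Real, 1 ≤ a → 1 ≤ b → IntervalIntegrable (fun s => kap ξ s * jj p (w/s) / s) volume a b := fun a b ha hb =>
      intervalIntegrable_iff.2 (igr.mono_set fun s hs => by
        have := hs.1
        rw [Set.mem_Ioi]; rcases min_choice a b with hh | hh <;> rw [hh] at this <;> linarith)
    rw [← intervalIntegral.integral_add_adjacent_intervals (ig 1 2 le_rfl (by norm_num)) (ig 2 w (by norm_num) (by linarith)), z, zero_add]
    refine intervalIntegral.integral_congr fun s hs => ?_
    rw [Set.uIcc_of_le hw] at hs
    have hs0 : 0 < s := by grind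
    have h1 : ¬ (w / s < 1) := by rw [not_lt, le_div_iff₀ hs0, one_mul]; exact hs.2
    simp only [jj, if_neg h1]
    rw [h.kap_et, div_rpow hw0.le hs0.le, rpow_sub_one hs0.ne', rpow_neg hs0.le]
    grind
  have e2 : ∫ s in (2:Real)..w, (s^(-p) + s^(-p-1)) = (w^(1-p) - 2^(1-p))/(1-p) + (2^(-p) - w^(-p))/p := by
    have n0 : (0:Real) ∉ Set.uIcc 2 w := by rw [Set.uIcc_of_le hw]; intro hh; linarith [hh.1]
    rw [intervalIntegral.integral_add (ii _) (ii _), integral_rpow (Or.inr ⟨by linarith, n0⟩), integral_rpow (Or.inr ⟨by linarith, n0⟩)]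
    grind
  have e3 : ∫ s in (2:Real)..w, (s + 1) = (w^2/2 + w) - 4 := by
    rw [intervalIntegral.integral_add (by simp) (by simp), integral_id, intervalIntegral.integral_const, smul_eq_mul]; ring
  have i3 : IntervalIntegrable (fun s : Real => c * (s^(-p) + s^(-p-1))) volume 2 w := ((ii _).add (ii _)).const_mul c
  have i4 : IntervalIntegrable (fun s : Real => c * (s+1)) volume 2 w := (by fun_prop : Continuous fun s : Real => c * (s+1)).intervalIntegrable _ _
  rw [intervalIntegral.integral_add ((i2.add i3).const_mul _) ((i1.add i4).const_mul _), intervalIntegral.integral_const_mul, intervalIntegral.integral_const_mul,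
    intervalIntegral.integral_add i2 i3, intervalIntegral.integral_add i1 i4, intervalIntegral.integral_const_mul, intervalIntegral.integral_const_mul, e2, e3, ← r1, ← r2, h.et_tot, h.etp_tot] at e1
  rw [kk, e1, h.kap_et, jj, if_neg (by linarith)]
  have w1 : w^(1-p) = w / w^p := by rw [rpow_sub hw0, rpow_one]
  have w2 : w^(-p) = 1 / w^p := by rw [rpow_neg hw0.le]; simp
  rw [w1, w2]
  have hwp : 0 < w^p := by positivity
  have p0 : p ≠ 0 := by linarith
  have p3 : 1 - p ≠ 0 := by linarith
  have p4 : 1 + p ≠ 0 := by linarith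
  generalize (2:Real)^(1-p) = X1
  generalize (2:Real)^(-p) = X2
  generalize w^p = X3 at *
  grind

end

lemma S0_nonneg (ξ : Real → Real) (c w : Real) : 0 ≤ S0 ξ c w := integral_nonneg fun _ => abs_nonneg _

section

variable {ξ : Real → Real} {c p : Real} (h : KD ξ c p)

include h

lemma KD.et_ca {s : Real} (hs : 2 < s) : ContinuousAt (et ξ c) s := by
  have h1 : ContinuousAt ξ (s-1) := h.cont.continuousAt (Ici_mem_nhds bL)
  have h2 : ContinuousAt (fun s => ξ (s-1)) s := ContinuousAt.comp h1 (by fun_prop)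
  exact h2.sub (by fun_prop)

lemma KD.taild {F : Real → Real} (hF : IntegrableOn F (Ioi 2)) (hm : Measurable F) {r : Real} (hr : 2 < r) (hc : ContinuousAt F r) :
    HasDerivAt (fun w => ∫ s in Ioi w, F s) (-F r) r := by
  have e : ∀ w, 2 < w → ∫ s in Ioi w, F s = (∫ s in Ioi 2, F s) - ∫ s in 2..w, F s := by
    intro w hw
    linarith [intervalIntegral.integral_Ioi_sub_Ioi hF hw.le]
  have ii : IntervalIntegrable F volume 2 r := (iio hr.le).2 (hF.mono_set Ioc_subset_Ioi_self)
  have h1 := (intervalIntegral.integral_hasDerivAt_right ii hm.stronglyMeasurable.stronglyMeasurableAtFilter hc).const_sub (∫ s in Ioi 2, F s)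
  refine h1.congr_of_eventuallyEq ?_
  filter_upwards [Ioi_mem_nhds hr] with w hw using e w hw

lemma KD.tailc {F : Real → Real} (hF : IntegrableOn F (Ioi 2)) W (hW : 2 ≤ W) :
    ContinuousOn (fun w => ∫ s in Ioi w, F s) (Icc 2 W) := by
  have ii : IntervalIntegrable F volume 2 W := (iio hW).2 (hF.mono_set Ioc_subset_Ioi_self)
  have := (intervalIntegral.continuousOn_primitive_interval' ii (a := 2) (by simp))
  rw [uIcc_of_le hW] at this
  refine (continuousOn_const (c := ∫ s in Set.Ioi 2, F s)).sub this |>.congr fun w hw => ?_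
  have := intervalIntegral.integral_Ioi_sub_Ioi hF hw.1
  show ∫ s in Ioi w, F s = (∫ s in Ioi 2, F s) - ∫ s in 2..w, F s
  linarith

lemma KD.abspI : IntegrableOn (fun s => |et ξ c s| * s^(-p-1)) (Ioi 2) := by
  refine (integrableOn_congr_fun (fun s hs => ?_) measurableSet_Ioi).1 h.etpI.norm
  have hs0 : 0 < s := lt_trans bN hs
  rw [norm_mul, norm_of_nonneg (by positivity : 0 ≤ s^(-p-1)), norm_eq_abs]

lemma KD.SPle {w : Real} (hw : 2 ≤ w) : w^p * SP ξ c p w ≤ S0 ξ c w / w := by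
  have hw0 : 0 < w := bL
  have i1 : IntegrableOn (fun s => |et ξ c s| * s^(-p-1)) (Ioi w) := h.abspI.mono_set (Ioi_subset_Ioi hw)
  have i2 : IntegrableOn (fun s => |et ξ c s|) (Ioi w) := IntegrableOn.mono_set h.etI.norm (Ioi_subset_Ioi hw)
  have h1 : SP ξ c p w ≤ ∫ s in Ioi w, |et ξ c s| * w^(-p-1) := by
    refine setIntegral_mono_on i1 (i2.mul_const _) measurableSet_Ioi fun s hs => ?_
    exact mnl (rpow_le_rpow_of_nonpos hw0 (le_of_lt hs) (by linarith [h.p1])) (abs_nonneg _)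
  rw [integral_mul_const] at h1
  calc w^p * SP ξ c p w ≤ w^p * ((∫ s in Set.Ioi w, |et ξ c s|) * w^(-p-1)) := by gcongr
    _ = _ := by rw [rpow_sub_one hw0.ne', rpow_neg hw0.le, S0]; field_simp

lemma KD.kk_abs {w : Real} (hw : 2 ≤ w) : |kk ξ p w| ≤ |et ξ c w| + p*(1-p)/(1+p) * w^p * SP ξ c p w + 2/(1+p)/w * S0 ξ c w := by
  have hp1 := h.p1
  have hp2 : 0 < 1 - p := by linarith [h.p2]
  have hw0 : 0 < w := bL
  rw [h.kk_form hw]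
  refine (abs_add_le _ _).trans (add_le_add ((abs_add_le _ _).trans (add_le_add le_rfl ?_)) ?_)
  · rw [abs_mul, abs_of_nonneg (by positivity)]
    gcongr
    refine (abs_integral_le_integral_abs).trans (le_of_eq (scf measurableSet_Ioi fun s hs => ?_))
    have hs0 : 0 < s := lt_trans hw0 hs
    rw [abs_mul, abs_of_nonneg (by positivity : 0 ≤ s^(-p-1))]
  · rw [abs_mul, abs_of_nonneg (by positivity)]
    gcongr
    exact abs_integral_le_integral_abs

lemma KD.kkint (a b : Real) (ha : 1 ≤ a) (hb : 1 ≤ b) : IntervalIntegrable (fun r => |kk ξ p r| / r) volume a b := by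
  obtain ⟨C, hC0, hC⟩ := h.kkLB.b (max a b)
  rw [intervalIntegrable_iff]
  refine Measure.integrableOn_of_bounded (M := C) (by simp) ((continuous_abs.measurable.comp h.kkLB.m).div measurable_id).aestronglyMeasurable ?_
  refine (ari measurableSet_uIoc).2 (Eventually.of_forall fun s hs => ?_)
  have h1 : 1 ≤ s := (le_min ha hb).trans hs.1.le
  rw [norm_div, norm_eq_abs, norm_eq_abs, abs_abs, abs_of_pos (a := s) bL]
  exact (div_le_self (abs_nonneg _) h1).trans (hC s hs.2)

lemma KD.q2 {w : Real} (hw : 2 ≤ w) : ∫ r in (2:Real)..w, |kk ξ p r| / r ≤ S0 ξ c 2 / (1+p) := by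
  have hp1 := h.p1
  have hp2 : 0 < 1 - p := by linarith [h.p2]
  have hp0 : 0 < p := by linarith
  have iabs : IntegrableOn (fun s => |et ξ c s|) (Ioi 2) := h.etI.norm
  have mabs : Measurable (fun s => |et ξ c s|) := continuous_abs.measurable.comp h.etm
  have mabsp : Measurable (fun s => |et ξ c s| * s^(-p-1)) := mabs.mul (by fun_prop)
  let H : Real → Real := fun r => 1/(1+p) * (S0 ξ c 2 - S0 ξ c r) - (1-p)/(1+p) * 2^p * (SP ξ c p 2 - SP ξ c p r) + (1-p)/(1+p) * ((r^p - 2^p) * SP ξ c p r) + 2/(1+p) * ((1/2 - r⁻¹) * S0 ξ c r)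
  have hH : ∫ r in 2..w, |kk ξ p r| / r ≤ H w - H 2 := by
    refine intervalIntegral.integral_le_sub_of_hasDeriv_right_of_le (g' := fun r => 1/(1+p) * (0 - -|et ξ c r|) - (1-p)/(1+p) * 2^p * (0 - -(|et ξ c r| * r^(-p-1))) + (1-p)/(1+p) * ((p * r^(p-1)) * SP ξ c p r + (r^p - 2^p) * (-(|et ξ c r| * r^(-p-1)))) + 2/(1+p) * ((-(-(r^2)⁻¹)) * S0 ξ c r + (1/2 - r⁻¹) * (-|et ξ c r|))) hw ?_ ?_ ?_ ?_
    · have c1 := h.tailc iabs w hw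
      have c2 := h.tailc h.abspI w hw
      have c3 : ContinuousOn (fun r : Real => r^p) (Icc 2 w) := by
        intro r hr; exact (continuousAt_rpow_const _ _ (Or.inl (by linarith [hr.1]))).continuousWithinAt
      have c4 : ContinuousOn (fun r : Real => r⁻¹) (Icc 2 w) := continuousOn_id.inv₀ (by intro r hr; have := hr.1; simp; linarith)
      exact (((continuousOn_const.mul (continuousOn_const.sub c1)).sub (continuousOn_const.mul (continuousOn_const.sub c2))).add (continuousOn_const.mul ((c3.sub continuousOn_const).mul c2))).add (continuousOn_const.mul ((continuousOn_const.sub c4).mul c1))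
    · intro r hr
      have hr2 := hr.1
      have d1 := h.taild iabs mabs hr2 (h.et_ca hr2).abs
      have d2 := h.taild h.abspI mabsp hr2 ((h.et_ca hr2).abs.mul (continuousAt_rpow_const _ _ (Or.inl bL)))
      have d3 := (hasDerivAt_rpow_const (x := r) (p := p) (Or.inl (by linarith))).sub_const (2^p)
      have d4 := (hasDerivAt_inv (x := r) (by linarith)).const_sub (1/2)
      have z : ∀ a : Real, HasDerivAt (fun _ : Real => a) 0 r := fun a => hasDerivAt_const r a
      exact (((((((z (S0 ξ c 2)).sub d1).const_mul (1/(1+p))).sub (((z (SP ξ c p 2)).sub d2).const_mul ((1-p)/(1+p) * 2^p)))).add ((d3.mul d2).const_mul ((1-p)/(1+p)))).add ((d4.mul d1).const_mul (2/(1+p)))).hasDerivWithinAt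
    · rw [← intervalIntegrable_iff_integrableOn_Icc_of_le hw]; exact h.kkint 2 w (by norm_num) (by linarith)
    · intro r hr
      have hr2 := hr.1
      have hr0 : 0 < r := by linarith
      have hk := h.kk_abs hr2.le
      rw [div_le_iff₀ hr0]
      refine hk.trans (le_of_eq ?_)
      rw [rpow_sub_one hr0.ne', rpow_sub_one hr0.ne', rpow_neg hr0.le]
      have hrp : 0 < r^p := by positivity
      generalize r^p = R at *
      generalize (2:Real)^p = R2 at *
      field_simp
      ring
  refine hH.trans ?_
  have hw0 : 0 < w := by linarith
  have h2 : H 2 = 0 := by simp [H]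
  have hS := S0_nonneg ξ c w
  have hSP := h.SPle hw
  have e : H w = 1/(1+p) * (S0 ξ c 2 - S0 ξ c w - (1-p)*2^p*SP ξ c p 2 + (1-p) * (w^p * SP ξ c p w) + S0 ξ c w - 2 * (S0 ξ c w / w)) := by
    simp only [H]; field_simp; ring
  rw [h2, sub_zero, e, div_eq_mul_one_div (S0 ξ c 2), mul_comm (S0 ξ c 2)]
  refine mul_le_mul_of_nonneg_left ?_ (by positivity)
  have h3 : 0 ≤ (1-p)*2^p*SP ξ c p 2 := by
    have : 0 ≤ SP ξ c p 2 := setIntegral_nonneg measurableSet_Ioi fun s hs => by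
      have : (0:Real) < s := lt_trans (by norm_num) hs
      positivity
    positivity
  have h4 : 0 ≤ S0 ξ c w / w := by positivity
  nlinarith

lemma KD.q1 : ∫ r in (1:Real)..2, |kk ξ p r| / r = (1-p)/(1+p) * (2^p - 1) + 1/(1+p) := by
  have hp1 := h.p1
  have hp2 : 0 < 1 - p := by linarith [h.p2]
  have hp0 : 0 < p := by linarith
  have e : ∫ r in (1:Real)..2, |kk ξ p r| / r = ∫ r in (1:Real)..2, (p*(1-p)/(1+p) * r^(p-1) + 2/(1+p) * r^(-2:Real)) := by
    rw [intervalIntegral.integral_of_le (by norm_num), intervalIntegral.integral_of_le (by norm_num), integral_Ioc_eq_integral_Ioo, integral_Ioc_eq_integral_Ioo]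
    refine setIntegral_congr_fun measurableSet_Ioo fun r hr => ?_
    have hr0 : 0 < r := by grind
    have k1 : kap ξ r = 0 := h.z _ (by linarith [hr.2])
    have k2 : MC (kap ξ) (jj p) r = 0 := by
      rw [MC, setIntegral_congr_fun (g := fun _ => (0:Real)) measurableSet_Ioi fun s hs => ?_]
      · simp
      · by_cases h2 : s ∈ Set.Icc 1 r
        · simp [kap, h.z (s-1) (by linarith [h2.2, hr.2])]
        · exact h.kapLB.zero h.jjLB hs h2
    rw [kk, k1, k2, jj, if_neg (by linarith [hr.1]), add_zero, add_zero]
    have e : -(p*(1-p)/(1+p)) * r^p - 2/(1+p)/r = -(p*(1-p)/(1+p) * r^p + 2/(1+p)/r) := by ring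
    rw [e, abs_neg, abs_of_nonneg (by positivity), rpow_sub_one hr0.ne', rpow_neg hr0.le, rpow_two]
    field_simp
  rw [e]
  have n0 : (0:Real) ∉ Set.uIcc 1 2 := by simp
  rw [intervalIntegral.integral_add ((intervalIntegral.intervalIntegrable_rpow (Or.inr n0)).const_mul _) ((intervalIntegral.intervalIntegrable_rpow (Or.inr n0)).const_mul _), intervalIntegral.integral_const_mul, intervalIntegral.integral_const_mul,
    integral_rpow (Or.inl (by linarith)), integral_rpow (Or.inr ⟨by norm_num, n0⟩)]
  rw [show (-2+1:Real) = -1 by norm_num, rpow_neg_one, rpow_neg_one, one_rpow]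
  grind

lemma KD.q : ∃ q : Real, 0 ≤ q ∧ q < 1 ∧ ∀ w : Real, 1 ≤ w → ∫ r in 1..w, |kk ξ p r| / r ≤ q := by
  have hp1 := h.p1
  have hp2 : 0 < 1 - p := by linarith [h.p2]
  have hE := h.E2
  have hb : 2^p ≤ 1 + p := by
    have := rpow_one_add_le_one_add_mul_self (s := 1) (p := p) bN bL bL
    grind
  have key : ∀ w : Real, 2 ≤ w → ∫ r in 1..w, |kk ξ p r| / r ≤ (1-p)/(1+p) * (2^p - 1) + 1/(1+p) + S0 ξ c 2 / (1+p) := by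
    intro w hw
    rw [← iadj (h.kkint 1 2 le_rfl bN) (h.kkint 2 w bN bL), h.q1]
    linarith [h.q2 hw]
  refine ⟨(1-p)/(1+p) * (2^p - 1) + 1/(1+p) + S0 ξ c 2 / (1+p), ?_, ?_, fun w hw => ?_⟩
  · refine le_trans ?_ (key 2 le_rfl)
    refine inn bN fun r hr => ?_
    have := hr.1
    positivity
  · have e : (1-p)/(1+p) * (2^p - 1) + 1/(1+p) + S0 ξ c 2 / (1+p) = ((1-p)*(2^p-1) + 1 + S0 ξ c 2)/(1+p) := by ring
    rw [e, div_lt_one bL]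
    have hE' : S0 ξ c 2 ≤ 0.485 := hE
    nlinarith
  · refine le_trans ?_ (key (w+2) (by linarith))
    rw [← intervalIntegral.integral_add_adjacent_intervals (h.kkint 1 w le_rfl hw) (h.kkint w (w+2) hw (by linarith))]
    have : 0 ≤ ∫ r in w..(w+2), |kk ξ p r| / r := by
      refine intervalIntegral.integral_nonneg (by linarith) fun r hr => ?_
      have := hr.1
      have : 0 ≤ r := by linarith
      positivity
    linarith

end

section

variable {ξ : Real → Real} {c p : Real} (h : KD ξ c p)

include h

lemma KD.invA {D g : Real → Real} (hD : LB D) (hg : LB g) (he : ∀ w, 1 ≤ w → D w + MC (kap ξ) D w = g w) w :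
    D w + MC (kk ξ p) D w = g w + MC (jj p) g w := by
  have hk := h.kapLB
  have hj := h.jjLB
  have e0 : (fun w => D w + MC (kap ξ) D w) = g := by
    ext w
    rcases lt_or_ge w 1 with h1 | h1
    · rw [hD.z w h1, (MC_LB hk hD).z w h1, hg.z w h1, add_zero]
    · exact he w h1
  have e1 : MC (jj p) (kap ξ) = MC (kap ξ) (jj p) := by
    ext w
    rcases lt_or_ge w 1 with h1 | h1
    · rw [(MC_LB hk hj).z w h1, (MC_LB hj hk).z w h1]
    · exact MC_comm _ _ bL
  have e2 : MC (kk ξ p) D w = MC (jj p) D w + MC (kap ξ) D w + MC (MC (kap ξ) (jj p)) D w := by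
    have := MC_add_left (hj.add hk) (MC_LB hk hj) hD w
    rw [MC_add_left hj hk hD w] at this
    exact this
  rw [e2, ← e0, MC_add_right hj hD (MC_LB hk hD), MC_assoc hj hk hD, e1]
  ring

lemma KD.invB {q : Real} (hq0 : 0 ≤ q) (hq1 : q < 1) (hq : ∀ w : Real, 1 ≤ w → ∫ r in (1:Real)..w, |kk ξ p r| / r ≤ q)
    {D : Real → Real} (hD : LB D) {M : Real} (hM : ∀ w, 1 ≤ w → |D w + MC (kk ξ p) D w| ≤ M) (w : Real) (hw : 1 ≤ w) : |D w| ≤ M / (1-q) := by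
  obtain ⟨C, hC0, hC⟩ := hD.b w
  set S := sSup ((fun s => |D s|) '' Set.Icc 1 w) with hS
  have bd : BddAbove ((fun s => |D s|) '' Set.Icc 1 w) := ⟨C, by rintro _ ⟨s, hs, rfl⟩; exact hC s hs.2⟩
  have hle : ∀ s ∈ Set.Icc 1 w, |D s| ≤ S := fun s hs => le_csSup bd ⟨s, hs, rfl⟩
  have hS0 : 0 ≤ S := (abs_nonneg _).trans (hle w ⟨hw, le_rfl⟩)
  have key : ∀ s ∈ Set.Icc 1 w, |D s| ≤ M + q * S := by
    intro s hs
    have h1 : |MC (kk ξ p) D s| ≤ q * S := by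
      rw [MC_interval h.kkLB hD hs.1]
      have : ‖∫ r in (1:Real)..s, kk ξ p r * D (s/r) / r‖ ≤ ∫ r in (1:Real)..s, |kk ξ p r| / r * S := by
        refine intervalIntegral.norm_integral_le_of_norm_le hs.1 (Filter.Eventually.of_forall fun r hr => ?_) ((h.kkint 1 s le_rfl hs.1).mul_const _)
        have hr0 : 0 < r := by grind
        rw [norm_div, norm_mul, norm_eq_abs, norm_eq_abs, norm_eq_abs, abs_of_pos hr0, mul_div_right_comm]
        refine mul_le_mul_of_nonneg_left (hle _ ⟨(one_le_div hr0).2 hr.2, (div_le_self (by linarith [hs.1]) hr.1.le).trans hs.2⟩) (by positivity)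
      rw [intervalIntegral.integral_mul_const] at this
      refine this.trans ?_
      gcongr
      exact hq s hs.1
    have h2 := hM s hs.1
    rw [abs_le] at *
    constructor <;> linarith [h2.1, h2.2, h1.1, h1.2]
  have : S ≤ M + q * S := csSup_le ⟨_, ⟨w, ⟨hw, le_rfl⟩, rfl⟩⟩ (by rintro _ ⟨s, hs, rfl⟩; exact key s hs)
  rw [le_div_iff₀ (by linarith)]
  nlinarith [hle w ⟨hw, le_rfl⟩]

lemma KD.gLB {e : Real → Real} (hm : Measurable e) {M b : Real} (he : ∀ s, 1 ≤ s → |e s| ≤ M) : LB (fun s => if s < 1 then 0 else b * s + e s) := by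
  have hM : 0 ≤ M := (abs_nonneg _).trans (he 1 le_rfl)
  refine ⟨Measurable.ite measurableSet_Iio measurable_const (by fun_prop), fun s hs => by simp [hs], fun W => ⟨|b| * |W| + M, by positivity, fun s hs => ?_⟩⟩
  split_ifs with h1
  · rw [abs_zero]; positivity
  · push Not at h1
    refine (abs_add_le _ _).trans (add_le_add ?_ (he s h1))
    rw [abs_mul]
    gcongr

lemma KD.epI1 {e : Real → Real} (hm : Measurable e) {M : Real} (he : ∀ s, 1 ≤ s → |e s| ≤ M) : IntegrableOn (fun s => e s * s^(-p-1)) (Ioi 1) := by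
  have h0 : IntegrableOn (fun s : Real => s^(-p-1)) (Ioi 1) := integrableOn_Ioi_rpow_of_lt (by linarith [h.p1]) one_pos
  refine Integrable.bdd_mul (c := M) h0 hm.aestronglyMeasurable ?_
  exact (ari measurableSet_Ioi).2 (Eventually.of_forall fun s hs => he s (le_of_lt hs))

lemma KD.Gform {e : Real → Real} (hm : Measurable e) {M b : Real} (he : ∀ s, 1 ≤ s → |e s| ≤ M) {w : Real} (hw : 1 ≤ w) :
    MC (jj p) (fun s => if s < 1 then 0 else b * s + e s) w = b * ((p * w^p + 1/w)/(1+p) - w)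
      - p*(1-p)/(1+p) * w^p * (∫ s in 1..w, e s * s^(-p-1)) - 2/(1+p)/w * ∫ s in 1..w, e s := by
  have hp1 := h.p1
  have hp2 : 0 < 1 - p := by linarith [h.p2]
  have hw0 : 0 < w := bL
  have i1 : IntervalIntegrable (fun s => e s * s^(-p-1)) volume 1 w :=
    (iio hw).2 ((h.epI1 hm he).mono_set Ioc_subset_Ioi_self)
  have i2 : IntervalIntegrable e volume 1 w := by
    rw [iio hw]
    refine Measure.integrableOn_of_bounded (M := M) (by simp) hm.aestronglyMeasurable ?_
    exact (ari measurableSet_Ioc).2 (Eventually.of_forall fun s hs => he s hs.1.le)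
  have n0 : 0 ∉ uIcc 1 w := by rw [uIcc_of_le hw]; intro hh; linarith [hh.1]
  have i3 : IntervalIntegrable (fun s : Real => s^(-p)) volume 1 w := intervalIntegral.intervalIntegrable_rpow (Or.inr n0)
  have i4 : IntervalIntegrable (fun s : Real => s) volume 1 w := intervalIntegral.intervalIntegrable_id
  rw [MC_comm _ _ hw0, MC_interval (h.gLB hm he) h.jjLB hw]
  have e1 : ∫ s in (1:Real)..w, (if s < 1 then 0 else b * s + e s) * jj p (w/s) / s =
      ∫ s in (1:Real)..w, ((-(p*(1-p)/(1+p)) * w^p * b * s^(-p) - 2/(1+p)/w * b * s) + (-(p*(1-p)/(1+p)) * w^p * (e s * s^(-p-1)) - 2/(1+p)/w * e s)) := by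
    refine intervalIntegral.integral_congr fun s hs => ?_
    rw [Set.uIcc_of_le hw] at hs
    have hs0 : 0 < s := by grind
    rw [if_neg (by linarith [hs.1]), jj, if_neg (by rw [not_lt, one_le_div hs0]; exact hs.2), div_rpow hw0.le hs0.le, rpow_sub_one hs0.ne', rpow_neg hs0.le]
    grind
  rw [e1, intervalIntegral.integral_add ((i3.const_mul _).sub (i4.const_mul _)) ((i1.const_mul _).sub (i2.const_mul _)),
    intervalIntegral.integral_sub (i3.const_mul _) (i4.const_mul _), intervalIntegral.integral_sub (i1.const_mul _) (i2.const_mul _)]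
  rw [intervalIntegral.integral_const_mul, intervalIntegral.integral_const_mul, intervalIntegral.integral_const_mul, intervalIntegral.integral_const_mul]
  rw [integral_rpow (Or.inl (by linarith)), integral_id, one_rpow, show -p + 1 = 1 - p by ring, rpow_sub hw0, rpow_one]
  have : 0 < w^p := by positivity
  grind

lemma KD.tailb {e : Real → Real} (hm : Measurable e) {M : Real} (he : ∀ s, 1 ≤ s → |e s| ≤ M) {w : Real} (hw : 1 ≤ w) :
    w^p * |(∫ s in Ioi 1, e s * s^(-p-1)) - ∫ s in 1..w, e s * s^(-p-1)| ≤ M / p := by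
  have hp1 := h.p1
  have hw0 : 0 < w := bL
  have := intervalIntegral.integral_Ioi_sub_Ioi (h.epI1 hm he) hw
  rw [← this, sub_sub_cancel]
  have hI : IntegrableOn (fun s : Real => M * s^(-p-1)) (Ioi w) := (integrableOn_Ioi_rpow_of_lt (by linarith) hw0).const_mul M
  have h1 : ‖∫ s in Ioi w, e s * s^(-p-1)‖ ≤ ∫ s in Ioi w, M * s^(-p-1) := by
    refine norm_integral_le_of_norm_le hI ((ari measurableSet_Ioi).2 (Eventually.of_forall fun s hs => ?_))
    have hs1 : 1 ≤ s := hw.trans (le_of_lt hs)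
    rw [norm_mul, norm_of_nonneg (by positivity : 0 ≤ s^(-p-1)), norm_eq_abs]
    gcongr
    grind
  rw [integral_const_mul, integral_Ioi_rpow_of_lt bL hw0, show -p-1+1 = -p by ring, rpow_neg hw0.le] at h1
  rw [← norm_eq_abs]
  calc _ ≤ w^p * (M * (-(w^p)⁻¹ / -p)) := by gcongr
    _ = M / p := by field_simp

lemma KD.constI : ∫ s in Ioi 1, s^(-p-1) = 1/p := by
  rw [integral_Ioi_rpow_of_lt (by linarith [h.p1]) one_pos]
  simp

lemma KD.inv : ∃ C0 : Real, 0 ≤ C0 ∧ ∀ (f L e : Real → Real) (l β M : Real), LB f → LB L → Measurable e → |β| ≤ M → (∀ s, 1 ≤ s → |e s| ≤ M) →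
    (∀ w, 1 ≤ w → L w + MC (kap ξ) L w = w - 1) → (∀ w, 1 ≤ w → f w + MC (kap ξ) f w = l * (w-1) + β * w + e w) →
    ∃ a, |a| ≤ C0 * M ∧ ∀ w, 1 ≤ w → |f w - (l + a) * L w| ≤ C0 * M := by
  obtain ⟨q, q0, q1, hq⟩ := h.q
  have hp1 := h.p1
  have hp2 : 0 < 1 - p := by linarith [h.p2]
  refine ⟨20 / (1-q), by have : 0 < 1 - q := bL
                         positivity, fun f L e l β M hf hL hm hβ he eL ef => ?_⟩
  have hM0 : 0 ≤ M := (abs_nonneg _).trans hβ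
  set I := ∫ s in Ioi (1:Real), e s * s^(-p-1) with hI
  set a := β * p - p*(1-p) * I with ha
  have hIb : |I| ≤ M / p := by
    have := h.tailb hm he le_rfl
    simpa using this
  have hab : |a| ≤ 2 * M := by
    rw [ha]
    refine (abs_sub _ _).trans ?_
    rw [abs_mul, abs_mul, abs_of_pos (by linarith : 0 < p), abs_of_pos (by positivity : 0 < p*(1-p))]
    calc _ ≤ M * p + p*(1-p) * (M/p) := by gcongr
      _ = M := by field_simp; ring
      _ ≤ _ := by linarith
  have hq' : 2 * M ≤ 20/(1-q) * M := by
    gcongr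
    rw [le_div_iff₀ (by linarith)]; linarith
  refine ⟨a, hab.trans hq', ?_⟩
  set e1 : Real → Real := fun s => e s + a with he1
  have m1 : Measurable e1 := hm.add_const _
  have b1 : ∀ s, 1 ≤ s → |e1 s| ≤ 3 * M := fun s hs => (abs_add_le _ _).trans (by linarith [he s hs])
  set D : Real → Real := fun s => f s + (-(l+a)) * L s with hD
  have hDL : LB D := hf.add (hL.smul _)
  have hg := h.gLB m1 (b := β - a) b1
  have eq1 := h.invA hDL hg (by
    intro w hw
    rw [hD, MC_add_right h.kapLB hf (hL.smul _), MC_smul_right, if_neg (by linarith)]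
    linear_combination ef w hw - (l+a) * eL w hw)
  have I1 : ∫ s in Set.Ioi (1:Real), e1 s * s^(-p-1) = I + a / p := by
    have h0 : IntegrableOn (fun s : Real => s^(-p-1)) (Set.Ioi 1) := integrableOn_Ioi_rpow_of_lt (by linarith [h.p1]) one_pos
    simp only [he1, add_mul]
    rw [integral_add (h.epI1 hm he) (h0.const_mul _), integral_const_mul, h.constI]; ring
  have key : ∀ w, 1 ≤ w → |D w + MC (kk ξ p) D w| ≤ 20 * M := by
    intro w hw
    have hw0 : 0 < w := by linarith
    rw [eq1, h.Gform m1 b1 hw, if_neg (by linarith)]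
    have t1 := h.tailb m1 b1 hw
    rw [I1] at t1
    have t2 : |∫ s in (1:Real)..w, e1 s| ≤ 3 * M * w := by
      have := intervalIntegral.norm_integral_le_of_norm_le_const (a := 1) (b := w) (C := 3*M) (f := e1) fun s hs => by
        rw [Set.uIoc_of_le hw] at hs; exact b1 s hs.1.le
      rw [abs_of_nonneg (by linarith)] at this
      rw [← norm_eq_abs]
      linarith
    have t3 := b1 w hw
    set J := ∫ s in (1:Real)..w, e1 s * s^(-p-1)
    set J2 := ∫ s in (1:Real)..w, e1 s
    have eqn : (β-a)*w + e1 w + ((β-a)*((p * w^p + 1/w)/(1+p) - w) - p*(1-p)/(1+p) * w^p * J - 2/(1+p)/w*J2)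
      = (β-a)*(1/w)/(1+p) + e1 w + p*(1-p)/(1+p) * (w^p * (I + a/p - J)) - 2/(1+p)*(J2/w) := by
      have : a * (1+p) = a + p * a := by ring
      have hpI : p*(1-p)*I = β*p - a := by linarith
      have hpI' : I = (β * p - a)/(p*(1-p)) := by field_simp; linear_combination hpI
      rw [hpI']
      generalize w^p = W at *
      field_simp
      ring
    rw [eqn]
    have u1 : |(β-a)*(1/w)/(1+p)| ≤ 3 * M := by
      rw [abs_div, abs_mul, abs_of_pos (by positivity : 0 < 1/w), abs_of_pos (by linarith : 0 < 1+p), div_le_iff₀ (by linarith)]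
      have : 1/w ≤ 1 := by rw [div_le_one hw0]; exact hw
      have h3 : |β-a| ≤ 3*M := (abs_sub _ _).trans (by linarith)
      calc |β-a| * (1/w) ≤ 3 * M * 1 := by gcongr
        _ ≤ 3*M*(1+p) := by gcongr; linarith
    have u2 : |p*(1-p)/(1+p) * (w^p * (I + a/p - J))| ≤ 3 * M := by
      rw [abs_mul, abs_mul, abs_of_pos (by positivity : 0 < w^p), abs_of_pos (by positivity : 0 < p*(1-p)/(1+p))]
      calc _ ≤ p*(1-p)/(1+p) * (3*M/p) := by gcongr
        _ = 3*M * ((1-p)/(1+p)) := by field_simp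
        _ ≤ 3*M*1 := by gcongr; rw [div_le_one (by linarith)]; linarith
        _ = _ := by ring
    have u3 : |2/(1+p)*(J2/w)| ≤ 6 * M := by
      rw [abs_mul, abs_div J2, abs_of_pos hw0, abs_of_pos (by positivity : 0 < 2/(1+p))]
      calc _ ≤ 2/(1+p) * (3*M*w/w) := by gcongr
        _ = 3*M * (2/(1+p)) := by field_simp
        _ ≤ 3*M*2 := by gcongr; rw [div_le_iff₀ (by linarith)]; linarith
        _ = _ := by ring
    rw [abs_le] at *
    constructor <;> linarith [u1.1, u1.2, u2.1, u2.2, u3.1, u3.2, t3.1, t3.2]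
  intro w hw
  have := h.invB q0 q1 hq hDL key w hw
  grind

lemma KD.lamas {L : Real → Real} (hL : LB L) (eL : ∀ w, 1 ≤ w → L w + MC (kap ξ) L w = w - 1) :
    ∃ A C : Real, 0 < A ∧ ∀ w, 1 ≤ w → |L w - A * w^p| ≤ C := by
  obtain ⟨q, q0, q1, hq⟩ := h.q
  have hp1 := h.p1
  have hp2 : 0 < 1 - p := by linarith [h.p2]
  have kI : IntegrableOn (fun r => |kk ξ p r| / r) (Ioi 1) := by
    refine integrableOn_Ioi_of_intervalIntegral_norm_bounded q 1 (fun i => ?_) tendsto_id ?_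
    · rcases le_total 1 i with hi | hi
      · exact (iio hi).1 (h.kkint 1 i le_rfl hi)
      · simp [Set.Ioc_eq_empty_of_le hi]
    · filter_upwards [Filter.eventually_ge_atTop 1] with w hw
      refine le_trans (le_of_eq ?_) (hq w hw)
      refine intervalIntegral.integral_congr fun s hs => ?_
      rw [id, Set.uIcc_of_le hw] at hs
      have : 0 < s := by grind
      rw [norm_of_nonneg (by positivity)]
  have kpI : IntegrableOn (fun r => kk ξ p r * r^(-p-1)) (Set.Ioi 1) := by
    refine Integrable.mono' kI (h.kkLB.m.mul (by fun_prop)).aestronglyMeasurable ((ae_restrict_iff' measurableSet_Ioi).2 (Filter.Eventually.of_forall fun s hs => ?_))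
    have hs1 : (1:Real) < s := hs
    have : 0 < s := by linarith
    rw [norm_mul, norm_of_nonneg (by positivity : 0 ≤ s^(-p-1)), norm_eq_abs, div_eq_mul_inv, ← rpow_neg_one]
    gcongr 2
    · linarith
    · linarith
  have tail : ∀ w, 1 ≤ w → w^p * |∫ s in Set.Ioi w, kk ξ p s * s^(-p-1)| ≤ q := by
    intro w hw
    have hw0 : 0 < w := by linarith
    have kIw := kI.mono_set (Set.Ioi_subset_Ioi hw)
    have h1 : ‖∫ s in Set.Ioi w, kk ξ p s * s^(-p-1)‖ ≤ ∫ s in Set.Ioi w, (w^p)⁻¹ * (|kk ξ p s| / s) := by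
      refine norm_integral_le_of_norm_le (kIw.const_mul _) ((ae_restrict_iff' measurableSet_Ioi).2 (Filter.Eventually.of_forall fun s hs => ?_))
      have hs1 : w < s := hs
      have hs0 : 0 < s := by linarith
      rw [norm_mul, norm_of_nonneg (by positivity : 0 ≤ s^(-p-1)), norm_eq_abs, rpow_sub_one hs0.ne', rpow_neg hs0.le]
      calc |kk ξ p s| * ((s^p)⁻¹ / s) = (s^p)⁻¹ * (|kk ξ p s| / s) := by ring
        _ ≤ _ := by gcongr
    rw [integral_const_mul] at h1
    have h2 : ∫ s in Set.Ioi w, |kk ξ p s| / s ≤ q := by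
      refine (setIntegral_mono_set kI ((ae_restrict_iff' measurableSet_Ioi).2 (Filter.Eventually.of_forall fun s hs => ?_)) (Filter.Eventually.of_forall (Set.Ioi_subset_Ioi hw))).trans ?_
      · have hs1 : (1:Real) < s := hs
        positivity
      · refine le_of_tendsto (intervalIntegral_tendsto_integral_Ioi 1 kI Filter.tendsto_id) ?_
        filter_upwards [Filter.eventually_ge_atTop 1] with w hw using hq w hw
    rw [← norm_eq_abs]
    calc _ ≤ w^p * ((w^p)⁻¹ * q) := by gcongr; exact h1.trans (by gcongr)
      _ = q := by field_simp
  set K := ∫ s in Set.Ioi 1, kk ξ p s * s^(-p-1) with hK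
  have hKq : |K| ≤ q := by simpa using tail 1 le_rfl
  have hK1 : 0 < 1 + K := by grind
  set A := 1/((1+p)*(1+K)) with hA
  have hA0 : 0 < A := by positivity
  set P : Real → Real := fun s => if s < 1 then 0 else s^p with hP
  have hPL : LB P := by
    refine ⟨Measurable.ite measurableSet_Iio measurable_const (by fun_prop), fun s hs => by simp [hP, hs], fun W => ⟨|W|^p, by positivity, fun s hs => ?_⟩⟩
    rw [hP]; dsimp only
    split_ifs with h1
    · rw [abs_zero]; positivity
    · push Not at h1
      rw [abs_of_nonneg (by positivity)]
      exact rpow_le_rpow (by linarith) (hs.trans (le_abs_self _)) (by linarith)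
  have hg := h.gLB (e := fun _ => -1) measurable_const (b := 1) (M := 1) (by simp)
  have eq1 := h.invA hL hg (by intro w hw; rw [eL w hw, if_neg (by linarith)]; ring)
  set D : Real → Real := fun s => L s + (-A) * P s with hD
  have hDL : LB D := hL.add (hPL.smul _)
  have key : ∀ w, 1 ≤ w → |D w + MC (kk ξ p) D w| ≤ 1 + A * q := by
    intro w hw
    have hw0 : 0 < w := by linarith
    have n0 : (0:Real) ∉ Set.uIcc 1 w := by rw [Set.uIcc_of_le hw]; intro hh; linarith [hh.1]
    have m1 : MC (kk ξ p) P w = w^p * (K - ∫ s in Set.Ioi w, kk ξ p s * s^(-p-1)) := by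
      rw [intervalIntegral.integral_Ioi_sub_Ioi kpI hw, MC_interval h.kkLB hPL hw, ← intervalIntegral.integral_const_mul]
      refine intervalIntegral.integral_congr fun s hs => ?_
      rw [Set.uIcc_of_le hw] at hs
      have hs0 : 0 < s := by grind
      rw [hP]; dsimp only
      rw [if_neg (by rw [not_lt, one_le_div hs0]; exact hs.2), div_rpow hw0.le hs0.le, rpow_sub_one hs0.ne', rpow_neg hs0.le]
      ring
    have eD : D w + MC (kk ξ p) D w = (w^p - 1/w)/(1+p) - A * (w^p * (1 + K - ∫ s in Set.Ioi w, kk ξ p s * s^(-p-1))) := by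
      have e1 : MC (kk ξ p) D w = MC (kk ξ p) L w + (-A) * MC (kk ξ p) P w := by
        rw [hD, MC_add_right h.kkLB hL (hPL.smul _), MC_smul_right]
      have e2 := eq1 w
      rw [h.Gform measurable_const (M := 1) (by simp) hw, if_neg (by linarith)] at e2
      have e3 : P w = w^p := by grind
      rw [e1, m1]
      have e4 : L w + MC (kk ξ p) L w = (w^p - 1/w)/(1+p) := by
        rw [e2]
        simp only [neg_one_mul, intervalIntegral.integral_neg, intervalIntegral.integral_const]
        rw [integral_rpow (Or.inr ⟨by linarith, n0⟩), one_rpow, show -p-1+1 = -p by ring, rpow_neg hw0.le]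
        have : 0 < w^p := by positivity
        generalize w^p = W at *
        simp only [smul_eq_mul]
        field_simp
        ring
      grind
    rw [eD]
    have e5 : (w^p - 1/w)/(1+p) - A * (w^p * (1 + K - ∫ s in Set.Ioi w, kk ξ p s * s^(-p-1))) = -(1/w/(1+p)) + A * (w^p * ∫ s in Set.Ioi w, kk ξ p s * s^(-p-1)) := by
      rw [hA]
      generalize (∫ s in Set.Ioi w, kk ξ p s * s^(-p-1)) = J
      generalize w^p = W
      field_simp
      ring
    rw [e5]
    refine (abs_add_le _ _).trans (add_le_add ?_ ?_)
    · rw [abs_neg, abs_of_pos (by positivity), div_div, div_le_one (by positivity)]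
      nlinarith
    · rw [abs_mul, abs_mul, abs_of_pos hA0, abs_of_pos (by positivity : 0 < w^p)]
      gcongr
      grind
  refine ⟨A, (1 + A*q)/(1-q), hA0, fun w hw => ?_⟩
  have := h.invB q0 q1 hq hDL key w hw
  grind

end

section

variable {ξ : Real → Real} {c p : Real} (h : KD ξ c p)

include h

lemma KD.MChalf {g : Real → Real} (hg : LB g) {w : Real} (hw : 1 ≤ w) : MC g (kap ξ) w = ∫ s in Ioo 1 (w/2), g s * kap ξ (w/s) / s := by
  rw [MC_interval hg h.kapLB hw, iole hw, ioo]
  symm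
  rw [← ioo]
  refine (setIntegral_eq_of_subset_of_forall_sdiff_eq_zero measurableSet_Ioo (fun s hs => ⟨hs.1, by linarith [hs.2]⟩) fun s hs => ?_).symm
  have h1 := hs.1.1
  have : w / 2 < s := by
    by_contra h2; exact hs.2 ⟨h1, not_lt.1 h2⟩
  rw [kap, h.z]; · simp
  have : w / s < 2 := by rw [div_lt_iff₀ bL]; linarith
  linarith

lemma KD.lamL {lam : Real → Real} (hlam0 : ∀ v : Real, v < 0 → lam v = 0)
    (hlam : ∀ v : Real, 0 ≤ v →
      lam v = v - ∫ u in (0:Real)..((v - 1) / 2), lam u * ξ ((v - u) / (u + 1)) / (u + 1)) :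
    LB (fun w => lam (w-1)) ∧ ∀ w, 1 ≤ w → lam (w-1) + MC (kap ξ) (fun w => lam (w-1)) w = w - 1 := by
  have eq : ∀ w, 1 ≤ w → lam (w-1) = w - 1 - ∫ s in Ioo 1 (w/2), lam (s-1) * kap ξ (w/s) / s := by
    intro w hw
    rw [hlam _ bL]
    congr 1
    have e1 : ∫ u in 0..((w-1-1)/2), lam u * ξ ((w-1-u)/(u+1)) / (u+1) = ∫ s in (1:Real)..(w/2), lam (s-1) * kap ξ (w/s) / s := by
      have := intervalIntegral.integral_comp_sub_right (a := 1) (b := w/2) (fun u => lam u * ξ ((w-1-u)/(u+1)) / (u+1)) 1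
      rw [show (1:Real)-1 = 0 by norm_num, show w/2-1 = (w-1-1)/2 by ring] at this
      rw [← this]
      refine icg fun s hs => ?_
      have hs0 : 0 < s := by
        have := hs.1
        grind
      simp only [kap]
      grind
    rw [e1]
    rcases le_total 1 (w/2) with h1 | h1
    · rw [iole h1, ioo]
    · rw [intervalIntegral.integral_of_ge h1, ioo, Ioo_eq_empty (by linarith : ¬ (1 < w/2))]
      rw [setIntegral_congr_fun (g := fun _ => (0:Real)) measurableSet_Ioo fun s hs => by rw [hlam0 _ (by linarith [hs.2])]; simp]
      simp
  have hk := h.kapLB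
  have ind : ∀ n : ℕ, ∃ g : Real → Real, LB g ∧ ∀ s ≤ (2:Real)^n, g s = lam (s-1) := by
    have base := h.gLB (e := fun _ => -1) measurable_const (b := 1) (M := 1) (by simp)
    have step : ∀ (V : Real) (g : Real → Real), LB g → (∀ s < V, g s = lam (s-1)) → ∃ g' : Real → Real, LB g' ∧ ∀ s ≤ 2*V, g' s = lam (s-1) := by
      intro V g hg e
      refine ⟨_, base.add ((MC_LB hg hk).smul (-1)), fun w hw => ?_⟩
      split_ifs with h1
      · rw [(MC_LB hg hk).z w h1, hlam0 _ (by linarith)]; simp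
      · push Not at h1
        rw [h.MChalf hg h1, eq w h1, setIntegral_congr_fun (g := fun s => lam (s-1) * kap ξ (w/s) / s) measurableSet_Ioo fun s hs => by
          show g s * kap ξ (w/s) / s = _
          rw [e s (by linarith [hs.2])]]
        ring
    intro n
    induction n with
    | zero =>
      obtain ⟨g, h1, h2⟩ := step 1 (fun _ => 0) ⟨measurable_const, fun _ _ => rfl, fun W => ⟨0, le_rfl, by simp⟩⟩ (fun s hs => (hlam0 _ (by linarith)).symm)
      exact ⟨g, h1, fun s hs => h2 s (by rw [pow_zero] at hs; linarith)⟩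
    | succ n ih =>
      obtain ⟨g, h1, h2⟩ := ih
      obtain ⟨g', h3, h4⟩ := step _ g h1 fun s hs => h2 s hs.le
      exact ⟨g', h3, fun s hs => h4 s (by rw [pow_succ] at hs; linarith)⟩
  choose g hg e using ind
  have hL : LB (fun w => lam (w-1)) := by
    refine ⟨?_, fun s hs => hlam0 _ (by linarith), fun W => ?_⟩
    · refine measurable_of_tendsto_metrizable (fun n => (hg n).m) (tendsto_pi_nhds.2 fun s => ?_)
      obtain ⟨N, hN⟩ := pow_unbounded_of_one_lt s (one_lt_two)
      refine tendsto_const_nhds.congr' ?_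
      filter_upwards [Filter.eventually_ge_atTop N] with n hn
      exact (e n s (hN.le.trans (pow_le_pow_right₀ (by norm_num) hn))).symm
    · obtain ⟨N, hN⟩ := pow_unbounded_of_one_lt W (one_lt_two)
      obtain ⟨C, h0, h1⟩ := (hg N).b W
      grind
  refine ⟨hL, fun w hw => ?_⟩
  rw [MC_comm _ _ (by linarith), h.MChalf hL hw, eq w hw]
  ring

end

lemma mvt1 {f f' : Real → Real} {a b C : Real} (hab : a ≤ b) (h : ∀ s ∈ Icc a b, HasDerivAt f (f' s) s) (hb : ∀ s ∈ Icc a b, |f' s| ≤ C) : |f b - f a| ≤ C * (b - a) := by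
  have := (convex_Icc a b).norm_image_sub_le_of_norm_hasDerivWithin_le (f' := f') (fun s hs => (h s hs).hasDerivWithinAt) hb (left_mem_Icc.2 hab) (right_mem_Icc.2 hab)
  rwa [norm_eq_abs, norm_eq_abs, abs_of_nonneg (by linarith : 0 ≤ b - a)] at this

lemma LB.ii {D : Real → Real} (hD : LB D) (a b : Real) : IntervalIntegrable D volume a b := by
  obtain ⟨C, hC0, hC⟩ := hD.b (max a b)
  rw [intervalIntegrable_iff]
  refine Measure.integrableOn_of_bounded (M := C) (by simp) hD.m.aestronglyMeasurable ?_
  exact (ari measurableSet_uIoc).2 (Eventually.of_forall fun s hs => hC s hs.2)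

lemma LB.int0 {D : Real → Real} (hD : LB D) {u : Real} (hu : u ≤ 1) : ∫ s in 1..u, D s = 0 := by
  rw [intervalIntegral.integral_of_ge hu, ioo, scf measurableSet_Ioo fun s hs => hD.z s hs.2]
  simp

lemma expint (L u : Real) (hL : 0 < L) : ∫ s in 1..u, L * exp (-L*(s-1)) = 1 - exp (-L*(u-1)) := by
  have : ∀ s ∈ uIcc 1 u, HasDerivAt (fun s => -exp (-L*(s-1))) (L * exp (-L*(s-1))) s := by
    intro s _
    have := ((((hasDerivAt_id s).sub_const 1).const_mul (-L)).exp).neg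
    refine this.congr_deriv ?_
    simp only [id]; ring
  rw [intervalIntegral.integral_eq_sub_of_hasDerivAt this (by apply Continuous.intervalIntegrable; fun_prop)]
  simp; ring

lemma conv {D : Real → Real} (hD : LB D) {L K : Real} (hL : 0 < L) (hK : 0 ≤ K)
    (hη : ∀ u, 1 ≤ u → |u * D u - 2 * ∫ s in 1..(u-1), D s| ≤ K * (u + L * exp (-L*(u-1)))) :
    ∃ b : Real, |b| ≤ 24 * K ∧ ∀ u, 1 ≤ u → |D u - b * (u+2)| ≤ 100 * K * (1 + L * exp (-L*(u-1))) := by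
  set I : Real → Real := fun u => ∫ s in 1..u, D s with hI
  have Ic : Continuous I := intervalIntegral.continuous_primitive (fun a b => hD.ii a b) 1
  have I0 : ∀ u ≤ 1, I u = 0 := fun u hu => hD.int0 hu
  set y : Real → Real := fun s => 2 * I (s-1) / s with hy
  have y0 : ∀ s ≤ 2, y s = 0 := fun s hs => by rw [hy]; dsimp only; rw [I0 _ bL]; simp
  have yc : Continuous y := by
    have e : y = fun s => 2 * I (s-1) / max s 1 := by grind
    rw [e]
    refine Continuous.div (by fun_prop) (by fun_prop) fun s => by positivity
  set Y : Real → Real := fun u => ∫ s in 1..u, y s with hY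
  have Yd : ∀ u, HasDerivAt Y (y u) u := fun u => yc.integral_hasStrictDerivAt 1 u |>.hasDerivAt
  have Y0 : ∀ u ≤ 2, Y u = 0 := by
    intro u hu
    rw [hY]; dsimp only
    rw [icg (g := fun _ => (0:Real)) fun s hs => y0 s ?_]
    · simp
    · exact hs.2.trans (max_le (by norm_num) hu)
  have IY : ∀ u, 0 ≤ u → |I u - Y u| ≤ K * (u + 1) := by
    intro u hu
    rcases le_total u 1 with h1 | h1
    · rw [I0 u h1, Y0 u (by linarith)]; simp; positivity
    rw [hI, hY]; dsimp only
    rw [← intervalIntegral.integral_sub (hD.ii _ _) (yc.intervalIntegrable _ _)]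
    have gi : IntervalIntegrable (fun s => K * (1 + L * exp (-L*(s-1)))) volume 1 u := by apply Continuous.intervalIntegrable; fun_prop
    have := intervalIntegral.norm_integral_le_of_norm_le (f := fun s => D s - y s) (g := fun s => K * (1 + L * exp (-L*(s-1)))) h1 (Filter.Eventually.of_forall fun s hs => by
      have hs0 : 0 < s := by linarith [hs.1]
      have h2 := hη s hs.1.le
      have e : D s - y s = (s * D s - 2 * I (s-1)) / s := by rw [hy]; field_simp
      rw [e, norm_eq_abs, abs_div, abs_of_pos hs0, div_le_iff₀ hs0]
      refine h2.trans ?_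
      rw [mul_assoc]
      gcongr
      rw [add_mul, one_mul]
      have : 0 ≤ L * exp (-L*(s-1)) := by positivity
      nlinarith [hs.1]) gi
    rw [norm_eq_abs] at this
    refine this.trans ?_
    rw [intervalIntegral.integral_const_mul, intervalIntegral.integral_add (by simp) (by apply Continuous.intervalIntegrable; fun_prop), expint L u hL]
    simp only [intervalIntegral.integral_const, smul_eq_mul, mul_one]
    refine mul_le_mul_of_nonneg_left ?_ hK
    linarith [exp_pos (-L*(u-1))]
  have hE : ∀ u, 1 ≤ u → |y u - 2 * Y (u-1) / u| ≤ 2 * K := by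
    intro u hu
    have := IY (u-1) (by linarith)
    have e : y u - 2 * Y (u-1) / u = 2 / u * (I (u-1) - Y (u-1)) := by grind
    rw [e, abs_mul, abs_of_pos (by positivity)]
    calc 2/u * |I (u-1) - Y (u-1)| ≤ 2/u * (K * (u-1+1)) := by gcongr
      _ = 2*K := by field_simp; ring
  set m : Real → Real := fun u => Y u / PP u with hm
  set G : Real → Real := fun u => y u - (u+2) * m u with hG
  have Pd : ∀ u, HasDerivAt PP (u+2) u := by
    intro u
    have := (((hasDerivAt_id u).add_const 1).mul ((hasDerivAt_id u).add_const 3)).div_const 2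
    exact this.congr_deriv (by simp only [id]; ring)
  have Pp : ∀ u, 0 ≤ u → 0 < PP u := fun u hu => by unfold PP; positivity
  have md : ∀ u, 0 ≤ u → HasDerivAt m (G u / PP u) u := by
    intro u hu
    have hp := Pp u hu
    refine ((Yd u).div (Pd u) hp.ne').congr_deriv ?_
    rw [hG, hm]; dsimp only
    field_simp
  have Pm : ∀ a b, 0 ≤ a → a ≤ b → PP a ≤ PP b := fun a b ha hab => PP_mono ha hab
  have Y2 : ∀ u, 0 ≤ u → u ≤ 3 → |Y u| ≤ 2 * K * 3 := by
    intro u h0 h1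
    have := mvt1 (f := Y) (f' := y) (a := 0) (b := u) (C := 2*K) h0 (fun s _ => Yd s) fun s hs => by
      rcases le_total s 1 with h2 | h2
      · rw [y0 s (by linarith)]; simp; positivity
      · have := hE s h2
        rw [Y0 (s-1) (by linarith [hs.2])] at this
        simpa using this
    rw [Y0 0 (by norm_num), sub_zero, sub_zero] at this
    refine this.trans ?_
    gcongr
  have Gs : ∀ u, 1 ≤ u → u ≤ 3 → |G u| ≤ 12 * K := by
    intro u h1 h3
    have e1 := hE u h1
    rw [Y0 (u-1) (by linarith)] at e1
    have e2 := Y2 u (by linarith) h3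
    have e3 : |(u+2) * m u| ≤ 2*K*3 := by
      rw [hm, ← mul_div_assoc, abs_div, abs_mul, abs_of_pos (by linarith : 0 < u+2), abs_of_pos (Pp u (by linarith)), div_le_iff₀ (Pp u (by linarith)), mul_comm]
      refine mul_le_mul e2 ?_ (by linarith) (by positivity)
      unfold PP; nlinarith
    rw [mul_zero, zero_div, sub_zero] at e1
    exact (abs_sub _ _).trans (by linarith)
  have Gc : ContinuousOn G (Set.Ici 0) := by
    refine yc.continuousOn.sub (ContinuousOn.mul (by fun_prop) ?_)
    intro u hu
    exact (md u hu).continuousAt.continuousWithinAt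
  have Gb : ∀ U, 1 ≤ U → |G U| ≤ 12 * K := by
    intro U hU
    obtain ⟨B, hB⟩ := (isCompact_Icc (a := (1:Real)) (b := U)).bddAbove_image ((Gc.mono fun s hs => (by linarith [hs.1] : (0:Real) ≤ s)).abs)
    set S := sSup ((fun s => |G s|) '' Set.Icc 1 U) with hS
    have hle : ∀ s ∈ Set.Icc 1 U, |G s| ≤ S := fun s hs => le_csSup ⟨B, hB⟩ ⟨s, hs, rfl⟩
    have hS0 : 0 ≤ S := (abs_nonneg _).trans (hle U ⟨hU, le_rfl⟩)
    have key : ∀ s ∈ Set.Icc 1 U, |G s| ≤ max (12*K) (2/3*S + 2*K) := by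
      intro s hs
      rcases le_total s 3 with h3 | h3
      · exact (Gs s hs.1 h3).trans (le_max_left _ _)
      refine le_trans ?_ (le_max_right _ _)
      have h1 := mvt1 (f := m) (f' := fun u => G u / PP u) (a := s-1) (b := s) (C := S / PP (s-1)) (by linarith) (fun r hr => md r (by linarith [hr.1])) fun r hr => by
        have hp := Pp (s-1) (by linarith)
        rw [abs_div, abs_of_pos (Pp r (by linarith [hr.1]))]
        exact div_le_div₀ hS0 (hle r ⟨by linarith [hr.1], hr.2.trans hs.2⟩) hp (Pm _ _ (by linarith) hr.1)
      have hs0 : 0 < s := by linarith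
      have eP : PP (s-1) = s*(s+2)/2 := by unfold PP; ring
      have e : G s = -((s+2) * (m s - m (s-1))) + (y s - 2 * Y (s-1) / s) := by
        rw [hG, hm]; dsimp only
        rw [eP]
        have : 0 < s + 2 := by linarith
        field_simp
        ring
      rw [e]
      refine (abs_add_le _ _).trans (add_le_add ?_ (hE s hs.1))
      rw [abs_neg, abs_mul, abs_of_pos (by linarith : 0 < s+2)]
      calc (s+2) * |m s - m (s-1)| ≤ (s+2) * (S / PP (s-1) * (s - (s-1))) := by gcongr
        _ = 2/s * S := by
            rw [eP]
            have : 0 < s + 2 := by linarith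
            field_simp; ring
        _ ≤ 2/3 * S := by gcongr
    have : S ≤ max (12*K) (2/3*S + 2*K) := csSup_le ⟨_, ⟨U, ⟨hU, le_rfl⟩, rfl⟩⟩ (by rintro _ ⟨s, hs, rfl⟩; exact key s hs)
    refine (hle U ⟨hU, le_rfl⟩).trans ?_
    rcases le_max_iff.1 this with h1 | h1 <;> linarith
  have mv : ∀ a b, 1 ≤ a → a ≤ b → |m b - m a| ≤ 24 * K * (1/a - 1/b) := by
    intro a b ha hab
    have hd : ∀ s, 1 ≤ s → HasDerivAt (fun s : Real => 24*K*(1/a - s⁻¹)) (24*K*(-(-(s^2)⁻¹))) s := fun s hs =>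
      ((hasDerivAt_inv (by linarith : s ≠ 0)).const_sub (1/a)).const_mul (24*K)
    have := image_norm_le_of_norm_deriv_right_le_deriv_boundary' (f := fun s => m s - m a) (f' := fun s => G s / PP s) (a := a) (b := b)
      (B := fun s => 24*K*(1/a - s⁻¹)) (B' := fun s => 24*K*(-(-(s^2)⁻¹)))
      (fun s hs => ((md s (by linarith [hs.1])).sub_const _).continuousAt.continuousWithinAt)
      (fun s hs => ((md s (by linarith [hs.1])).sub_const _).hasDerivWithinAt) (by simp)
      (fun s hs => (hd s (by linarith [hs.1])).continuousAt.continuousWithinAt) (fun s hs => (hd s (by linarith [hs.1])).hasDerivWithinAt)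
      (fun s hs => by
        have hs1 : 1 ≤ s := by linarith [hs.1]
        have hp := Pp s (by linarith)
        rw [norm_div, norm_eq_abs, norm_eq_abs, abs_of_pos hp, div_le_iff₀ hp]
        refine (Gb s hs1).trans ?_
        rw [neg_neg]
        have h2 : 1/2 ≤ (s^2)⁻¹ * PP s := by
          rw [inv_mul_eq_div, div_le_div_iff₀ (by norm_num) (by positivity)]; unfold PP; nlinarith
        calc 12*K = 24*K*(1/2) := by ring
          _ ≤ 24*K*((s^2)⁻¹ * PP s) := by gcongr
          _ = _ := by ring) (Set.right_mem_Icc.2 hab)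
    simpa [norm_eq_abs] using this
  have mc : CauchySeq (fun n : ℕ => m (n+1)) := by
    refine cauchySeq_of_le_tendsto_0 (fun n : ℕ => 24*K*(1/((n:Real)+1)) + 24*K*(1/((n:Real)+1))) (fun i j N hi hj => ?_) ?_
    · have f : ∀ k : ℕ, N ≤ k → |m (k+1) - m (N+1)| ≤ 24*K*(1/((N:Real)+1)) := by
        intro k hk
        have hk' : (N:Real) ≤ k := by exact_mod_cast hk
        refine (mv (N+1) (k+1) (by linarith [Nat.cast_nonneg (α := Real) N]) (by linarith)).trans ?_
        gcongr
        linarith [show (0:Real) < 1/((k:Real)+1) by positivity]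
      rw [dist_eq]
      have h1 := f i hi
      have h2 := f j hj
      rw [show m (i+1) - m (j+1) = (m (i+1) - m (N+1)) - (m (j+1) - m (N+1)) by ring]
      exact (abs_sub _ _).trans (add_le_add h1 h2)
    · have := (tendsto_one_div_add_atTop_nhds_zero_nat (𝕜 := Real)).const_mul (24*K)
      simpa using this.add this
  obtain ⟨b, hb⟩ := cauchySeq_tendsto_of_complete mc
  have mb : ∀ u, 1 ≤ u → |b - m u| ≤ 24*K*(1/u) := by
    intro u hu
    refine le_of_tendsto ((hb.sub_const (m u)).abs) ?_
    filter_upwards [Filter.eventually_ge_atTop ⌈u⌉₊] with n hn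
    have hn' : u ≤ n := Nat.ceil_le.1 hn
    refine (mv u (n+1) hu (by linarith)).trans ?_
    gcongr
    linarith [show (0:Real) < 1/((n:Real)+1) by positivity]
  refine ⟨b, ?_, fun u hu => ?_⟩
  · have := mb 1 le_rfl
    have e : m 1 = 0 := by rw [hm]; dsimp only; rw [Y0 1 (by norm_num), zero_div]
    rw [e, sub_zero] at this
    linarith
  · have hu0 : 0 < u := by linarith
    have h1 := Gb u hu
    have h2 := mb u hu
    have h3 := hη u hu
    set η := u * D u - 2 * ∫ s in (1:Real)..(u-1), D s with hηd
    have e : D u - b * (u+2) = G u - (u+2) * (b - m u) + η / u := by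
      have : D u = y u + η / u := by rw [hηd, hy, hI]; field_simp; ring
      rw [this, hG]; ring
    rw [e]
    have hx : 0 ≤ L * exp (-L*(u-1)) := by positivity
    have h4 : |(u+2) * (b - m u)| ≤ 72 * K := by
      rw [abs_mul, abs_of_pos (by linarith : 0 < u+2)]
      calc _ ≤ (u+2) * (24*K*(1/u)) := by gcongr
        _ = 24*K*((u+2)/u) := by ring
        _ ≤ 24*K*3 := by gcongr; rw [div_le_iff₀ hu0]; linarith
        _ = _ := by ring
    have h5 : |η / u| ≤ K * (1 + L * exp (-L*(u-1))) := by
      rw [abs_div, abs_of_pos hu0, div_le_iff₀ hu0]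
      refine h3.trans ?_
      rw [mul_assoc]
      gcongr
      nlinarith
    have h6 := abs_add_le (G u - (u+2) * (b - m u)) (η/u)
    have h7 := abs_sub (G u) ((u+2) * (b - m u))
    have h8 : 0 ≤ K * (L * exp (-L*(u-1))) := by positivity
    nlinarith

lemma XI.LB {ξ : Real → Real} (h : XI ξ) : LB ξ := by
  refine ⟨h.meas, h.z, fun W => ?_⟩
  obtain ⟨B, hB⟩ := (isCompact_Icc).bddAbove_image ((h.cont.mono fun s hs => hs.1).abs)
  refine ⟨max B 0, le_max_right _ _, fun s hs => ?_⟩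
  rcases lt_or_ge s 1 with h1 | h1
  · rw [h.z s h1, abs_zero]; exact le_max_right _ _
  · exact (hB ⟨s, ⟨h1, hs⟩, rfl⟩).trans (le_max_left _ _)

structure RF (C1 L : Real) (F : Real → Real) : Prop where
  lb : LB F
  nn : ∀ u, 0 ≤ F u
  tr : ∀ u, 1 ≤ u → F u ≤ 1 + u * L
  eq : ∀ u, 1 ≤ u → ∀ S, (∀ s, 1 ≤ s → s ≤ u → F s ≤ S) →
    |u * F u - 2 * (∫ s in 1..(u-1), F s) - 2 / L * (1 - exp (-L*(u-1)))| ≤ C1 * (S / L + 1 / L^3)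

lemma apr {C1 : Real} (hC1 : 0 ≤ C1) : ∃ C2 : Real, 0 ≤ C2 ∧ ∀ L F, log 2 ≤ L → RF C1 L F → ∀ u, 1 ≤ u → F u ≤ C2 * u / L := by
  refine ⟨6 + (4*C1+1) + (4*C1+1)^2, by positivity, fun L F hL h U hU => ?_⟩
  have hl2 := log_two_gt_d9
  have hL0 : 0 < L := bL
  rcases le_total L (4*C1+1) with h1 | h1
  · refine (h.tr U hU).trans ?_
    rw [le_div_iff₀ hL0]
    have : L^2 ≤ (4*C1+1)^2 := by gcongr
    nlinarith
  obtain ⟨B, hB0, hB⟩ := h.lb.b U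
  set M := sSup ((fun s => F s * L / s) '' Icc 1 U) with hM
  have hle : ∀ s ∈ Icc 1 U, F s * L / s ≤ M := fun s hs => le_csSup ⟨B * L, by
    rintro _ ⟨r, hr, rfl⟩
    have h1 := hB r hr.2
    have h2 := h.nn r
    rw [abs_of_nonneg h2] at h1
    exact (div_le_self bP hr.1).trans (by gcongr)⟩ ⟨s, hs, rfl⟩
  have hM6 : M ≤ 6 := by
    by_contra hM6
    push Not at hM6
    have hU0 : 0 < U := bL
    have key : ∀ s ∈ Icc 1 U, F s * L / s ≤ max (3/4*M) (M - M/U) := by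
      intro u hu
      have hu0 : 0 < u := by grind
      have Fle : ∀ s, 1 ≤ s → s ≤ u → F s ≤ M / L * s := by
        intro s h1 h2
        have := hle s ⟨h1, h2.trans hu.2⟩
        rw [div_le_iff₀ bL] at this
        rw [div_mul_eq_mul_div, le_div_iff₀ hL0]; exact this
      have e := h.eq u hu.1 (M/L*u) (fun s h1 h2 => (Fle s h1 h2).trans (by gcongr))
      have e2 := (abs_le.1 e).2
      have ex := exp_pos (-L*(u-1))
      have hc : C1 / L ≤ 1/4 := by rw [div_le_iff₀ hL0]; linarith
      have hc2 : C1 / L^2 ≤ 1 := by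
        rw [div_le_iff₀ bP]; nlinarith
      have e3 : u * F u - 2 * (∫ s in 1..(u-1), F s) ≤ (1/L) * (3 + M * u / 4) := by
        have : 2 / L * (1 - exp (-L*(u-1))) ≤ 2/L * 1 := by gcongr; linarith
        have h5 : C1 * (M/L*u/L + 1/L^3) = 1/L * (C1/L * (M*u) + C1/L^2) := by field_simp
        have h6 : 1/L * (C1/L * (M*u) + C1/L^2) ≤ 1/L * (1/4 * (M*u) + 1) := by gcongr
        grind
      rcases le_total u 2 with hu2 | hu2
      · rw [h.lb.int0 bL] at e3
        refine le_trans ?_ (le_max_left _ _)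
        rw [div_le_iff₀ hu0]
        have e4 : F u * L * u ≤ 3 + M*u/4 := by
          have : u * F u * L ≤ 1/L*(3+M*u/4) * L := mnr bL hL0.le
          have e : 1/L*(3+M*u/4) * L = 3 + M*u/4 := by field_simp
          linarith
        have h5 : F u * L ≤ F u * L * u := le_mul_of_one_le_right (mul_nonneg (h.nn u) hL0.le) hu.1
        nlinarith
      · refine le_trans ?_ (le_max_right _ _)
        have i1 : ∫ s in 1..(u-1), F s ≤ ∫ s in 1..(u-1), M/L*s := by
          refine imon bL (h.lb.ii _ _) (by apply Continuous.intervalIntegrable; fun_prop) fun s hs => Fle s hs.1 (by linarith [hs.2])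
        rw [intervalIntegral.integral_const_mul, integral_id] at i1
        have e4 : u * F u * L ≤ M * (u^2 - 2*u) + (3 + M*u/4) := by
          have h1 : u * F u ≤ 2 * (M/L * (((u-1)^2 - 1^2)/2)) + 1/L*(3+M*u/4) := by linarith
          have h2 : u * F u * L ≤ (2 * (M/L * (((u-1)^2 - 1^2)/2)) + 1/L*(3+M*u/4)) * L := by gcongr
          refine h2.trans (le_of_eq ?_)
          grind
        have h5 : M - M/u ≤ M - M/U := by
          have : M/U ≤ M/u := by gcongr; exact hu.2
          linarith
        refine le_trans ?_ h5
        rw [div_le_iff₀ hu0, sub_mul, div_mul_cancel₀ _ hu0.ne']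
        have : F u * L * u ≤ (M*u - M) * u := by nlinarith
        exact le_of_mul_le_mul_right this hu0
    have : M ≤ max (3/4*M) (M - M/U) := csSup_le ⟨_, ⟨U, ⟨hU, le_rfl⟩, rfl⟩⟩ (by rintro _ ⟨s, hs, rfl⟩; exact key s hs)
    have : 0 < M / U := by positivity
    grind
  have h3 := hle U ⟨hU, le_rfl⟩
  rw [div_le_iff₀ (by linarith)] at h3
  rw [le_div_iff₀ hL0]
  refine h3.trans ?_
  gcongr
  nlinarith

lemma XI.Fas {ξ : Real → Real} (hx : XI ξ) {C1 : Real} (hC1 : 0 ≤ C1) : ∃ C3 : Real, 0 ≤ C3 ∧ ∀ L F, log 2 ≤ L → RF C1 L F → ∃ b, |b| ≤ C3 / L^2 ∧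
    ∀ u, 1 ≤ u → |F u - ξ u / L - b * (u+2)| ≤ C3 / L^2 * (1 + L * exp (-L*(u-1))) := by
  obtain ⟨C2, hC2, ha⟩ := apr hC1
  refine ⟨100 * (2 + C1*C2 + 2*C1), by positivity, fun L F hL h => ?_⟩
  have hl2 := log_two_gt_d9
  have hL0 : 0 < L := bL
  have hD := h.lb.add (hx.LB.smul (-(1/L)))
  have hK : 0 ≤ (2 + C1*C2 + 2*C1) / L^2 := bP
  obtain ⟨b, hb, hu⟩ := conv hD hL0 hK (by
    intro u hu
    rw [iadd (h.lb.ii _ _) ((hx.LB.ii _ _).const_mul _), icm]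
    have e1 := h.eq u hu (C2 * u / L) fun s h1 h2 => (ha L F hL h s h1).trans (by gcongr)
    have e2 := hx.e u hu
    have e3 : u * (F u + -(1/L) * ξ u) - 2 * ((∫ s in 1..(u-1), F s) + -(1/L) * ∫ s in 1..(u-1), ξ s)
      = (u * F u - 2 * (∫ s in 1..(u-1), F s) - 2 / L * (1 - exp (-L*(u-1)))) - 2/L * exp (-L*(u-1)) := by
      linear_combination (-(1/L)) * e2
    rw [e3]
    refine (abs_sub _ _).trans ?_
    rw [abs_of_pos (a := 2/L * exp (-L*(u-1))) bP]
    have e4 : C1 * (C2*u/L/L + 1/L^3) ≤ (C1*C2 + 2*C1)/L^2 * u := by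
      have : 1/L^3 ≤ 2/L^2*u := by
        rw [div_mul_eq_mul_div, div_le_div_iff₀ bP bP]
        have : 1 ≤ 2*u*L := by nlinarith
        nlinarith
      calc C1 * (C2*u/L/L + 1/L^3) ≤ C1 * (C2*u/L/L + 2/L^2*u) := by gcongr
        _ = _ := by ring
    have e5 : 2/L * exp (-L*(u-1)) = 2/L^2 * (L * exp (-L*(u-1))) := by field_simp
    have hx0 : 0 ≤ L * exp (-L*(u-1)) := bP
    have e6 : 2/L^2 * u + (C1*C2 + 2*C1)/L^2 * u = (2 + C1*C2 + 2*C1) / L^2 * u := by ring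
    have e7 : 2/L^2 * (L * exp (-L*(u-1))) + (C1*C2 + 2*C1)/L^2 * (L * exp (-L*(u-1))) = (2 + C1*C2 + 2*C1) / L^2 * (L * exp (-L*(u-1))) := by ring
    have e8 : 0 ≤ 2/L^2 * u := bP
    have e9 : 0 ≤ (C1*C2 + 2*C1)/L^2 * (L * exp (-L*(u-1))) := bP
    rw [mul_add, ← e6, ← e7]
    linarith)
  grind

noncomputable def SM (a : ℕ → Real) (x : Real) : Real := ∑ n ∈ Finset.Ioc 0 ⌊x⌋₊, a n

lemma SM_mono {a : ℕ → Real} (ha : ∀ n, 0 ≤ a n) : Monotone (SM a) := fun x y h =>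
  Finset.sum_le_sum_of_subset_of_nonneg (Finset.Ioc_subset_Ioc_right (Nat.floor_mono h)) fun n _ _ => ha n

lemma SM_meas (a : ℕ → Real) : Measurable (SM a) :=
  (Measurable.of_discrete (f := fun N : ℕ => ∑ n ∈ Finset.Ioc 0 N, a n)).comp Nat.measurable_floor

lemma SM_abs (a : ℕ → Real) x : |SM a x| ≤ SM (fun n => |a n|) x := Finset.abs_sum_le_sum_abs _ _

lemma abel (a : ℕ → Real) {L c U : Real} {ω : Real → Real} (hL : 0 < L) (hU : c ≤ U) (hω : IntervalIntegrable ω volume c U) :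
    SM (fun n => a n * ∫ s in (c + log n / L)..U, ω s) (exp (L*(U-c))) = ∫ s in c..U, SM a (exp (L*(s-c))) * ω s := by
  have key : ∀ n : ℕ, 0 < n → ∀ s, n ≤ exp (L*(s-c)) ↔ c + log n / L ≤ s := by
    intro n hn s
    have : (0:Real) < n := by positivity
    rw [← log_le_iff_le_exp this, ← le_sub_iff_add_le', div_le_iff₀ hL, mul_comm]
  have h1 : ∀ n ∈ Finset.Ioc 0 ⌊exp (L*(U-c))⌋₊, ∫ s in (c + log n / L)..U, ω s = ∫ s in c..U, (Ici (c + log n / L)).indicator ω s := by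
    intro n hn
    rw [Finset.mem_Ioc] at hn
    have h2 := (key n hn.1 U).1 ((Nat.le_floor_iff (exp_pos _).le).1 hn.2)
    have h3 : (1:Real) ≤ n := by exact_mod_cast hn.1
    have h4 : c ≤ c + log n / L := by have := div_nonneg (log_nonneg h3) hL.le; linarith
    rw [iole h2, iole hU, ← integral_indicator measurableSet_Ioc, ← integral_indicator measurableSet_Ioc]
    refine integral_congr_ae ?_
    have := (Measure.ae_ne volume (c + log n / L))
    filter_upwards [this] with s hs
    simp only [indicator]
    grind
  have h2 : ∀ s ∈ uIcc c U, SM a (exp (L*(s-c))) * ω s = ∑ n ∈ Finset.Ioc 0 ⌊exp (L*(U-c))⌋₊, a n * (Ici (c + log n / L)).indicator ω s := by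
    intro s hs
    rw [uIcc_of_le hU] at hs
    rw [SM, Finset.sum_mul]
    have : Finset.Ioc 0 ⌊exp (L*(s-c))⌋₊ ⊆ Finset.Ioc 0 ⌊exp (L*(U-c))⌋₊ := by
      refine Finset.Ioc_subset_Ioc_right (Nat.floor_mono (exp_le_exp.2 ?_))
      exact mnl (by linarith [hs.2]) hL.le
    rw [← Finset.sum_subset this]
    · refine Finset.sum_congr rfl fun n hn => ?_
      rw [Finset.mem_Ioc] at hn
      rw [indicator_of_mem]
      exact (key n hn.1 s).1 ((Nat.le_floor_iff (exp_pos _).le).1 hn.2)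
    · intro n hn hn'
      rw [Finset.mem_Ioc] at hn hn'
      rw [indicator_of_notMem, mul_zero]
      intro h
      exact hn' ⟨hn.1, (Nat.le_floor_iff (exp_pos _).le).2 ((key n hn.1 s).2 h)⟩
  rw [icg h2, intervalIntegral.integral_finsetSum]
  · rw [SM]
    refine Finset.sum_congr rfl fun n hn => ?_
    rw [icm, h1 n hn]
  · intro n _
    apply IntervalIntegrable.const_mul
    rw [intervalIntegrable_iff] at hω ⊢
    exact hω.indicator measurableSet_Ici

def RG (z : Real) (r : ℕ) : Prop := ∀ p : ℕ, p.Prime → p ∣ r → z < p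

lemma RG_mul {z : Real} {a b : ℕ} : RG z (a*b) ↔ RG z a ∧ RG z b := by
  refine ⟨fun h => ⟨fun p hp hd => h p hp (hd.mul_right _), fun p hp hd => h p hp (hd.mul_left _)⟩, fun h p hp hd => ?_⟩
  rcases (Nat.Prime.dvd_mul hp).1 hd with h1 | h1
  exacts [h.1 p hp h1, h.2 p hp h1]

lemma RG_one z : RG z 1 := fun p hp hd => absurd (Nat.dvd_one.1 hd) hp.ne_one

lemma RG_le {z : Real} {r : ℕ} (h : RG z r) (h2 : r ≠ 1) (h0 : 0 < r) : z < r := by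
  obtain ⟨p, hp, hd⟩ := Nat.exists_prime_and_dvd h2
  have := h p hp hd
  have h3 : (p:Real) ≤ r := by exact_mod_cast Nat.le_of_dvd h0 hd
  linarith

open Classical in
noncomputable def rt (z : Real) : ArithmeticFunction Real := ⟨fun r => if RG z r then (r.divisors.card : Real) else 0, by simp⟩

open Classical in
noncomputable def rl (z : Real) : ArithmeticFunction Real := ⟨fun r => if RG z r then ArithmeticFunction.vonMangoldt r else 0, by simp⟩

lemma rt_nn z r : 0 ≤ rt z r := by simp only [rt, ArithmeticFunction.coe_mk]; positivity

lemma rt_le z r : rt z r ≤ r.divisors.card := by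
  simp only [rt, ArithmeticFunction.coe_mk]; split_ifs <;> simp

lemma rt_id z r : rt z r * log r = 2 * (rl z * rt z) r := by
  rw [ArithmeticFunction.mul_apply]
  rcases Nat.eq_zero_or_pos r with h0 | h0
  · subst h0; simp
  by_cases h : RG z r
  · have h1 : ∑ x ∈ r.divisorsAntidiagonal, rl z x.1 * rt z x.2 = (ArithmeticFunction.vonMangoldt * ((ArithmeticFunction.zeta : ArithmeticFunction Real) * (ArithmeticFunction.zeta : ArithmeticFunction Real))) r := by
      rw [ArithmeticFunction.mul_apply]
      refine Finset.sum_congr rfl fun x hx => ?_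
      have hx' := Nat.mem_divisorsAntidiagonal.1 hx
      rw [← hx'.1, RG_mul] at h
      simp only [rl, rt, ArithmeticFunction.coe_mk, h.1, h.2]
      congr 1
      rw [ArithmeticFunction.coe_mul_zeta_apply, Finset.sum_congr rfl (g := fun _ => (1:Real))]
      · simp
      · intro y hy
        have := (Nat.pos_of_mem_divisors hy).ne'
        simp [this]
    rw [h1, ← mul_assoc, ArithmeticFunction.vonMangoldt_mul_zeta, ArithmeticFunction.coe_mul_zeta_apply]
    have h2 : ∑ d ∈ r.divisors, ArithmeticFunction.log d = ∑ d ∈ r.divisors, ArithmeticFunction.log (r/d) :=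
      (Nat.sum_div_divisors r (fun d => ArithmeticFunction.log d)).symm
    rw [two_mul]
    nth_rw 2 [h2]
    rw [← Finset.sum_add_distrib, Finset.sum_congr rfl (g := fun _ => log r)]
    · simp [rt, h]
    · intro d hd
      have hd' := Nat.dvd_of_mem_divisors hd
      have h3 : (d:Real) ≠ 0 := by exact_mod_cast (Nat.pos_of_mem_divisors hd).ne'
      have h4 : (r:Real) ≠ 0 := bP
      rw [ArithmeticFunction.log_apply, ArithmeticFunction.log_apply, Nat.cast_div hd' h3, log_div h4 h3]; ring
  · have : rt z r = 0 := by simp [rt, h]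
    rw [this, zero_mul, Finset.sum_eq_zero, mul_zero]
    intro x hx
    have hx' := Nat.mem_divisorsAntidiagonal.1 hx
    rw [← hx'.1, RG_mul] at h
    by_cases h1 : RG z x.1
    · have h2 : ¬ RG z x.2 := fun h2 => h ⟨h1, h2⟩
      simp [rt, h2]
    · simp [rl, h1]

lemma rt_sum (z y : Real) : SM (fun r => rt z r * log r) y = 2 * SM (fun r => rt z r * SM (rl z) (y / r)) y := by
  simp only [SM, rt_id, ← Finset.mul_sum]
  rw [mul_comm (rl z), ArithmeticFunction.sum_Ioc_mul_eq_sum_sum]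
  simp only [Nat.floor_div_natCast]

lemma rl_zero {z v : Real} (h : v ≤ z) : SM (rl z) v = 0 := by
  refine Finset.sum_eq_zero fun a ha => ?_
  rw [Finset.mem_Ioc] at ha
  simp only [rl, ArithmeticFunction.coe_mk]
  split_ifs with h1
  · by_cases h2 : a = 1
    · simp [h2]
    · have := RG_le h1 h2 ha.1
      have h3 := (Nat.le_floor_iff' ha.1.ne').1 ha.2
      linarith
  · rfl

lemma SM_nn {a : ℕ → Real} (ha : ∀ n, 0 ≤ a n) x : 0 ≤ SM a x := Finset.sum_nonneg fun n _ => ha n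

lemma theta_restrict {z v : Real} (hz : 0 ≤ z) (h : z ≤ v) : Chebyshev.theta z = SM (fun n => if n.Prime ∧ (n:Real) ≤ z then log n else 0) v := by
  rw [Chebyshev.theta, SM, ← Finset.sum_filter]
  refine Finset.sum_congr ?_ fun _ _ => rfl
  ext n
  simp only [Finset.mem_filter, Finset.mem_Ioc, Nat.le_floor_iff hz, Nat.le_floor_iff (hz.trans h)]
  grind

lemma rl_up {z v : Real} (hz : 0 ≤ z) (h : z ≤ v) : SM (rl z) v ≤ Chebyshev.psi v - Chebyshev.theta z := by
  rw [theta_restrict hz h, le_sub_iff_add_le]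
  simp only [SM, Chebyshev.psi]
  rw [← Finset.sum_add_distrib]
  refine Finset.sum_le_sum fun a _ => ?_
  by_cases h1 : a.Prime ∧ a ≤ z
  · have : ¬ RG z a := fun h2 => by have := h2 a h1.1 dvd_rfl; linarith
    simp [rl, this, h1, ArithmeticFunction.vonMangoldt_apply_prime h1.1]
  · rw [if_neg h1, add_zero]
    simp only [rl, ArithmeticFunction.coe_mk]
    split_ifs <;> simp

lemma rl_lo {z v : Real} (hz : 0 ≤ z) (h : z ≤ v) : Chebyshev.theta v - Chebyshev.theta z ≤ SM (rl z) v := by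
  rw [theta_restrict hz h, sub_le_iff_le_add]
  simp only [SM, Chebyshev.theta]
  rw [← Finset.sum_add_distrib, Finset.sum_filter]
  refine Finset.sum_le_sum fun a _ => ?_
  have h0 : 0 ≤ log a := log_natCast_nonneg a
  have h0' : 0 ≤ rl z a := by simp only [rl, ArithmeticFunction.coe_mk]; split_ifs <;> simp
  by_cases h1 : a.Prime
  · by_cases h2 : a ≤ z
    · grind
    · have : RG z a := fun p hp hd => by rw [(Nat.prime_dvd_prime_iff_eq hp h1).1 hd]; push Not at h2; exact h2
      simp [rl, h1, h2, this, ArithmeticFunction.vonMangoldt_apply_prime h1]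
  · simp [h1, h0']

lemma log_le_sq {q : Real} (hq : 0 < q) : log q ≤ 2 * √q := by
  have h1 := log_le_sub_one_of_pos (sqrt_pos.2 hq)
  rw [log_sqrt hq.le] at h1
  linarith

lemma x_log_sq {z v : Real} (hz : 2 ≤ z) (h : z ≤ v) : z / (log z)^2 ≤ 16 * (v / (log v)^2) := by
  have hz0 : 0 < z := bL
  have hv0 : 0 < v := bL
  have hlz : log 2 ≤ log z := log_le_log bN hz
  have hl2 := log_two_gt_d9
  have hl0 : 0 < log z := bL
  have hlv : log z ≤ log v := log_le_log hz0 h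
  have hlv0 : 0 < log v := bL
  set q := v / z with hq
  have hq1 : 1 ≤ q := (one_le_div hz0).2 h
  have hv : v = z * q := by grind
  have hlog : log v = log z + log q := by rw [hv, log_mul hz0.ne' bL]
  have hs := log_le_sq (by linarith : 0 < q)
  have hs1 : 1 ≤ √q := one_le_sqrt.2 hq1
  have h5 : log v ≤ 4 * √q * log z := by
    rw [hlog]
    have : √q * 0.69 ≤ √q * log z := mnl bL bL
    nlinarith
  have h6 : (log v)^2 ≤ 16 * q * (log z)^2 := by
    calc (log v)^2 ≤ (4 * √q * log z)^2 := by gcongr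
      _ = _ := by rw [mul_pow, mul_pow, sq_sqrt bL]; ring
  rw [← mul_div_assoc, div_le_div_iff₀ bP bP]
  calc z * (log v)^2 ≤ z * (16 * q * (log z)^2) := by gcongr
    _ = _ := by grind

lemma sqrt_log3 {x : Real} (hx : 2 ≤ x) : 2 * √x * log x ≤ 432 * (x / (log x)^2) := by
  have hl0 : 0 < log x := log_pos bL
  have hx0 : 0 < x := bL
  have h1 : log x ≤ 6 * x^((1:Real)/6) := by
    have := log_le_rpow_div hx0.le (by norm_num : (0:Real) < 1/6)
    linarith
  have h2 : (x^((1:Real)/6))^3 = √x := by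
    rw [← rpow_natCast, ← rpow_mul hx0.le, sqrt_eq_rpow]; norm_num
  have h3 : (log x)^3 ≤ 216 * √x := by
    calc (log x)^3 ≤ (6 * x^((1:Real)/6))^3 := by gcongr
      _ = _ := by rw [mul_pow, h2]; norm_num
  rw [← mul_div_assoc, le_div_iff₀ (by positivity)]
  calc 2 * √x * log x * log x^2 = 2 * √x * (log x)^3 := by ring
    _ ≤ 2 * √x * (216 * √x) := by gcongr
    _ = 432 * (√x * √x) := by ring
    _ = 432 * x := by rw [mul_self_sqrt hx0.le]

lemma rl_as : ∃ C : Real, 0 < C ∧ ∀ z v : Real, 2 ≤ z → z ≤ v → |SM (rl z) v - (v - z)| ≤ C * (v / (log v)^2) := by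
  obtain ⟨C, hC0, hC⟩ := pnt
  refine ⟨C + 16 * C + 432 + 16*432, by positivity, fun z v hz h => ?_⟩
  have h1 := hC v bL
  have h2 := hC z hz
  have h3 := rl_up (by linarith) h
  have h4 := rl_lo (by linarith) h
  have h5 := x_log_sq hz h
  have h6 := (Chebyshev.psi_sub_theta_le (by linarith : 1 ≤ v)).trans (sqrt_log3 bL)
  have h7 := (Chebyshev.psi_sub_theta_le (by linarith)).trans (sqrt_log3 hz)
  rw [mul_div_assoc] at h1 h2
  rw [abs_le] at h1 h2 ⊢
  have h8 := Chebyshev.theta_le_psi z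
  set V := v / (log v)^2
  have h9 : C * (z / log z^2) ≤ C * (16 * V) := by gcongr
  grind

lemma tau_div N : ∑ n ∈ Finset.Ioc 0 N, (n.divisors.card : Real) = ∑ n ∈ Finset.Ioc 0 N, ((N / n : ℕ) : Real) := by
  have := ArithmeticFunction.sum_Ioc_sigma0_eq_sum_div N
  simp only [ArithmeticFunction.sigma_zero_apply] at this
  exact_mod_cast this

noncomputable def tu (n : ℕ) : Real := n.divisors.card

lemma tau_harm y : SM (fun n => y / n) y = y * harmonic ⌊y⌋₊ := by
  rw [harmonic_eq_sum_Icc, SM, ← Finset.Icc_add_one_left_eq_Ioc]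
  push_cast
  rw [Finset.mul_sum]
  grind

lemma tau_le {y : Real} (hy : 1 ≤ y) : SM tu y ≤ y * (1 + log y) := by
  have h1 : SM tu y ≤ SM (fun n => y / n) y := by
    unfold SM tu
    rw [tau_div]
    refine Finset.sum_le_sum fun n _ => ?_
    rw [← Nat.floor_div_natCast]
    exact Nat.floor_le bP
  rw [tau_harm] at h1
  exact h1.trans (mnl (harmonic_floor_le_one_add_log y hy) bL)

lemma tau_ge {y : Real} (hy : 1 ≤ y) : y * log y - y ≤ SM tu y := by
  have h1 : SM (fun n => y / n) y - y ≤ SM tu y := by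
    have : SM (fun n => y / n) y ≤ SM (fun n => tu n + 1) y - SM tu y + SM tu y := by
      rw [sub_add_cancel]
      unfold SM
      rw [Finset.sum_add_distrib]; unfold tu
      rw [tau_div, ← Finset.sum_add_distrib]
      refine Finset.sum_le_sum fun n _ => ?_
      rw [← Nat.floor_div_natCast]
      exact (Nat.lt_floor_add_one _).le
    have h2 : SM (fun n => tu n + 1) y = SM tu y + ⌊y⌋₊ := by
      simp [SM, Finset.sum_add_distrib]
    have := Nat.floor_le (by linarith : 0 ≤ y)
    linarith
  rw [tau_harm] at h1
  have := mnl (log_le_harmonic_floor y bL) (by linarith : 0 ≤ y)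
  linarith

noncomputable def FF (L s : Real) : Real := if s < 1 then 0 else (SM (rt (exp L)) (exp (L*s)) - 1) * exp (-(L*s))

lemma Ph_ge {z y : Real} (hy : 1 ≤ y) : 1 ≤ SM (rt z) y := by
  have h1 : SM (rt z) 1 = 1 := by simp [SM, rt, RG_one]
  rw [← h1]
  exact SM_mono (rt_nn z) hy

lemma Ph_one {z y : Real} (hy : 1 ≤ y) (hz : y ≤ z) : SM (rt z) y = 1 := by
  rw [SM, Finset.sum_eq_single 1]
  · simp [rt, RG_one]
  · intro b hb hb1
    rw [Finset.mem_Ioc] at hb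
    have h3 := (Nat.le_floor_iff' hb.1.ne').1 hb.2
    have : ¬ RG z b := fun h => by have := RG_le h hb1 hb.1; linarith
    simp [rt, this]
  · intro h; exact absurd (Finset.mem_Ioc.2 ⟨one_pos, Nat.le_floor (by simpa using hy)⟩) h

lemma FF_eq {L s : Real} (hL : 0 < L) (hs : 0 ≤ s) : SM (rt (exp L)) (exp (L*s)) = 1 + exp (L*s) * FF L s := by
  unfold FF
  split_ifs with h
  · rw [Ph_one (one_le_exp bP) (exp_le_exp.2 (by nlinarith))]; ring
  · rw [mul_left_comm, ← exp_add]; simp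

lemma FF_nn {L : Real} (hL : 0 < L) s : 0 ≤ FF L s := by
  unfold FF
  split_ifs with h
  · linarith
  · push Not at h
    have := Ph_ge (z := exp L) (one_le_exp (by positivity : 0 ≤ L * s))
    positivity

lemma FF_tr {L : Real} (hL : 0 < L) {s : Real} (hs : 1 ≤ s) : FF L s ≤ 1 + s * L := by
  unfold FF
  rw [if_neg bL]
  have h1 : SM (rt (exp L)) (exp (L*s)) ≤ SM tu (exp (L*s)) := Finset.sum_le_sum fun n _ => rt_le _ n
  have h2 := tau_le (one_le_exp (by positivity : 0 ≤ L * s))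
  rw [log_exp] at h2
  calc _ ≤ (exp (L*s) * (1 + L*s)) * exp (-(L*s)) := by gcongr; linarith
    _ = (1 + s * L) * (exp (L*s) * exp (-(L*s))) := by ring
    _ = _ := by rw [← exp_add]; simp

lemma FF_LB {L : Real} (hL : 0 < L) : LB (FF L) where
  m := by
    refine Measurable.ite measurableSet_Iio measurable_const ?_
    have := (SM_meas (rt (exp L))).comp (by fun_prop : Measurable fun s : Real => exp (L*s))
    exact (this.sub_const 1).mul (by fun_prop)
  z := fun s hs => by simp [FF, hs]
  b := fun W => by
    refine ⟨1 + |W| * L, by positivity, fun s hs => ?_⟩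
    rw [abs_of_nonneg (FF_nn hL s)]
    rcases lt_or_ge s 1 with h | h
    · simp only [FF, h]; positivity
    · refine (FF_tr hL h).trans ?_
      gcongr; exact hs.trans (le_abs_self W)

lemma FF0 {L : Real} (hL : 0 < L) U : ∫ s in 0..U, FF L s = ∫ s in 1..U, FF L s := by
  have h := (FF_LB hL)
  rw [← iadj (h.ii 0 1) (h.ii 1 U), intervalIntegral.integral_symm, h.int0 zero_le_one]; ring

lemma exi {L : Real} (a U : Real) : ∫ s in a..U, L * exp (-(L*s)) = exp (-(L*a)) - exp (-(L*U)) := by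
  have : ∀ s ∈ uIcc a U, HasDerivAt (fun s => -exp (-(L*s))) (L * exp (-(L*s))) s := by
    intro s _
    have := ((((hasDerivAt_id s)).const_mul (L)).neg.exp).neg
    refine this.congr_deriv ?_
    simp [mul_comm]
  rw [intervalIntegral.integral_eq_sub_of_hasDerivAt this (by apply Continuous.intervalIntegrable; fun_prop)]
  ring

lemma FF_ii {L : Real} (hL : 0 < L) (a b : Real) {ω : Real → Real} (hω : ContinuousOn ω (uIcc a b)) : IntervalIntegrable (fun s => FF L s * ω s) volume a b :=
  ((FF_LB hL).ii a b).mul_continuousOn hω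

lemma st1 {L u : Real} (hL : 0 < L) (hu : 1 ≤ u) : u * FF L u = exp (-(L*u)) * (∫ s in 1..u, exp (L*s) * FF L s) +
    2 / L * (exp (-(L*u)) * SM (fun r => rt (exp L) r * SM (rl (exp L)) (exp (L*u) / r)) (exp (L*u))) := by
  have h1 := abel (rt (exp L)) (c := 0) (ω := fun _ => L) hL bL (by simp)
  simp only [sub_zero, icst, smul_eq_mul, zero_add] at h1
  have h2 : SM (fun n => rt (exp L) n * ((u - log n / L) * L)) (exp (L*u)) = L * u * SM (rt (exp L)) (exp (L*u)) - SM (fun r => rt (exp L) r * log r) (exp (L*u)) := by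
    simp only [SM]
    rw [Finset.mul_sum, ← Finset.sum_sub_distrib]
    refine Finset.sum_congr rfl fun n _ => ?_
    field_simp
  have h3 : ∫ s in 0..u, SM (rt (exp L)) (exp (L*s)) * L = L * u + L * ∫ s in 1..u, exp (L*s) * FF L s := by
    have e1 : ∀ s ∈ uIcc 0 u, SM (rt (exp L)) (exp (L*s)) * L = L + L * (exp (L*s) * FF L s) := by
      intro s hs
      rw [uIcc_of_le bL] at hs
      rw [FF_eq hL hs.1]; ring
    have e2 : ∀ a b, IntervalIntegrable (fun s => exp (L*s) * FF L s) volume a b := by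
      intro a b
      have := FF_ii hL a b (ω := fun s => exp (L*s)) (by fun_prop)
      grind
    rw [icg e1, iadd (by simp) ((e2 _ _).const_mul _), icm,
      ← iadj (e2 0 1) (e2 1 u)]
    have e3 : ∫ s in 0..1, exp (L*s) * FF L s = 0 := by
      rw [iole zero_le_one, ioo, scf measurableSet_Ioo fun s hs => by rw [(FF_LB hL).z s hs.2, mul_zero]]
      simp
    rw [e3]; simp; ring
  rw [h2, h3, rt_sum, FF_eq hL (by linarith)] at h1
  have h4 : exp (-(L*u)) * exp (L*u) = 1 := by rw [← exp_add]; simp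
  grind

lemma st2 {L u S : Real} (hL : 0 < L) (hu : 1 ≤ u) (hS : ∀ s, 1 ≤ s → s ≤ u → FF L s ≤ S) :
    0 ≤ exp (-(L*u)) * (∫ s in 1..u, exp (L*s) * FF L s) ∧ exp (-(L*u)) * (∫ s in 1..u, exp (L*s) * FF L s) ≤ S / L := by
  have hS0 : 0 ≤ S := (FF_nn hL 1).trans (hS 1 le_rfl hu)
  constructor
  · exact mul_nonneg (exp_pos _).le (inn hu fun s _ => mul_nonneg (exp_pos _).le (FF_nn hL s))
  · have h1 : ∫ s in 1..u, exp (L*s) * FF L s ≤ ∫ s in 1..u, exp (L*s) * S := by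
      refine imon hu ?_ (by apply Continuous.intervalIntegrable; fun_prop) fun s hs => ?_
      · have := FF_ii hL 1 u (ω := fun s => exp (L*s)) (by fun_prop)
        grind
      · exact mnl (hS s hs.1 hs.2) (exp_pos _).le
    have h2 : ∫ s in 1..u, exp (L*s) * S ≤ exp (L*u) * (S / L) := by
      have h7 := exi (L := -L) 1 u
      simp only [neg_mul, neg_neg, intervalIntegral.integral_neg, intervalIntegral.integral_const_mul] at h7
      have h8 : ∫ s in (1:Real)..u, exp (L*s) = (exp (L*u) - exp (L*1)) / L := by grind
      rw [intervalIntegral.integral_mul_const, h8]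
      have := exp_pos (L*1)
      have : (exp (L*u) - exp (L*1)) / L ≤ exp (L*u) / L := by gcongr; linarith
      calc _ ≤ exp (L*u) / L * S := by gcongr
        _ = _ := by ring
    calc _ ≤ exp (-(L*u)) * (exp (L*u) * (S/L)) := mul_le_mul_of_nonneg_left (h1.trans h2) (exp_pos _).le
      _ = _ := by rw [← mul_assoc, ← exp_add]; simp

lemma r_exp {L : Real} (hL : 0 < L) {r : ℕ} (hr : 0 < r) : exp (-(L * (0 + log r / L))) = 1 / r := by
  have : (0:Real) < r := bP
  rw [zero_add, mul_div_cancel₀ _ hL.ne', exp_neg, exp_log this, one_div]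

lemma st3 {L u : Real} (hL : 0 < L) (hu : 1 ≤ u) :
    exp (-(L*u)) * SM (fun r => rt (exp L) r * (exp (L*u) / r - exp L)) (exp (L*(u-1))) = (1 - exp (-L*(u-1))) + L * ∫ s in 1..(u-1), FF L s := by
  have h1 := abel (rt (exp L)) (c := 0) (U := u - 1) (ω := fun s => L * exp (-(L*s))) hL bL (by apply Continuous.intervalIntegrable; fun_prop)
  simp only [exi, sub_zero] at h1
  have h2 : ∫ s in 0..(u-1), SM (rt (exp L)) (exp (L*s)) * (L * exp (-(L*s))) = ∫ s in 0..(u-1), (L * exp (-(L*s)) + L * FF L s) := by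
    refine icg fun s hs => ?_
    rw [uIcc_of_le bL] at hs
    rw [FF_eq hL hs.1]
    have : exp (L*s) * exp (-(L*s)) = 1 := by rw [← exp_add]; simp
    grind
  rw [h2, iadd (by apply Continuous.intervalIntegrable; fun_prop) (((FF_LB hL).ii _ _).const_mul _), exi, icm, FF0 hL] at h1
  rw [show -L*(u-1) = -(L*(u-1)) by ring]
  simp only [mul_zero, neg_zero, exp_zero] at h1
  rw [← h1]
  simp only [SM]
  rw [Finset.mul_sum]
  refine Finset.sum_congr rfl fun n hn => ?_
  rw [Finset.mem_Ioc] at hn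
  rw [r_exp hL hn.1]
  have e1 : exp (-(L*u)) * exp (L*u) = 1 := by rw [← exp_add]; simp
  have e2 : exp (-(L*(u-1))) = exp (-(L*u)) * exp L := by rw [← exp_add]; ring_nf
  rw [e2]
  linear_combination (rt (exp L) n / n) * e1

lemma inv_sq_int {u U : Real} (hu : 0 ≤ U) (hU : U + 1 ≤ u) : ∫ s in (0:Real)..U, 1 / (u-s)^2 ≤ 1 := by
  have : ∀ s ∈ Set.uIcc 0 U, HasDerivAt (fun s => 1/(u-s)) (1 / (u-s)^2) s := by
    intro s hs
    rw [uIcc_of_le hu] at hs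
    have := ((hasDerivAt_id s).const_sub u).inv (by simp only [id]; linarith [hs.2])
    simp only [one_div]
    refine this.congr_deriv ?_
    simp
  rw [intervalIntegral.integral_eq_sub_of_hasDerivAt this]
  · have : 0 ≤ 1/(u-0) := div_nonneg zero_le_one bL
    have : 1/(u-U) ≤ 1 := by rw [div_le_one bL]; linarith
    linarith
  · apply ContinuousOn.intervalIntegrable
    rw [uIcc_of_le hu]
    refine continuousOn_const.div (by fun_prop) fun s hs => ?_
    have : 0 < u - s := by linarith [hs.2]
    positivity

lemma st4 {L u S : Real} (hL : 0 < L) (hu : 1 ≤ u) (hS : ∀ s, 1 ≤ s → s ≤ u → FF L s ≤ S) :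
    SM (fun r => rt (exp L) r * ((1 / r) / (u - log r / L)^2)) (exp (L*(u-1))) ≤ 2 + S + L * S := by
  have hS0 : 0 ≤ S := (FF_nn hL 1).trans (hS 1 le_rfl hu)
  have hS' : ∀ s, s ≤ u → FF L s ≤ S := by
    intro s hs
    rcases lt_or_ge s 1 with h | h
    · rw [(FF_LB hL).z s h]; exact hS0
    grind
  have hpos : ∀ s ∈ Icc 0 (u-1), 0 < u - s := fun s hs => by linarith [hs.2]
  have hc : ContinuousOn (fun s => L * exp (-(L*s)) / (u-s)^2) (uIcc 0 (u-1)) := by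
    rw [uIcc_of_le bL]
    refine ContinuousOn.div (by fun_prop) (by fun_prop) fun s hs => ?_
    have := hpos s hs
    positivity
  have hc2 : ContinuousOn (fun s => 1 / (u-s)^2) (uIcc 0 (u-1)) := by
    rw [uIcc_of_le bL]
    refine ContinuousOn.div (by fun_prop) (by fun_prop) fun s hs => ?_
    have := hpos s hs
    positivity
  have h1 := abel (rt (exp L)) hL bL hc.intervalIntegrable
  simp only [sub_zero] at h1
  have h2 : SM (fun r => rt (exp L) r * ((1 / r) / (u - log r / L)^2)) (exp (L*(u-1))) ≤ SM (rt (exp L)) (exp (L*(u-1))) * exp (-(L*(u-1))) +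
     SM (fun n => rt (exp L) n * ∫ s in (0 + log n / L)..(u-1), L * exp (-(L*s)) / (u-s)^2) (exp (L*(u-1))) := by
    simp only [SM]
    rw [Finset.sum_mul, ← Finset.sum_add_distrib]
    refine Finset.sum_le_sum fun n hn => ?_
    rw [Finset.mem_Ioc] at hn
    rw [← mul_add]
    refine mnl ?_ (rt_nn _ _)
    rw [← r_exp hL hn.1]
    have hn1 : (1:Real) ≤ n := by exact_mod_cast hn.1
    have g0 : 0 ≤ 0 + log n / L := by positivity
    have g1 : 0 + log n / L ≤ u - 1 := by
      have := (Nat.le_floor_iff (exp_pos _).le).1 hn.2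
      rw [← log_le_iff_le_exp (by linarith)] at this
      rw [zero_add, div_le_iff₀ hL]; linarith
    simp only [zero_add] at g0 g1 ⊢
    set s := log n / L
    have g2 : 1 / (u-s)^2 * (exp (-(L*s)) - exp (-(L*(u-1)))) ≤ ∫ r in s..(u-1), L * exp (-(L*r)) / (u-r)^2 := by
      rw [← exi, ← intervalIntegral.integral_const_mul]
      refine intervalIntegral.integral_mono_on g1 (by apply Continuous.intervalIntegrable; fun_prop) ?_ fun r hr => ?_
      · refine hc.intervalIntegrable.mono_set ?_
        rw [Set.uIcc_of_le g1, Set.uIcc_of_le (by linarith)]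
        grind
      · have : 0 < u - r := by grind
        rw [one_div_mul_eq_div]
        gcongr
        grind
    have g3 : 1 / (u-s)^2 ≤ 1 := by
      rw [div_le_one (by nlinarith)]; nlinarith
    have := mul_le_mul_of_nonneg_right g3 (exp_pos (-(L*(u-1)))).le
    grind
  have h3 : SM (rt (exp L)) (exp (L*(u-1))) * exp (-(L*(u-1))) ≤ 1 + S := by
    rw [FF_eq hL (by linarith), add_mul, one_mul, mul_right_comm, ← exp_add, add_neg_cancel, exp_zero, one_mul]
    have : exp (-(L*(u-1))) ≤ 1 := exp_le_one_iff.2 (by nlinarith)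
    grind
  have h4 : ∫ s in (0:Real)..(u-1), SM (rt (exp L)) (exp (L*s)) * (L * exp (-(L*s)) / (u-s)^2) ≤ ∫ s in (0:Real)..(u-1), (L * exp (-(L*s)) + L * S * (1 / (u-s)^2)) := by
    refine intervalIntegral.integral_mono_on (by linarith) ?_ ?_ fun s hs => ?_
    · have : IntervalIntegrable (fun s => SM (rt (exp L)) (exp (L*s))) volume 0 (u-1) := by
        refine Monotone.intervalIntegrable fun a b h => SM_mono (rt_nn _) (exp_le_exp.2 (mul_le_mul_of_nonneg_left h hL.le))
      exact this.mul_continuousOn hc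
    · exact IntervalIntegrable.add (by apply Continuous.intervalIntegrable; fun_prop) (hc2.intervalIntegrable.const_mul _)
    · rw [FF_eq hL hs.1]
      have e1 : exp (L*s) * exp (-(L*s)) = 1 := by rw [← exp_add]; simp
      have hp := hpos s hs
      have e2 : (1 + exp (L*s) * FF L s) * (L * exp (-(L*s)) / (u-s)^2) = L * exp (-(L*s)) * (1 / (u-s)^2) + L * FF L s * (1/(u-s)^2) := by grind
      rw [e2]
      have g3 : 1 / (u-s)^2 ≤ 1 := by
        rw [div_le_one (by positivity)]; nlinarith [hs.2]
      have := hS' s (by linarith [hs.2])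
      have := exp_pos (-(L*s))
      refine add_le_add (mul_le_of_le_one_right (by positivity) g3) ?_
      gcongr
  rw [intervalIntegral.integral_add (by apply Continuous.intervalIntegrable; fun_prop) (hc2.intervalIntegrable.const_mul _), exi, intervalIntegral.integral_const_mul] at h4
  have h5 := inv_sq_int (u := u) (U := u - 1) (by linarith) (by linarith)
  have h6 : L * S * (∫ s in (0:Real)..(u-1), 1 / (u-s)^2) ≤ L * S * 1 := by gcongr
  have := exp_pos (-(L*(u-1)))
  simp only [mul_zero, neg_zero, exp_zero] at h4
  linarith

lemma FF_RF : ∃ C1 : Real, 0 ≤ C1 ∧ ∀ L, log 2 ≤ L → RF C1 L (FF L) := by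
  obtain ⟨C, hC0, hC⟩ := rl_as
  refine ⟨1 + 20 * C, by positivity, fun L hL => ?_⟩
  have hl2 := log_two_gt_d9
  have hL0 : 0 < L := by linarith
  refine ⟨FF_LB hL0, FF_nn hL0, fun u hu => FF_tr hL0 hu, fun u hu S hS => ?_⟩
  have hS0 : 0 ≤ S := (FF_nn hL0 1).trans (hS 1 le_rfl hu)
  have hz : 2 ≤ exp L := by rw [← log_le_iff_le_exp (by norm_num)]; exact hL
  rw [st1 hL0 hu]
  obtain ⟨a1, a2⟩ := st2 hL0 hu hS
  have a3 := st3 hL0 hu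
  have a4 := st4 hL0 hu hS
  set E := exp (-(L*u)) with hE
  set av := E * (∫ s in (1:Real)..u, exp (L*s) * FF L s)
  have hsub : Finset.Ioc 0 ⌊exp (L*(u-1))⌋₊ ⊆ Finset.Ioc 0 ⌊exp (L*u)⌋₊ :=
    Finset.Ioc_subset_Ioc_right (Nat.floor_mono (exp_le_exp.2 (by nlinarith)))
  have b1 : SM (fun r => rt (exp L) r * SM (rl (exp L)) (exp (L*u) / r)) (exp (L*u)) = SM (fun r => rt (exp L) r * SM (rl (exp L)) (exp (L*u) / r)) (exp (L*(u-1))) := by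
    unfold SM
    refine (Finset.sum_subset hsub fun n hn hn' => ?_).symm
    rw [Finset.mem_Ioc] at hn hn'
    have hn0 : (0:Real) < n := by exact_mod_cast hn.1
    have h1 : exp (L*(u-1)) < n := by
      by_contra h
      push Not at h
      exact hn' ⟨hn.1, (Nat.le_floor_iff (exp_pos _).le).2 h⟩
    have h2 : exp (L*u) / n ≤ exp L := by
      rw [div_le_iff₀ hn0]
      have : exp (L*u) = exp L * exp (L*(u-1)) := by rw [← exp_add]; ring_nf
      rw [this]
      gcongr
    have := rl_zero h2
    unfold SM at this
    rw [this, mul_zero]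
  have b2 : |SM (fun r => rt (exp L) r * SM (rl (exp L)) (exp (L*u) / r)) (exp (L*(u-1))) - SM (fun r => rt (exp L) r * (exp (L*u) / r - exp L)) (exp (L*(u-1)))| ≤
      C * exp (L*u) / L^2 * SM (fun r => rt (exp L) r * ((1 / r) / (u - log r / L)^2)) (exp (L*(u-1))) := by
    unfold SM
    rw [← Finset.sum_sub_distrib, Finset.mul_sum]
    refine (Finset.abs_sum_le_sum_abs _ _).trans (Finset.sum_le_sum fun n hn => ?_)
    rw [Finset.mem_Ioc] at hn
    have hn0 : (0:Real) < n := by exact_mod_cast hn.1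
    have h1 := (Nat.le_floor_iff (exp_pos _).le).1 hn.2
    have h2 : exp L ≤ exp (L*u) / n := by
      rw [le_div_iff₀ hn0]
      have : exp (L*u) = exp L * exp (L*(u-1)) := by rw [← exp_add]; ring_nf
      rw [this]
      gcongr
    have h3 := hC _ _ hz h2
    rw [log_div (exp_pos _).ne' hn0.ne', log_exp] at h3
    rw [← mul_sub, abs_mul, abs_of_nonneg (rt_nn _ _)]
    refine (mul_le_mul_of_nonneg_left h3 (rt_nn _ _)).trans (le_of_eq ?_)
    have : L * u - log n = L * (u - log n / L) := by field_simp
    rw [this]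
    rw [mul_pow]
    simp only [div_eq_mul_inv, mul_inv]
    ring
  rw [b1]
  set P := SM (fun r => rt (exp L) r * SM (rl (exp L)) (exp (L*u) / r)) (exp (L*(u-1)))
  set Q := SM (fun r => rt (exp L) r * (exp (L*u) / r - exp L)) (exp (L*(u-1)))
  set I := ∫ s in (1:Real)..(u-1), FF L s
  have hE0 : 0 < E := exp_pos _
  have hEE : E * exp (L*u) = 1 := by rw [hE, ← exp_add]; simp
  have e1 : av + 2 / L * (E * P) - 2 * I - 2 / L * (1 - exp (-L*(u-1))) = av + 2 / L * (E * (P - Q)) := by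
    have : 1 - exp (-L*(u-1)) = E * Q - L * I := by linarith
    rw [this]; field_simp; ring
  rw [e1]
  have b3 : |E * (P - Q)| ≤ C / L^2 * (2 + S + L * S) := by
    rw [abs_mul, abs_of_pos hE0]
    calc E * |P - Q| ≤ E * (C * exp (L*u) / L^2 * (2 + S + L * S)) := by
          refine mul_le_mul_of_nonneg_left (b2.trans ?_) hE0.le
          exact mul_le_mul_of_nonneg_left a4 (by positivity)
      _ = (E * exp (L*u)) * (C / L^2 * (2 + S + L * S)) := by ring
      _ = _ := by rw [hEE, one_mul]
  have b4 : |2 / L * (E * (P-Q))| ≤ 2 / L * (C / L^2 * (2 + S + L * S)) := by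
    rw [abs_mul, abs_of_pos (by positivity : 0 < 2 / L)]
    gcongr
  refine (abs_add_le _ _).trans ?_
  rw [abs_of_nonneg a1]
  have b5 : 2 / L * (C / L^2 * (2 + S + L * S)) ≤ 20 * C * (S / L + 1 / L^3) := by
    have e : 2 / L * (C / L^2 * (2 + S + L * S)) = C * ((4 + 2*S + 2*L*S) / L^3) := by field_simp; ring
    have e' : 20 * C * (S / L + 1 / L^3) = C * ((20 * S * L^2 + 20) / L^3) := by field_simp
    rw [e, e']
    refine mul_le_mul_of_nonneg_left ?_ hC0.le
    gcongr ?_ / _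
    have : 0.69 * L ≤ L^2 := by nlinarith
    have h7 : 0 ≤ S * (L^2 - 0.69 * L) := mul_nonneg hS0 (by linarith)
    have h8 : 0 ≤ S * (L^2 - 0.69*0.69) := mul_nonneg hS0 (by nlinarith)
    nlinarith
  have : 0 ≤ 1 / L^3 := by positivity
  have h9 : (1 + 20 * C) * (S / L + 1 / L^3) = S / L + 1 / L^3 + 20 * C * (S / L + 1 / L^3) := by ring
  rw [h9]
  linarith

lemma IsDense.nxt {n : ℕ} {t : Real} (h : IsDense n t) (ht : 0 ≤ t) {d : ℕ} (h1 : 1 ≤ d) (hd : d < n) : ∃ e : ℕ, e ∣ n ∧ d < e ∧ e ≤ t * d := by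
  have hne : (n.divisors.filter (· ≤ d)).Nonempty := ⟨1, by simp [h1, h.1.ne']⟩
  obtain ⟨d0, hd0, hmax⟩ := Finset.exists_max_image _ id hne
  simp only [Finset.mem_filter, Nat.mem_divisors] at hd0 hmax
  obtain ⟨e, he, h2, h3⟩ := h.2 d0 hd0.1.1 (hd0.2.trans_lt hd)
  refine ⟨e, he, ?_, h3.trans (mnl (by exact_mod_cast hd0.2) ht)⟩
  grind

lemma IsDense.mul {n q : ℕ} {t : Real} (h : IsDense n t) (ht : 0 ≤ t) (h1 : 1 ≤ q) (hq : q ≤ t * n) : IsDense (n*q) t := by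
  refine ⟨Nat.mul_pos h.1 h1, fun d hd hlt => ?_⟩
  have hd1 : 1 ≤ d := Nat.pos_of_dvd_of_pos hd (Nat.mul_pos h.1 h1)
  rcases lt_or_ge d n with h2 | h2
  · obtain ⟨e, a, b, c⟩ := h.nxt ht hd1 h2
    grind
  rcases lt_or_ge d q with h3 | h3
  · exact ⟨q, dvd_mul_left _ _, h3, hq.trans (mnl (by exact_mod_cast h2) ht)⟩
  · obtain ⟨e, a, b, c⟩ := h.nxt ht ((Nat.one_le_div_iff h1).2 h3) ((Nat.div_lt_iff_lt_mul h1).2 hlt)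
    refine ⟨e * q, Nat.mul_dvd_mul_right a q, (Nat.div_lt_iff_lt_mul h1).1 b, ?_⟩
    push_cast
    calc e * q ≤ t * (d/q : ℕ) * q := by gcongr
      _ = t * ((d/q : ℕ) * q) := by ring
      _ ≤ t * d := by
        gcongr
        exact_mod_cast Nat.div_mul_le_self d q

lemma IsDense.one t : IsDense 1 t := ⟨one_pos, fun d hd h => by have := Nat.dvd_one.1 hd; omega⟩

lemma RG.cop {z : Real} {r n : ℕ} (h : RG z r) (hn : 0 < n) (hz : n ≤ z) : n.Coprime r := by
  refine Nat.coprime_of_dvd fun p hp h1 h2 => ?_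
  have := h p hp h2
  have h3 : (p:Real) ≤ n := by exact_mod_cast Nat.le_of_dvd hn h1
  linarith

lemma dense_ex {t : Real} (ht : 1 ≤ t) {m : ℕ} (hm : 0 < m) : ∃ x ∈ m.divisorsAntidiagonal, IsDense x.1 t ∧ RG (t * x.1) x.2 := by
  classical
  have hne : (m.divisors.filter (IsDense · t)).Nonempty := ⟨1, by simp [hm.ne', IsDense.one]⟩
  obtain ⟨n, hn, hmax⟩ := Finset.exists_max_image _ id hne
  simp only [Finset.mem_filter, Nat.mem_divisors, id] at hn hmax
  obtain ⟨⟨⟨r, hr⟩, _⟩, hd⟩ := hn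
  refine ⟨(n, r), Nat.mem_divisorsAntidiagonal.2 ⟨hr.symm, hm.ne'⟩, hd, fun p hp hpr => ?_⟩
  by_contra h
  push Not at h
  have h1 := hmax (n * p) ⟨⟨by rw [hr]; exact Nat.mul_dvd_mul_left n hpr, hm.ne'⟩, hd.mul bL hp.one_le h⟩
  have := hd.1
  have := hp.two_le
  nlinarith

lemma dense_aux {t : Real} (ht : 1 ≤ t) {n r n' r' : ℕ} (he : n * r = n' * r') (h1 : IsDense n t) (h2 : RG (t*n) r) (h1' : IsDense n' t) (h2' : RG (t*n') r') : n' ≤ n := by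
  by_contra hlt
  push Not at hlt
  have hnn : (n:Real) < n' := by exact_mod_cast hlt
  have hn0 : 0 < n := by exact_mod_cast h1.1
  have hn' : 0 < n' := bL
  have hc : n.Coprime r' := h2'.cop h1.1 (by nlinarith)
  have hdv : n ∣ n' := hc.dvd_of_dvd_mul_right (by rw [← he]; exact dvd_mul_right _ _)
  obtain ⟨k, hk⟩ := hdv
  have hr : r = k * r' := by
    have : n * r = n * (k * r') := by rw [he, hk]; ring
    exact Nat.eq_of_mul_eq_mul_left h1.1 this
  have hk2 : RG (t*n) k := by rw [hr] at h2; exact (RG_mul.1 h2).1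
  obtain ⟨e, he, h3, h4⟩ := h1'.2 n ⟨k, hk⟩ hlt
  have hc2 : e.Coprime k := hk2.cop (by omega) h4
  have : e ∣ n := hc2.dvd_of_dvd_mul_right (by rw [← hk]; exact he)
  have := Nat.le_of_dvd h1.1 this
  omega

open Classical in
noncomputable def aD (t : Real) (n : ℕ) : Real := if IsDense n t then (n.divisors.card : Real) else 0

lemma T_eq (x t : Real) : T x t = SM (aD t) x := by
  classical
  rw [T, SM, Finset.sum_filter]
  rfl

lemma aD_nn t n : 0 ≤ aD t n := by unfold aD; positivity

lemma aD_le t n : aD t n ≤ tu n := by unfold aD tu; split_ifs <;> simp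

lemma tau_dense {t : Real} (ht : 1 ≤ t) {m : ℕ} (hm : 0 < m) : tu m = ∑ x ∈ m.divisorsAntidiagonal, aD t x.1 * rt (t * x.1) x.2 := by
  obtain ⟨y, hy, h1, h2⟩ := dense_ex ht hm
  have hy' := Nat.mem_divisorsAntidiagonal.1 hy
  rw [Finset.sum_eq_single_of_mem y hy]
  · have hc : y.1.Coprime y.2 := h2.cop h1.1 (by have : (0:Real) < y.1 := by exact_mod_cast h1.1
                                                 nlinarith)
    simp only [aD, h1, rt, ArithmeticFunction.coe_mk, h2, tu]
    rw [← hy'.1, hc.card_divisors_mul]; push_cast; rfl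
  · intro x hx hne
    have hx' := Nat.mem_divisorsAntidiagonal.1 hx
    by_cases h3 : IsDense x.1 t
    · by_cases h4 : RG (t * x.1) x.2
      · exfalso
        apply hne
        have he : x.1 * x.2 = y.1 * y.2 := by rw [hx'.1, hy'.1]
        have e1 := le_antisymm (dense_aux ht he.symm h1 h2 h3 h4) (dense_aux ht he h3 h4 h1 h2)
        refine Prod.ext e1 ?_
        rw [e1] at he
        exact Nat.eq_of_mul_eq_mul_left h1.1 he
      · simp [rt, h4]
    · simp [aD, h3]

lemma sum_hyp (g : ℕ → ℕ → Real) N : ∑ m ∈ Finset.Ioc 0 N, ∑ x ∈ m.divisorsAntidiagonal, g x.1 x.2 = ∑ n ∈ Finset.Ioc 0 N, ∑ r ∈ Finset.Ioc 0 (N/n), g n r := by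
  rw [Finset.sum_sigma', Finset.sum_sigma']
  refine Finset.sum_bij' (fun p _ => ⟨p.2.1, p.2.2⟩) (fun p _ => ⟨p.1 * p.2, (p.1, p.2)⟩) ?_ ?_ ?_ ?_ ?_
  · rintro ⟨m, a, b⟩ h
    simp only [Finset.mem_sigma, Finset.mem_Ioc, Nat.mem_divisorsAntidiagonal] at h ⊢
    obtain ⟨⟨h1, h2⟩, rfl, h3⟩ := h
    have ha : 0 < a := Nat.pos_of_mul_pos_right h1
    have hb : 0 < b := Nat.pos_of_mul_pos_left h1
    refine ⟨⟨ha, le_trans (Nat.le_mul_of_pos_right a hb) h2⟩, hb, ?_⟩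
    rw [Nat.le_div_iff_mul_le ha]; linarith
  · rintro ⟨a, b⟩ h
    simp only [Finset.mem_sigma, Finset.mem_Ioc, Nat.mem_divisorsAntidiagonal] at h ⊢
    have := (Nat.le_div_iff_mul_le h.1.1).1 h.2.2
    refine ⟨⟨Nat.mul_pos h.1.1 h.2.1, by linarith⟩, trivial, (Nat.mul_pos h.1.1 h.2.1).ne'⟩
  · rintro ⟨m, a, b⟩ h
    simp only [Finset.mem_sigma, Nat.mem_divisorsAntidiagonal] at h
    grind
  · simp
  · rintro ⟨m, a, b⟩ h; rfl

lemma dense_id {t : Real} (ht : 1 ≤ t) x : SM tu x = SM (fun n => aD t n * SM (rt (t*n)) (x/n)) x := by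
  unfold SM
  have h := sum_hyp (fun a b => aD t a * rt (t * a) b) ⌊x⌋₊
  rw [Finset.sum_congr rfl fun m hm => tau_dense ht (Finset.mem_Ioc.1 hm).1]
  simp only [← Nat.floor_div_natCast, ← Finset.mul_sum] at h
  exact h

lemma Phi_as {ξ : Real → Real} (hx : XI ξ) : ∃ C : Real, 0 < C ∧ ∃ b : Real → Real, (∀ z, 2 ≤ z → |b z| ≤ C / (log z)^3) ∧
    ∀ z, 2 ≤ z → ∀ y, 1 ≤ y → |SM (rt z) y - 1 - y * ξ (log y / log z) / log z - b z * (y * log y)| ≤ C * (y / (log z)^2 + if z ≤ y then z / log z else 0) := by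
  obtain ⟨C1, h1, h2⟩ := FF_RF
  obtain ⟨C3, h3, h4⟩ := hx.Fas h1
  have h5 : ∀ z : Real, ∃ b, 2 ≤ z → |b| ≤ C3 / (log z)^2 ∧ ∀ u, 1 ≤ u → |FF (log z) u - ξ u / log z - b * (u+2)| ≤ C3 / (log z)^2 * (1 + log z * exp (-log z*(u-1))) := by
    intro z
    by_cases hz : 2 ≤ z
    · have hl : log 2 ≤ log z := log_le_log bN hz
      grind
    · exact ⟨0, fun h => absurd h hz⟩
  choose b hb using h5
  refine ⟨3 * C3 + 1, by positivity, fun z => b z / log z, fun z hz => ?_, fun z hz y hy => ?_⟩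
  · have hl0 : 0 < log z := log_pos bL
    rw [abs_div, abs_of_pos hl0, div_le_iff₀ hl0]
    refine (hb z hz).1.trans ?_
    have e : (3 * C3 + 1) / log z^3 * log z = (3 * C3 + 1) / log z^2 := by field_simp
    rw [e]; gcongr; linarith
  · set L := log z with hL
    have hl0 : 0 < L := log_pos bL
    have hb1 := (hb z hz).1
    have hz0 : 0 < z := bL
    have hy0 : 0 < y := bL
    have hly : 0 ≤ log y := log_nonneg hy
    have hezL : exp L = z := exp_log hz0
    split_ifs with h
    · have hu : 1 ≤ log y / L := by rw [one_le_div hl0]; exact log_le_log hz0 h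
      have h6 := (hb z hz).2 _ hu
      have h7 := FF_eq hl0 (by linarith : 0 ≤ log y / L)
      have e0 : L * (log y / L) = log y := by field_simp
      rw [e0, exp_log hy0, hezL] at h7
      have e1 : y * exp (-L * (log y / L - 1)) = z := by
        rw [show -L * (log y / L - 1) = L - L * (log y / L) by ring, e0, exp_sub, exp_log hy0, hezL]; field_simp
      have e2 : SM (rt z) y - 1 - y * ξ (log y / L) / L - b z / L * (y * log y) = y * (FF L (log y / L) - ξ (log y / L) / L - b z * (log y / L + 2)) + 2 * (b z * y) := by grind
      rw [e2]
      refine (abs_add_le _ _).trans ?_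
      have a1 : |y * (FF L (log y / L) - ξ (log y / L) / L - b z * (log y / L + 2))| ≤ C3 / L^2 * (y + L * z) := by
        rw [abs_mul, abs_of_pos hy0]
        calc _ ≤ y * (C3 / L^2 * (1 + L * exp (-L * (log y / L - 1)))) := by gcongr
          _ = C3 / L^2 * (y + L * (y * exp (-L * (log y / L - 1)))) := by ring
          _ = _ := by rw [e1]
      have a2 : |2 * (b z * y)| ≤ 2 * (C3 / L^2 * y) := by
        rw [abs_mul, abs_mul, abs_two, abs_of_pos hy0]; gcongr
      have e3 : C3 / L^2 * (y + L * z) = C3 * (y / L^2 + z / L) := by field_simp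
      have e4 : 2 * (C3 / L^2 * y) = 2 * C3 * (y / L^2) := by ring
      rw [e3] at a1; rw [e4] at a2
      have p1 : 0 ≤ y / L^2 := bP
      have p2 : 0 ≤ z / L := bP
      have p3 : 0 ≤ C3 * (z / L) := bP
      nlinarith
    · push Not at h
      have hu : log y / L < 1 := by rw [div_lt_one hl0]; exact log_lt_log hy0 h
      rw [Ph_one hy h.le, hx.z _ hu]
      have e : 1 - 1 - y * 0 / L - b z / L * (y * log y) = - (b z * (y * (log y / L))) := by ring
      rw [e, abs_neg, abs_mul, abs_of_nonneg (by positivity : 0 ≤ y * (log y / L))]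
      calc |b z| * (y * (log y / L)) ≤ C3 / L^2 * (y * 1) := by gcongr
        _ = C3 * (y / L^2) := by ring
        _ ≤ _ := by
          have p1 : 0 ≤ y / L^2 := bP
          rw [add_zero]; gcongr; linarith

lemma rt_anti {z z' : Real} (h : z ≤ z') y : SM (rt z') y ≤ SM (rt z) y := by
  refine Finset.sum_le_sum fun n _ => ?_
  simp only [rt, ArithmeticFunction.coe_mk]
  by_cases h1 : RG z' n
  · have : RG z n := fun p hp hd => h.trans_lt (h1 p hp hd)
    grind
  grind

lemma Phi_lo {ξ : Real → Real} {c : Real} (hx : XC ξ c) : ∃ c0 : Real, 0 < c0 ∧ ∀ z, 2 ≤ z → ∃ Y : Real, ∀ y, Y ≤ y → c0 / (log z)^2 * (y * log y) ≤ SM (rt z) y := by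
  obtain ⟨C, hC, b, hb, h⟩ := Phi_as hx.toXI
  have hc := hx.c1
  have hc0 : 0 < c := bL
  have big : ∀ z, 2 ≤ z → 2 * C / c ≤ log z → ∃ Y : Real, ∀ y, Y ≤ y → c / 4 / (log z)^2 * (y * log y) ≤ SM (rt z) y := by
    intro z hz hzL
    set L := log z with hL
    have hl0 : 0 < L := log_pos bL
    have hz0 : 0 < z := bL
    set K := 6 / L + C * (1 / L^2 + z / L) with hK
    have hK0 : 0 < K := bP
    refine ⟨max z (exp (4 * L^2 * K / c)), fun y hy => ?_⟩
    have hzy : z ≤ y := (le_max_left _ _).trans hy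
    have hy1 : 1 ≤ y := bL
    have hy0 : 0 < y := bL
    have hly : 4 * L^2 * K / c ≤ log y := by
      rw [← log_exp (4 * L^2 * K / c)]; exact log_le_log (exp_pos _) ((le_max_right _ _).trans hy)
    have hly0 : 0 ≤ log y := log_nonneg hy1
    have hu : 1 ≤ log y / L := by rw [one_le_div hl0]; exact log_le_log hz0 hzy
    have h1 := (abs_le.1 (h z hz y hy1)).1
    rw [if_pos hzy] at h1
    have h2 := (abs_le.1 (hx.epb hu)).1
    have h3 : 6 / (log y / L) ≤ 6 := div_le_self bN hu
    unfold ep at h2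
    have h4 : c * (log y / L) - 6 ≤ ξ (log y / L) := by nlinarith
    have h5 : y * (c * (log y / L) - 6) / L ≤ y * ξ (log y / L) / L := by gcongr
    have h6 : -(C / L^3 * (y * log y)) ≤ b z * (y * log y) := by
      have := (abs_le.1 (hb z hz)).1
      have p : 0 ≤ y * log y := bP
      nlinarith
    have h7 : C / L^3 ≤ c / 2 / L^2 := by
      rw [div_le_div_iff₀ bP bP]
      rw [div_le_iff₀ hc0] at hzL
      have : C * L^2 ≤ (L * c / 2) * L^2 := by gcongr; linarith
      nlinarith
    have h8 : C / L^3 * (y * log y) ≤ c / 2 / L^2 * (y * log y) := by gcongr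
    have h9 : y * (4 * L^2 * K / c) ≤ y * log y := by gcongr
    have h10 : c / 4 / L^2 * (y * (4 * L^2 * K / c)) ≤ c / 4 / L^2 * (y * log y) := by gcongr
    have e1 : c / 4 / L^2 * (y * (4 * L^2 * K / c)) = K * y := by field_simp
    have e2 : y * (c * (log y / L) - 6) / L = c / L^2 * (y * log y) - 6 / L * y := by field_simp
    have e3 : K * y = 6 / L * y + C * (y / L^2) + C * (z / L) * y := by rw [hK]; ring
    have e4 : C * (z/L) ≤ C * (z/L) * y := le_mul_of_one_le_right bP hy1
    have e5 : c / 4 / L^2 * (y * log y) = (c / L^2 * (y * log y)) / 4 := by ring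
    have e6 : c / 2 / L^2 * (y * log y) = (c / L^2 * (y * log y)) / 2 := by ring
    have e7 : C * (y / L^2 + z / L) = C * (y / L^2) + C * (z / L) := by ring
    rw [e1, e3, e5] at h10
    rw [e6] at h8
    rw [e2] at h5
    rw [e7] at h1
    rw [e5]
    linarith
  have hl2 := log_two_gt_d9
  set L1 := 1 + 2 * C / c with hL1
  have hL1p : 0 < 2 * C / c := bP
  refine ⟨c / 4 * (log 2)^2 / L1^2, by positivity, fun z hz => ?_⟩
  have hlz : log 2 ≤ log z := log_le_log bN hz
  have key : ∀ l y, 0 ≤ y * log y → (log 2)^2 / L1^2 / (log z)^2 ≤ 1 / l^2 → c / 4 / l^2 * (y * log y) ≤ SM (rt z) y → c / 4 * (log 2)^2 / L1^2 / (log z)^2 * (y * log y) ≤ SM (rt z) y := by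
    intro l y h1 h2 h3
    refine le_trans ?_ h3
    have : c / 4 * ((log 2)^2 / L1^2 / (log z)^2) * (y * log y) ≤ c / 4 * (1 / l^2) * (y * log y) := by gcongr
    calc _ = c / 4 * ((log 2)^2 / L1^2 / (log z)^2) * (y * log y) := by ring
      _ ≤ _ := this
      _ = _ := by ring
  rcases le_total (2 * C / c) (log z) with h1 | h1
  · obtain ⟨Y, hY⟩ := big z hz h1
    refine ⟨max 1 Y, fun y hy => key (log z) y ?_ ?_ (hY y ((le_max_right _ _).trans hy))⟩
    · have := (le_max_left _ _).trans hy
      have := log_nonneg this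
      positivity
    · have : (log 2)^2 / L1^2 ≤ 1 := by
        rw [div_le_one (by positivity)]
        have := log_two_lt_d9
        gcongr; linarith
      gcongr
  · have hL2 : (2:Real) ≤ exp L1 := by have := add_one_le_exp L1; linarith
    obtain ⟨Y, hY⟩ := big (exp L1) hL2 (by rw [log_exp]; linarith)
    refine ⟨max 1 Y, fun y hy => key L1 y ?_ ?_ ?_⟩
    · have := (le_max_left _ _).trans hy
      have := log_nonneg this
      positivity
    · rw [div_right_comm]
      gcongr
      rw [div_le_one (by have : 0 < log z := by linarith
                         positivity)]
      gcongr
    · have := hY y ((le_max_right _ _).trans hy)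
      rw [log_exp] at this
      refine this.trans (rt_anti ?_ y)
      rw [← exp_log (by linarith : 0 < z)]
      exact exp_le_exp.2 (by linarith)

lemma aD_sum {ξ : Real → Real} {c : Real} (hx : XC ξ c) : ∃ C : Real, 0 < C ∧ ∀ t, 2 ≤ t → ∀ x, SM (fun n => aD t n / (n * (log (t*n))^2)) x ≤ C := by
  obtain ⟨c0, hc0, h⟩ := Phi_lo hx
  refine ⟨4 / c0, by positivity, fun t ht x => ?_⟩
  have h1 : ∀ n : ℕ, ∃ Y : Real, 0 < n → ∀ y, Y ≤ y → c0 / (log (t*n))^2 * (y * log y) ≤ SM (rt (t*n)) y := by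
    intro n
    rcases Nat.eq_zero_or_pos n with h0 | h0
    · exact ⟨0, fun h => by omega⟩
    · have : (1:Real) ≤ n := by exact_mod_cast h0
      obtain ⟨Y, hY⟩ := h (t*n) (by nlinarith)
      exact ⟨Y, fun _ => hY⟩
  choose Y hY using h1
  have ev : ∀ᶠ X : Real in Filter.atTop, exp 1 ≤ X ∧ x ≤ X ∧ ∀ n ∈ Finset.Ioc 0 ⌊x⌋₊, Y n * n ≤ X ∧ (n:Real)^2 ≤ X := by
    refine (Filter.eventually_ge_atTop _).and ((Filter.eventually_ge_atTop _).and ?_)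
    rw [eventually_all_finset]
    exact fun n _ => (eventually_ge_atTop _).and (eventually_ge_atTop _)
  obtain ⟨X, hX1, hX2, hX3⟩ := ev.exists
  have hX0 : 0 < X := (exp_pos 1).trans_le hX1
  have hXl : 1 ≤ log X := by rw [le_log_iff_exp_le hX0]; exact hX1
  have hX11 : 1 ≤ X := by have := add_one_le_exp (1:Real); linarith
  have k1 := tau_le hX11
  rw [dense_id (by linarith : 1 ≤ t)] at k1
  have k2 : c0 / 2 * (X * log X) * SM (fun n => aD t n / (n * (log (t*n))^2)) x ≤ SM (fun n => aD t n * SM (rt (t*n)) (X/n)) X := by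
    have k3 : SM (fun n => aD t n * SM (rt (t*n)) (X/n)) x ≤ SM (fun n => aD t n * SM (rt (t*n)) (X/n)) X :=
      SM_mono (fun n => mul_nonneg (aD_nn _ _) (SM_nn (rt_nn _) _)) hX2
    refine le_trans ?_ k3
    nth_rw 1 [SM]; nth_rw 1 [SM]
    rw [Finset.mul_sum]
    refine Finset.sum_le_sum fun n hn => ?_
    obtain ⟨g1, g2⟩ := hX3 n hn
    rw [Finset.mem_Ioc] at hn
    have hn1 : (1:Real) ≤ n := by exact_mod_cast hn.1
    have hn0 : (0:Real) < n := by linarith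
    have g3 := hY n hn.1 (X/n) (by rw [le_div_iff₀ hn0]; exact g1)
    have g4 : log X / 2 ≤ log (X/n) := by
      rw [log_div hX0.ne' hn0.ne']
      have := log_le_log (by positivity) g2
      rw [log_pow] at this
      push_cast at this; linarith
    have g5 : 0 < log (t*n) := log_pos (by nlinarith)
    have g6 : c0 / (log (t*n))^2 * (X/n * (log X / 2)) ≤ SM (rt (t*n)) (X/n) := by
      refine le_trans ?_ g3
      gcongr
    calc _ = aD t n * (c0 / (log (t*n))^2 * (X/n * (log X / 2))) := by field_simp
      _ ≤ _ := mul_le_mul_of_nonneg_left g6 (aD_nn _ _)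
  set Q := SM (fun n => aD t n / (n * (log (t*n))^2)) x
  have k4 : c0 / 2 * (X * log X) * Q ≤ 2 * (X * log X) := by nlinarith
  have k5 : 0 < X * log X := by positivity
  rw [le_div_iff₀ hc0]
  have : (X * log X) * (c0 * Q) ≤ (X * log X) * 4 := by linarith
  have := le_of_mul_le_mul_left this k5
  linarith

noncomputable def fD (t w : Real) : Real := if w < 1 then 0 else SM (aD t) (exp (log t*(w-1))) * exp (-(log t*(w-1)))

lemma fD_eq {t s : Real} (hs : 1 ≤ s) : SM (aD t) (exp (log t*(s-1))) = fD t s * exp (log t*(s-1)) := by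
  rw [fD, if_neg bL, mul_assoc, ← exp_add]; simp

lemma fD_nn (t s : Real) : 0 ≤ fD t s := by
  unfold fD
  split_ifs
  · linarith
  · exact mul_nonneg (SM_nn (aD_nn t) _) (exp_pos _).le

lemma aD_SM {t y : Real} (hy : 1 ≤ y) : SM (aD t) y ≤ y * (1 + log y) :=
  (Finset.sum_le_sum fun n _ => aD_le t n).trans (tau_le hy)

lemma fD_tr {t s : Real} (ht : 2 ≤ t) (hs : 1 ≤ s) : fD t s ≤ 1 + log t * (s-1) := by
  have h0 : 0 ≤ log t * (s-1) := mul_nonneg (log_nonneg bL) bL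
  have := aD_SM (t := t) (one_le_exp h0)
  rw [fD_eq hs, log_exp, mul_comm] at this
  exact le_of_mul_le_mul_left this (exp_pos _)

lemma fD_LB {t : Real} (ht : 2 ≤ t) : LB (fD t) where
  m := by
    refine Measurable.ite measurableSet_Iio measurable_const ?_
    have := (SM_meas (aD t)).comp (by fun_prop : Measurable fun s : Real => exp (log t*(s-1)))
    exact this.mul (by fun_prop)
  z := fun s hs => by simp [fD, hs]
  b := fun W => by
    have h0 : 0 ≤ log t := log_nonneg bL
    refine ⟨1 + log t * |W|, by positivity, fun s hs => ?_⟩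
    rw [abs_of_nonneg (fD_nn t s)]
    rcases lt_or_ge s 1 with h | h
    · simp only [fD, h]; positivity
    · refine (fD_tr ht h).trans ?_
      gcongr; linarith [le_abs_self W]

lemma wn_eq {t : Real} (ht : 2 ≤ t) {n : ℕ} (hn : 0 < n) : log (t*n) = log t * (1 + log n / log t) := by
  have h0 : 0 < log t := log_pos bL
  rw [log_mul bL (by exact_mod_cast hn.ne')]; field_simp

lemma wn_exp {t : Real} (ht : 2 ≤ t) {n : ℕ} (hn : 0 < n) : exp (-(log t * ((1 + log n / log t) - 1))) = 1 / n := by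
  have h0 : 0 < log t := log_pos bL
  have h1 : (0:Real) < n := bP
  rw [add_sub_cancel_left, mul_div_cancel₀ _ h0.ne', exp_neg, exp_log h1, one_div]

lemma wn_le {t : Real} (ht : 2 ≤ t) {n : ℕ} {U : Real} : n ∈ Finset.Ioc 0 ⌊exp (log t*(U-1))⌋₊ ↔ 0 < n ∧ 1 + log n / log t ≤ U := by
  have h0 : 0 < log t := log_pos bL
  rw [Finset.mem_Ioc]
  refine and_congr_right fun hn => ?_
  have h1 : (0:Real) < n := bP
  rw [Nat.le_floor_iff (exp_pos _).le, ← log_le_iff_le_exp h1, ← le_sub_iff_add_le', div_le_iff₀ h0, mul_comm]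

lemma wn_ge {t : Real} (ht : 2 ≤ t) {n : ℕ} (hn : 0 < n) : 1 ≤ 1 + log n / log t := by
  have h0 : 0 < log t := log_pos bL
  have := log_natCast_nonneg n
  have : 0 ≤ log n / log t := bP
  linarith

lemma f2_ii {t : Real} (ht : 2 ≤ t) {k : ℕ} {a b : Real} (ha : 1 ≤ a) (hab : a ≤ b) : IntervalIntegrable (fun s => fD t s / s^k) volume a b := by
  simp only [div_eq_mul_inv]
  refine ((fD_LB ht).ii a b).mul_continuousOn ?_
  rw [uIcc_of_le hab]
  exact ContinuousOn.inv₀ (by fun_prop) fun s hs => by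
    have : 0 < s := by grind
    positivity

lemma f2_int {ξ : Real → Real} {c : Real} (hx : XC ξ c) : ∃ C : Real, 0 < C ∧ ∀ t, 2 ≤ t → ∀ V, 1 ≤ V → ∫ s in (1:Real)..V, fD t s / s^2 ≤ C * log t := by
  obtain ⟨C, hC, h⟩ := aD_sum hx
  refine ⟨C, hC, fun t ht V hV => ?_⟩
  have h0 : 0 < log t := log_pos bL
  have hc : ContinuousOn (fun s => exp (-(log t*(s-1))) / s^2) (Icc 1 V) := by
    refine ContinuousOn.div (by fun_prop) (by fun_prop) fun s hs => ?_
    have := hs.1; positivity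
  have h1 := abel (aD t) (ω := fun s => exp (-(log t*(s-1))) / s^2) h0 hV (by
    apply ContinuousOn.intervalIntegrable; rwa [uIcc_of_le hV])
  have h2 : ∫ s in 1..V, fD t s / s^2 = ∫ s in 1..V, SM (aD t) (exp (log t*(s-1))) * (exp (-(log t*(s-1))) / s^2) := by
    refine icg fun s hs => ?_
    rw [uIcc_of_le hV] at hs
    have e : exp (log t*(s-1)) * exp (-(log t*(s-1))) = 1 := by rw [← exp_add]; simp
    rw [fD_eq hs.1]
    linear_combination (-(fD t s / s^2)) * e
  rw [h2, ← h1]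
  refine le_trans ?_ (mnr (h t ht (exp (log t*(V-1)))) h0.le)
  unfold SM
  rw [Finset.sum_mul]
  refine Finset.sum_le_sum fun n hn => ?_
  obtain ⟨hn0, hnV⟩ := (wn_le ht).1 hn
  have hw1 := wn_ge ht hn0
  rw [wn_eq ht hn0]
  have e1 := wn_exp ht hn0
  have hn' : 0 < n := by exact_mod_cast hn0
  generalize 1 + log n / log t = W at *
  have g1 : ∫ s in W..V, exp (-(log t*(s-1))) / s^2 ≤ ∫ s in W..V, (1 / W^2 / log t) * (log t * exp (-(log t*(s-1)))) := by
    refine imon hnV ?_ (by apply Continuous.intervalIntegrable; fun_prop) fun s hs => ?_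
    · apply ContinuousOn.intervalIntegrable
      rw [uIcc_of_le hnV]
      exact hc.mono (Icc_subset_Icc_left hw1)
    · have e : (1 / W^2 / log t) * (log t * exp (-(log t*(s-1)))) = exp (-(log t*(s-1))) / W^2 := by field_simp
      rw [e]
      gcongr
      exact hs.1
  have g2 : ∫ s in W..V, log t * exp (-(log t*(s-1))) ≤ 1 / n := by
    rw [← e1]
    have := intervalIntegral.integral_comp_sub_right (a := W) (b := V) (fun s => log t * exp (-(log t*s))) 1
    rw [this, exi]
    have := exp_pos (-(log t*(V-1)))
    linarith
  rw [intervalIntegral.integral_const_mul] at g1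
  have g3 : (1 / W^2 / log t) * (∫ s in W..V, log t * exp (-(log t*(s-1)))) ≤ (1 / W^2 / log t) * (1/n) := by gcongr
  calc aD t n * _ ≤ aD t n * ((1 / W^2 / log t) * (1/n)) := mul_le_mul_of_nonneg_left (g1.trans g3) (aD_nn _ _)
    _ = _ := by field_simp

noncomputable def k1 (ξ : Real → Real) (v : Real) : Real := (2 * ξ (v-2) - ξ (v-1)) / (v-1)

section

variable {ξ : Real → Real} {c p : Real} (h : KD ξ c p)

include h

lemma KD.k1b {v : Real} (hv : 2 ≤ v) : |k1 ξ v - c| ≤ 30 / v := by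
  have hc1 := h.c1
  have hc2 := h.c2
  have hu0 : 0 < v - 1 := bL
  rcases lt_or_ge v 3 with h1 | h1
  · have h2 := abs_le.1 (h.epb (u := v - 1) bL)
    have h3 : 6 / (v-1) ≤ 6 := div_le_self bN bL
    unfold ep at h2
    have h4 : |ξ (v-1)| ≤ 7.3 := by rw [abs_le]; constructor <;> nlinarith
    have h6 : |k1 ξ v| ≤ 7.3 := by
      rw [k1, h.z (v-2) bL, mul_zero, zero_sub, abs_div, abs_neg, abs_of_pos hu0]
      exact (div_le_self (abs_nonneg _) bL).trans h4
    have h7 : 8 ≤ 30 / v := by rw [le_div_iff₀ bL]; linarith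
    grind
  · have h2 := h.epb (u := v - 1) bL
    have h3 := h.epb (u := v - 2) bL
    have e : k1 ξ v - c = (2 * ep ξ c (v-2) - ep ξ c (v-1)) / (v-1) := by
      unfold k1 ep; field_simp; ring
    have h5 : |2 * ep ξ c (v-2) - ep ξ c (v-1)| ≤ 15 := by
      have g1 : 6 / (v-2) ≤ 6 := div_le_self bN bL
      have g2 : 6 / (v-1) ≤ 3 := by rw [div_le_iff₀ hu0]; linarith
      grind
    rw [e, abs_div, abs_of_pos hu0]
    calc _ ≤ 15 / (v-1) := by gcongr
      _ ≤ 30 / v := by rw [div_le_div_iff₀ hu0 bL]; linarith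

lemma KD.kap_d {v : Real} (hv : 2 < v) (h3 : v ≠ 3) : HasDerivAt (kap ξ) (k1 ξ v) v := by
  have := h.d (u := v-1) bL (fun e => h3 bL)
  have := HasDerivAt.comp_sub_const v 1 this
  refine this.congr_deriv ?_
  rw [k1, show v - 1 - 1 = v - 2 by ring]

lemma KD.kap_b {v : Real} (hv : 2 ≤ v) : |kap ξ v| ≤ v + 6 := by
  have h1 := abs_le.1 (h.et_b hv)
  have hc1 := h.c1
  have hc2 := h.c2
  have h2 : 12 / v ≤ 6 := by rw [div_le_iff₀ bL]; linarith
  rw [h.kap_et, abs_le]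
  constructor <;> nlinarith

end

noncomputable def G1 (ξ : Real → Real) (w s : Real) : Real := -(w * k1 ξ (w/s) / s^3 + kap ξ (w/s) / s^2)

section

variable {ξ : Real → Real} {c p : Real} (h : KD ξ c p)

include h

lemma KD.G1_m w : Measurable (G1 ξ w) := by
  have h1 := h.kapLB.m
  have h2 := h.toXI.LB.m
  unfold G1 k1
  fun_prop

lemma KD.G1_as {w s : Real} (hs : 1 ≤ s) (hw : s ≤ w/2) : |-G1 ξ w s - 2 * c * w / s^3| ≤ 40 / s^2 := by
  have hs0 : 0 < s := bL
  have hw0 : 0 < w := bL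
  have hv : 2 ≤ w / s := by rw [le_div_iff₀ hs0]; linarith
  have h1 := h.k1b hv
  have h2 := h.et_b hv
  have hc1 := h.c1
  have hc2 := h.c2
  have e : -G1 ξ w s - 2 * c * w / s^3 = ((w/s) * (k1 ξ (w/s) - c) + et ξ c (w/s) + c) / s^2 := by
    rw [G1, h.kap_et]; field_simp; ring
  rw [e, abs_div, abs_of_pos (by positivity : 0 < s^2)]
  gcongr
  generalize w / s = v at *
  have h3 : |v * (k1 ξ v - c)| ≤ 30 := by
    rw [abs_mul, abs_of_pos (by linarith : 0 < v)]
    calc v * |k1 ξ v - c| ≤ v * (30 / v) := mul_le_mul_of_nonneg_left h1 (by linarith)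
      _ = 30 := mul_div_cancel₀ _ bL
  have h4 : 12 / v ≤ 6 := by rw [div_le_iff₀ bL]; linarith
  rw [abs_le] at *
  constructor <;> linarith

lemma KD.G1_b {w s : Real} (hs : 1 ≤ s) (hw : s ≤ w/2) : |G1 ξ w s| ≤ w + 40 := by
  have h1 := h.G1_as hs hw
  have hc1 := h.c1
  have hc2 := h.c2
  have hw0 : 0 < w := bL
  have h2 : 40 / s^2 ≤ 40 := div_le_self bN (one_le_pow₀ hs)
  have h3 : 2 * c * w / s^3 ≤ 2 * c * w := div_le_self bP (one_le_pow₀ hs)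
  have h4 : 0 ≤ 2 * c * w / s^3 := bP
  have h5 : 2 * c * w ≤ w := by nlinarith
  grind

lemma KD.G_d {w s : Real} (hs : 1 ≤ s) (hw : s < w/2) (h3 : s ≠ w/3) : HasDerivAt (fun s => kap ξ (w/s) / s) (G1 ξ w s) s := by
  have hs0 : s ≠ 0 := bL
  have hw0 : w ≠ 0 := bL
  have h1 : HasDerivAt (fun s : Real => w / s) (-w/s^2) s := by
    have := (hasDerivAt_inv hs0).const_mul w
    grind
  have h2 : HasDerivAt (fun s => kap ξ (w/s)) (k1 ξ (w/s) * (-w/s^2)) s := by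
    have g : HasDerivAt (kap ξ) (k1 ξ (w/s)) (w/s) := by
     refine h.kap_d ?_ ?_
     · rw [lt_div_iff₀ bL]; linarith
     grind
    exact HasDerivAt.comp (h := fun s : Real => w/s) s g h1
  refine (h2.div (hasDerivAt_id s) hs0).congr_deriv ?_
  simp only [G1, id]; field_simp; ring

lemma KD.G_c {w : Real} : ContinuousOn (fun s => kap ξ (w/s) / s) (Icc 1 (w/2)) := by
  refine ContinuousOn.div ?_ continuousOn_id fun s hs => by have := hs.1; exact (by linarith : (0:Real) < s).ne'
  unfold kap
  refine h.cont.comp ?_ fun s hs => ?_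
  · refine ContinuousOn.sub (ContinuousOn.div continuousOn_const continuousOn_id fun s hs => by have := hs.1; exact (by linarith : (0:Real) < s).ne') continuousOn_const
  · have := hs.1
    have : 2 ≤ w / s := by rw [le_div_iff₀ bL]; linarith [hs.2]
    grind

lemma KD.G1_ii {w a b : Real} (ha : 1 ≤ a) (hab : a ≤ b) (hb : b ≤ w/2) : IntervalIntegrable (G1 ξ w) volume a b := by
  rw [intervalIntegrable_iff, uIoc_of_le hab]
  refine Measure.integrableOn_of_bounded (M := w + 40) (by simp) (h.G1_m w).aestronglyMeasurable ?_
  exact (ari measurableSet_Ioc).2 (Eventually.of_forall fun s hs => h.G1_b (by linarith [hs.1]) (hs.2.trans hb))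

noncomputable def KS (ξ : Real → Real) (t w : Real) : Real := SM (fun n => aD t n / n * (kap ξ (w / (1 + log n / log t)) / (log t * (1 + log n / log t)))) (exp (log t * (w-1)))

omit h in
lemma KS_lt (hx : XI ξ) {t w : Real} (ht : 2 ≤ t) (hw : w < 2) : KS ξ t w = 0 := by
  rw [KS, SM]
  refine Finset.sum_eq_zero fun n hn => ?_
  obtain ⟨hn0, _⟩ := (wn_le ht).1 hn
  have h1 := wn_ge ht hn0
  rw [kap, hx.z]
  · simp
  · have : w / (1 + log n / log t) < 2 := by rw [div_lt_iff₀ bL]; linarith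
    linarith

lemma KD.KS_eq {t w : Real} (ht : 2 ≤ t) (hw : 2 ≤ w) : KS ξ t w = MC (kap ξ) (fD t) w + 1 / log t * (fD t (w/2) * (4 / w) - ∫ s in (1:Real)..(w/2), fD t s * G1 ξ w s) := by
  have h0 : 0 < log t := log_pos (by linarith)
  set l := log t with hl
  set U := w/2 with hU
  have hU1 : 1 ≤ U := by linarith
  have hr : KS ξ t w = SM (fun n => aD t n / n * (kap ξ (w / (1 + log n / l)) / (l * (1 + log n / l)))) (exp (l * (U-1))) := by
    rw [KS, SM, SM]
    symm
    refine Finset.sum_subset (Finset.Ioc_subset_Ioc_right (Nat.floor_mono (exp_le_exp.2 (by nlinarith)))) fun n hn hn' => ?_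
    obtain ⟨hn0, _⟩ := (wn_le ht).1 hn
    rw [hl, wn_le ht, not_and, not_le] at hn'
    have h1 := wn_ge ht hn0
    have h2 := hn' hn0
    rw [kap, h.z]
    · simp
    · have : w / (1 + log n / log t) < 2 := by rw [div_lt_iff₀ (by linarith)]; linarith
      linarith
  set E : Real → Real := fun s => exp (-(l*(s-1))) with hE
  have hEd : ∀ s, HasDerivAt E (-l * E s) s := by
    intro s
    have := ((((hasDerivAt_id s).sub_const 1).const_mul l).neg).exp
    refine this.congr_deriv ?_
    simp [hE, mul_comm]
  have hEc : Continuous E := by fun_prop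
  set G : Real → Real := fun s => kap ξ (w/s) / s with hG
  set H1 : Real → Real := fun s => (1/l * G1 ξ w s - G s) * E s with hH1
  have hGc : ContinuousOn G (Set.Icc 1 U) := h.G_c
  have hH1i : ∀ a, 1 ≤ a → a ≤ U → IntervalIntegrable H1 volume a U := by
    intro a ha haU
    refine IntervalIntegrable.mul_continuousOn ?_ hEc.continuousOn
    refine ((h.G1_ii ha haU le_rfl).const_mul _).sub ?_
    apply ContinuousOn.intervalIntegrable
    rw [Set.uIcc_of_le haU]
    exact hGc.mono (Set.Icc_subset_Icc_left ha)
  have ftc : ∀ a, 1 ≤ a → a ≤ U → ∫ s in a..U, H1 s = 1/l * (G U * E U) - 1/l * (G a * E a) := by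
    intro a ha haU
    refine integral_eq_of_hasDerivAt_off_countable_of_le (fun s => 1/l * (G s * E s)) H1 haU (s := {w/3}) (Set.countable_singleton _) ?_ ?_ (hH1i a ha haU)
    · exact continuousOn_const.mul ((hGc.mono (Set.Icc_subset_Icc_left ha)).mul hEc.continuousOn)
    · intro s hs
      have g := h.G_d (w := w) (s := s) (by linarith [hs.1.1]) hs.1.2 hs.2
      refine ((g.mul (hEd s)).const_mul (1/l)).congr_deriv ?_
      grind
  have hab := abel (aD t) (c := 1) (U := U) (ω := H1) h0 hU1 (hH1i 1 le_rfl hU1)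
  have h3 : SM (fun n => aD t n * ∫ s in (1 + log n / l)..U, H1 s) (exp (l * (U-1))) = 1/l * (G U * E U) * SM (aD t) (exp (l*(U-1))) - KS ξ t w := by
    rw [hr]
    simp only [SM]
    rw [Finset.mul_sum, ← Finset.sum_sub_distrib]
    refine Finset.sum_congr rfl fun n hn => ?_
    obtain ⟨hn0, hnU⟩ := (wn_le ht).1 hn
    rw [ftc _ (wn_ge ht hn0) hnU]
    have e := wn_exp ht hn0
    grind
  have h4 : ∫ s in (1:Real)..U, SM (aD t) (exp (l*(s-1))) * H1 s = 1/l * (∫ s in (1:Real)..U, fD t s * G1 ξ w s) - ∫ s in (1:Real)..U, fD t s * G s := by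
    have i1 : IntervalIntegrable (fun s => fD t s * G1 ξ w s) volume 1 U := by
      obtain ⟨C, hC0, hC⟩ := (fD_LB ht).b U
      rw [intervalIntegrable_iff, Set.uIoc_of_le hU1]
      refine Measure.integrableOn_of_bounded (M := C * (w + 40)) (by simp) ((fD_LB ht).m.mul (h.G1_m w)).aestronglyMeasurable ?_
      refine (ae_restrict_iff' measurableSet_Ioc).2 (Filter.Eventually.of_forall fun s hs => ?_)
      rw [norm_mul]
      exact mul_le_mul (hC s hs.2) (h.G1_b hs.1.le hs.2) (abs_nonneg _) hC0
    have i2 : IntervalIntegrable (fun s => fD t s * G s) volume 1 U :=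
      ((fD_LB ht).ii 1 U).mul_continuousOn (by rw [Set.uIcc_of_le hU1]; exact hGc)
    rw [← intervalIntegral.integral_const_mul, ← intervalIntegral.integral_sub (i1.const_mul _) i2]
    refine intervalIntegral.integral_congr fun s hs => ?_
    rw [Set.uIcc_of_le hU1] at hs
    simp only [hH1]
    rw [fD_eq hs.1]
    have e : exp (l*(s-1)) * E s = 1 := by simp only [hE]; rw [← exp_add]; simp
    grind
  have h5 : MC (kap ξ) (fD t) w = ∫ s in (1:Real)..U, fD t s * G s := by
    rw [MC_comm _ _ (by linarith), h.MChalf (fD_LB ht) (by linarith), intervalIntegral.integral_of_le hU1, integral_Ioc_eq_integral_Ioo]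
    simp only [hG, mul_div_assoc]
    rfl
  have hGU : G U = 4 / w := by
    have : w / U = 2 := by grind
    simp only [hG]
    rw [this, kap, show (2:Real) - 1 = 1 by norm_num]
    have h1 := h.e 1 le_rfl
    rw [h.LB.int0 (by norm_num)] at h1
    grind
  have hEU : exp (l*(U-1)) * E U = 1 := by simp only [hE]; rw [← exp_add]; simp
  rw [h3, h4, fD_eq hU1, ← h5, hGU] at hab
  grind

end

lemma log2h {t : Real} (ht : 2 ≤ t) : 1/2 < log t := by
  have := log_two_gt_d9
  have := log_le_log bN ht
  linarith

lemma KD.KS_as {ξ : Real → Real} {c p : Real} (h : KD ξ c p) : ∃ C : Real, 0 < C ∧ ∀ t, 2 ≤ t → ∃ I, |I| ≤ C ∧ ∀ w, 1 ≤ w → |KS ξ t w - MC (kap ξ) (fD t) w - I * w| ≤ C := by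
  obtain ⟨C, hC, h2⟩ := f2_int h.toXC
  have hc1 := h.c1
  have hc2 := h.c2
  refine ⟨42 * C + 6, by positivity, fun t ht => ?_⟩
  have hl := log2h ht
  specialize h2 t ht
  set l := log t with hl'
  set F : Real → Real := fun V => ∫ s in 1..V, fD t s / s^3 with hF
  have nn : ∀ k s, 1 ≤ s → 0 ≤ fD t s / s^k := fun k s hs => div_nonneg (fD_nn _ _) bP
  have hst : ∀ V W, 1 ≤ V → V ≤ W → 0 ≤ F W - F V ∧ F W - F V ≤ C * l / V := by
    intro V W hV hW
    have e : F W - F V = ∫ s in V..W, fD t s / s^3 := intervalIntegral.integral_interval_sub_left (f2_ii ht le_rfl (hV.trans hW)) (f2_ii ht le_rfl hV)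
    have e2 : (∫ s in 1..V, fD t s / s^2) + ∫ s in V..W, fD t s / s^2 = ∫ s in 1..W, fD t s / s^2 := iadj (f2_ii ht le_rfl hV) (f2_ii ht hV hW)
    have e3 : 0 ≤ ∫ s in 1..V, fD t s / s^2 := inn hV fun s hs => nn 2 s hs.1
    rw [e]
    refine ⟨inn hW fun s hs => nn 3 s (hV.trans hs.1), ?_⟩
    calc _ ≤ ∫ s in V..W, (1/V) * (fD t s / s^2) := by
          refine imon hW (f2_ii ht hV hW) ((f2_ii ht hV hW).const_mul _) fun s hs => ?_
          have hs1 : 0 < s := by grind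
          have : fD t s / s^3 = (1/s) * (fD t s / s^2) := by field_simp
          rw [this]
          exact mnr (one_div_le_one_div_of_le bL hs.1) (nn 2 s (hV.trans hs.1))
      _ = (1/V) * ∫ s in V..W, fD t s / s^2 := icm _ _
      _ ≤ (1/V) * (C * l) := by
          refine mul_le_mul_of_nonneg_left ?_ (by positivity)
          linarith [h2 W (hV.trans hW)]
      _ = _ := by ring
  set J := sSup (F '' Set.Ici 1) with hJ
  have hF1 : F 1 = 0 := by simp [hF]
  have hbd : BddAbove (F '' Set.Ici 1) := by
    refine ⟨C * l / 1, ?_⟩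
    rintro _ ⟨W, hW, rfl⟩
    have := hst 1 W le_rfl hW
    linarith [this.2]
  have hJF : ∀ V, 1 ≤ V → 0 ≤ J - F V ∧ J - F V ≤ C * l / V := by
    intro V hV
    constructor
    · linarith [le_csSup hbd ⟨V, hV, rfl⟩]
    · have : J ≤ F V + C * l / V := by
        refine csSup_le ⟨_, 1, Set.self_mem_Ici, rfl⟩ ?_
        rintro _ ⟨W, hW, rfl⟩
        rcases le_total V W with g | g
        · linarith [(hst V W hV g).2]
        · have : 0 ≤ C * l / V := by positivity
          linarith [(hst W V hW g).1]
      linarith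
  have hJ1 := hJF 1 le_rfl
  rw [hF1, div_one, sub_zero] at hJ1
  have hI0 : 0 ≤ 2 * c / l * J := by have := hJ1.1; positivity
  have hI1 : 2 * c / l * J ≤ C := by
    calc 2 * c / l * J ≤ 2 * c / l * (C * l) := mul_le_mul_of_nonneg_left hJ1.2 (by positivity)
      _ = 2 * c * C := by field_simp
      _ ≤ C := by nlinarith
  refine ⟨2 * c / l * J, by rw [abs_of_nonneg hI0]; linarith, fun w hw => ?_⟩
  rcases lt_or_ge w 2 with hw2 | hw2
  · rw [KS_lt h.toXI ht hw2, MC_comm _ _ (by linarith), h.MChalf (fD_LB ht) hw, Set.Ioo_eq_empty (by linarith)]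
    simp only [Measure.restrict_empty, integral_zero_measure, sub_zero, zero_sub, abs_neg]
    rw [abs_of_nonneg (by positivity)]
    nlinarith
  · rw [h.KS_eq ht hw2]
    set U := w/2 with hU
    have hU1 : 1 ≤ U := by rw [hU]; linarith
    have hUw : w = 2 * U := by rw [hU]; ring
    have i1 : IntervalIntegrable (fun s => fD t s * G1 ξ w s) volume 1 U := by
      obtain ⟨C, hC0, hC⟩ := (fD_LB ht).b U
      rw [intervalIntegrable_iff, Set.uIoc_of_le hU1]
      refine Measure.integrableOn_of_bounded (M := C * (w + 40)) (by simp) ((fD_LB ht).m.mul (h.G1_m w)).aestronglyMeasurable ?_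
      refine (ae_restrict_iff' measurableSet_Ioc).2 (Filter.Eventually.of_forall fun s hs => ?_)
      rw [norm_mul]
      exact mul_le_mul (hC s hs.2) (h.G1_b hs.1.le hs.2) (abs_nonneg _) hC0
    have b1 : |-(∫ s in (1:Real)..U, fD t s * G1 ξ w s) - 2 * c * w * F U| ≤ 40 * (C * l) := by
      have e : -(∫ s in (1:Real)..U, fD t s * G1 ξ w s) - 2 * c * w * F U = ∫ s in (1:Real)..U, fD t s * (-G1 ξ w s - 2 * c * w / s^3) := by
        rw [hF, ← intervalIntegral.integral_const_mul, ← intervalIntegral.integral_neg, ← intervalIntegral.integral_sub (f := fun s => -(fD t s * G1 ξ w s)) i1.neg ((f2_ii ht le_rfl hU1).const_mul _)]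
        refine intervalIntegral.integral_congr fun s _ => ?_
        ring
      rw [e]
      refine le_trans ?_ (mul_le_mul_of_nonneg_left (h2 U hU1) (by norm_num))
      rw [← intervalIntegral.integral_const_mul, ← Real.norm_eq_abs]
      refine intervalIntegral.norm_integral_le_of_norm_le hU1 (Filter.Eventually.of_forall fun s hs => ?_) ((f2_ii ht le_rfl hU1).const_mul _)
      rw [norm_mul, Real.norm_eq_abs, Real.norm_eq_abs, abs_of_nonneg (fD_nn _ _)]
      calc _ ≤ fD t s * (40 / s^2) := mul_le_mul_of_nonneg_left (h.G1_as hs.1.le hs.2) (fD_nn _ _)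
        _ = _ := by ring
    have b2 : 0 ≤ 2 * c * w * (J - F U) ∧ 2 * c * w * (J - F U) ≤ 2 * (C * l) := by
      have g := hJF U hU1
      have hw0 : 0 ≤ 2 * c * w := by positivity
      refine ⟨mul_nonneg hw0 g.1, ?_⟩
      calc _ ≤ 2 * c * w * (C * l / U) := mul_le_mul_of_nonneg_left g.2 hw0
        _ = 4 * c * (C * l) := by rw [hUw]; field_simp; norm_num
        _ ≤ _ := by
          have : 0 < C * l := by positivity
          nlinarith
    have b3 : 0 ≤ fD t U * (4 / w) ∧ fD t U * (4 / w) ≤ 6 * l := by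
      have := fD_nn t U
      refine ⟨by positivity, ?_⟩
      calc _ ≤ (1 + l * (U-1)) * (4 / w) := mul_le_mul_of_nonneg_right (fD_tr ht hU1) (by positivity)
        _ ≤ 6 * l := by
          rw [mul_div_assoc', div_le_iff₀ (by linarith), hUw]
          nlinarith
    have e : MC (kap ξ) (fD t) w + 1 / l * (fD t U * (4 / w) - ∫ s in (1:Real)..U, fD t s * G1 ξ w s) - MC (kap ξ) (fD t) w - 2 * c / l * J * w
        = (fD t U * (4 / w) + (-(∫ s in (1:Real)..U, fD t s * G1 ξ w s) - 2 * c * w * F U) - 2 * c * w * (J - F U)) / l := by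
      field_simp; ring
    rw [e, abs_div, abs_of_pos (by linarith : 0 < l), div_le_iff₀ (by linarith)]
    rw [abs_le] at *
    constructor <;> linarith [b1.1, b1.2, b2.1, b2.2, b3.1, b3.2]

lemma err2 {t x : Real} (ht : 2 ≤ t) (hx : 1 ≤ x) : SM (fun n => aD t n * (if t * n ≤ x / n then t * n / log (t * n) else 0)) x ≤ 48 * x := by
  set y := √(x/t) with hy
  set V := √(x*t) with hV
  have hVy : V * y = x := by
    rw [hV, hy, ← sqrt_mul bP, show x * t * (x/t) = x^2 by field_simp, sqrt_sq bL]
  have hVt : V = t * y := by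
    have hs : √x * √x = x := mul_self_sqrt bL
    rw [hV, hy, sqrt_mul bL, sqrt_div bL]
    have : √t * √t = t := mul_self_sqrt bL
    have h0 : 0 < √t := sqrt_pos.2 bL
    field_simp
    linear_combination this
  have key : ∀ n : ℕ, 0 < n → t * n ≤ x / n → n ≤ y := by
    intro n hn h
    have hn' : (0:Real) < n := by exact_mod_cast hn
    apply le_sqrt_of_sq_le
    rw [le_div_iff₀ hn'] at h
    rw [le_div_iff₀ (by linarith)]
    linarith
  rcases lt_or_ge y 1 with hy1 | hy1
  · have : SM (fun n => aD t n * (if t * n ≤ x / n then t * n / log (t * n) else 0)) x = 0 := by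
      refine Finset.sum_eq_zero fun n hn => ?_
      have hn0 := (Finset.mem_Ioc.1 hn).1
      rw [if_neg, mul_zero]
      intro h
      have := key n hn0 h
      have : (1:Real) ≤ n := by exact_mod_cast hn0
      linarith
    rw [this]; linarith
  · have hV2 : 2 ≤ V := by rw [hVt]; nlinarith
    have hlV := log2h hV2
    set K := 16 * V / log V with hK
    have hK0 : 0 ≤ K := by positivity
    have h1 : SM (fun n => aD t n * (if t * n ≤ x / n then t * n / log (t * n) else 0)) x ≤ K * SM (aD t) y := by
      unfold SM
      rw [Finset.mul_sum]
      have hyx : y ≤ x := by rw [← hVy]; nlinarith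
      have hs : Finset.Ioc 0 ⌊y⌋₊ ⊆ Finset.Ioc 0 ⌊x⌋₊ := Finset.Ioc_subset_Ioc_right (Nat.floor_mono hyx)
      rw [← Finset.sum_subset hs]
      · refine Finset.sum_le_sum fun n hn => ?_
        have hn0 := (Finset.mem_Ioc.1 hn).1
        have hny : (n:Real) ≤ y := (Nat.le_floor_iff (by linarith)).1 (Finset.mem_Ioc.1 hn).2
        have hn1 : (1:Real) ≤ n := by exact_mod_cast hn0
        rw [mul_comm K]
        refine mul_le_mul_of_nonneg_left ?_ (aD_nn _ _)
        split_ifs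
        · have ht2 : 2 ≤ t * n := by nlinarith
          have htV : t * n ≤ V := by rw [hVt]; gcongr
          have g := x_log_sq ht2 htV
          have gl := log2h ht2
          have gm := log_le_log (by linarith) htV
          calc t * n / log (t*n) = t * n / (log (t*n))^2 * log (t*n) := by field_simp
            _ ≤ 16 * (V / (log V)^2) * log V := mul_le_mul g gm (by linarith) (by positivity)
            _ = K := by rw [hK]; field_simp
        · exact hK0
      · intro n hn hn'
        have hn0 := (Finset.mem_Ioc.1 hn).1
        rw [if_neg, mul_zero]
        intro h
        exact hn' (Finset.mem_Ioc.2 ⟨hn0, Nat.le_floor (key n hn0 h)⟩)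
    refine h1.trans ((mul_le_mul_of_nonneg_left (aD_SM hy1) hK0).trans ?_)
    have gm : log y ≤ log V := log_le_log (by linarith) (by rw [hVt]; nlinarith)
    have e : K * (y * (1 + log y)) = 16 * x * ((1 + log y) / log V) := by rw [hK, ← hVy]; field_simp
    rw [e]
    have : (1 + log y) / log V ≤ 3 := by rw [div_le_iff₀ (by linarith)]; linarith
    nlinarith

lemma dense_as {ξ : Real → Real} {c : Real} (hx : XC ξ c) : ∃ C : Real, 0 < C ∧ ∃ b : Real → Real, (∀ z, 2 ≤ z → |b z| ≤ C / (log z)^3) ∧ ∀ t, 2 ≤ t → ∀ w, 1 ≤ w →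
    |fD t w + KS ξ t w + SM (fun n => aD t n / n * b (t*n) * (log t * w - log (t*n))) (exp (log t * (w-1))) - log t * (w-1)| ≤ C := by
  obtain ⟨C, hC, b, hb, hP⟩ := Phi_as hx.toXI
  obtain ⟨C1, hC1, hS⟩ := aD_sum hx
  refine ⟨C * (C1 + 49) + 1, by positivity, b, fun z hz => (hb z hz).trans ?_, fun t ht w hw => ?_⟩
  · have := log2h hz
    gcongr
    nlinarith
  have hl := log2h ht
  have hX : 0 ≤ log t * (w-1) := mul_nonneg bL bL
  set l := log t with hl'
  set x := exp (l * (w-1)) with hxd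
  have hx1 : 1 ≤ x := one_le_exp hX
  have hlx : log x = l * (w-1) := log_exp _
  set B := SM (fun n => aD t n / n * b (t*n) * (l * w - log (t*n))) x with hB
  have h1 := dense_id (by linarith : 1 ≤ t) x
  have h2 : |SM tu x - SM (aD t) x - x * KS ξ t w - x * B| ≤ C * (x * C1 + 48 * x) := by
    have g : SM tu x - SM (aD t) x - x * KS ξ t w - x * B = SM (fun n => aD t n * (SM (rt (t*n)) (x/n) - 1 - (x/n) * ξ (log (x/n) / log (t*n)) / log (t*n) - b (t*n) * ((x/n) * log (x/n)))) x := by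
      rw [h1, hB, KS]
      simp only [SM]
      rw [Finset.mul_sum, Finset.mul_sum, ← Finset.sum_sub_distrib, ← Finset.sum_sub_distrib, ← Finset.sum_sub_distrib]
      refine Finset.sum_congr rfl fun n hn => ?_
      have hn0 := (Finset.mem_Ioc.1 hn).1
      have hn' : (0:Real) < n := by exact_mod_cast hn0
      have e1 : log (x/n) = l * w - log (t*n) := by
        rw [log_div bL hn'.ne', log_mul bL hn'.ne', hlx]; ring
      have e2 := wn_eq ht hn0
      have h3 := wn_ge ht hn0
      rw [e1, kap]
      rw [e2, ← hl'] at *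
      rw [← hl'] at h3
      generalize 1 + log n / l = W at *
      have e3 : (l * w - l * W) / (l * W) = w / W - 1 := by field_simp
      rw [e3]
      generalize ξ (w / W - 1) = X
      field_simp
    rw [g]
    have e2 := err2 ht hx1
    have e3 := hS t ht x
    refine le_trans ?_ (mnl (add_le_add (mul_le_mul_of_nonneg_left e3 (by linarith)) e2) hC.le)
    simp only [SM]
    refine (Finset.abs_sum_le_sum_abs _ _).trans ?_
    rw [Finset.mul_sum, ← Finset.sum_add_distrib, Finset.mul_sum]
    refine Finset.sum_le_sum fun n hn => ?_
    have hn0 := (Finset.mem_Ioc.1 hn).1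
    have hn1 : (1:Real) ≤ n := by exact_mod_cast hn0
    have hnx : (n:Real) ≤ x := (Nat.le_floor_iff (by linarith)).1 (Finset.mem_Ioc.1 hn).2
    have := hP (t*n) (by nlinarith) (x/n) (by rw [le_div_iff₀ (by linarith)]; linarith)
    rw [abs_mul, abs_of_nonneg (aD_nn t n)]
    refine (mul_le_mul_of_nonneg_left this (aD_nn t n)).trans (le_of_eq ?_)
    generalize (if t * (n:Real) ≤ x / n then t * n / log (t * n) else 0) = X
    field_simp
  have h3 := tau_le hx1
  have h4 := tau_ge hx1
  rw [hlx] at h3 h4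
  have h5 := fD_eq (t := t) hw
  rw [← hl', ← hxd] at h5
  rw [h5] at h2
  have e : fD t w + KS ξ t w + B - l * (w-1) = -((SM tu x - fD t w * x - x * KS ξ t w - x * B) - (SM tu x - x * (l * (w-1)))) / x := by
    field_simp; ring
  rw [e, abs_div, abs_neg, abs_of_pos (by linarith : 0 < x), div_le_iff₀ (by linarith)]
  rw [abs_le] at *
  have : 0 < C * x := by positivity
  constructor <;> nlinarith [h2.1, h2.2]

lemma b_as {C C1 t : Real} (hC : 0 < C) (hC1 : 0 < C1) (b : Real → Real) (hb : ∀ z, 2 ≤ z → |b z| ≤ C / (log z)^3) (ht : 2 ≤ t)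
    (hS : ∀ x, SM (fun n => aD t n / (n * (log (t*n))^2)) x ≤ C1) :
    ∃ I, |I| ≤ C * C1 ∧ ∀ w, 1 ≤ w → |SM (fun n => aD t n / n * b (t*n) * (log t * w - log (t*n))) (exp (log t * (w-1))) - I * w| ≤ C * C1 := by
  have hl := log2h ht
  set h : ℕ → Real := fun n => aD t n / (n * (log (t*n))^2) with hh
  set d : ℕ → Real := fun n => aD t n / n * b (t*n) with hd
  have h_nn : ∀ n, 0 ≤ h n := fun n => div_nonneg (aD_nn _ _) bP
  have hr : ∀ n, ∑ i ∈ Finset.range n, h i ≤ C1 := by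
    intro n
    have e : SM h n = ∑ i ∈ Finset.range (n+1), h i := by
      rw [SM, Nat.floor_natCast, Finset.range_eq_Ico, Finset.sum_eq_sum_Ico_succ_bot (by omega)]
      simp only [hh, Nat.cast_zero, zero_mul, div_zero, zero_add]
      rfl
    have := hS n
    rw [e, Finset.sum_range_succ] at this
    linarith [h_nn n]
  have hs : Summable h := summable_of_sum_range_le h_nn hr
  have hts : ∑' n, h n ≤ C1 := Real.tsum_le_of_sum_range_le h_nn hr
  have hdl : ∀ n : ℕ, 0 < n → |d n| * log (t*n) ≤ C * h n ∧ log t ≤ log (t*n) := by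
    intro n hn
    have hn1 : (1:Real) ≤ n := by exact_mod_cast hn
    have h2 : 2 ≤ t * n := by nlinarith
    have g := log2h h2
    refine ⟨?_, log_le_log (by linarith) (by nlinarith)⟩
    have := aD_nn t n
    calc |d n| * log (t*n) = aD t n / n * |b (t*n)| * log (t*n) := by
          simp only [hd]; rw [abs_mul, abs_of_nonneg (by positivity : 0 ≤ aD t n / n)]
      _ ≤ aD t n / n * (C / (log (t*n))^3) * log (t*n) := by
          refine mul_le_mul_of_nonneg_right (mul_le_mul_of_nonneg_left (hb _ h2) (by positivity)) (by linarith)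
      _ = C * h n := by simp only [hh]; field_simp
  have d0 : d 0 = 0 := by simp [hd]
  have hdb : ∀ n, |log t * d n| ≤ C * h n := by
    intro n
    rcases Nat.eq_zero_or_pos n with rfl | hn
    · rw [d0]; simp only [mul_zero, abs_zero]; exact mul_nonneg hC.le (h_nn _)
    · obtain ⟨g1, g2⟩ := hdl n hn
      rw [abs_mul, abs_of_pos (by linarith : 0 < log t), mul_comm]
      exact (mul_le_mul_of_nonneg_left g2 (abs_nonneg _)).trans g1
  have hCs : HasSum (fun n => C * h n) (C * ∑' n, h n) := hs.hasSum.mul_left C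
  have hds : Summable fun n => log t * d n := Summable.of_norm_bounded hCs.summable hdb
  have hI := (tsum_of_norm_bounded (f := fun n => log t * d n) hCs hdb).trans (mul_le_mul_of_nonneg_left hts hC.le)
  refine ⟨∑' n, log t * d n, hI, fun w hw => ?_⟩
  set x := exp (log t * (w-1)) with hx
  set F : ℕ → Real := fun n => if n ∈ Finset.Ioc 0 ⌊x⌋₊ then d n * (log t * w - log (t*n)) else 0 with hF
  have hF0 : ∀ n ∉ Finset.Ioc 0 ⌊x⌋₊, F n = 0 := fun n hn => if_neg hn
  have e1 : SM (fun n => aD t n / n * b (t*n) * (log t * w - log (t*n))) x = ∑' n, F n := by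
    rw [tsum_eq_sum hF0, SM]
    exact Finset.sum_congr rfl fun n hn => (if_pos hn).symm
  have hFs : Summable F := summable_of_ne_finset_zero hF0
  rw [e1, ← tsum_mul_right, ← hFs.tsum_sub (hds.mul_right w)]
  refine (tsum_of_norm_bounded (f := fun n => F n - log t * d n * w) hCs fun n => ?_).trans (mul_le_mul_of_nonneg_left hts hC.le)
  rw [Real.norm_eq_abs]
  simp only [hF]
  split_ifs with hn
  · have hn0 := (Finset.mem_Ioc.1 hn).1
    obtain ⟨g1, g2⟩ := hdl n hn0
    rw [show d n * (log t * w - log (t*n)) - log t * d n * w = -(d n * log (t*n)) by ring, abs_neg, abs_mul, abs_of_pos (by linarith : 0 < log (t*n))]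
    exact g1
  · rcases Nat.eq_zero_or_pos n with rfl | hn0
    · rw [d0]; simp only [mul_zero, zero_mul, sub_zero, abs_zero]; exact mul_nonneg hC.le (h_nn _)
    · obtain ⟨g1, g2⟩ := hdl n hn0
      rw [hx, wn_le ht, not_and, not_le] at hn
      have g3 := hn hn0
      have g4 : log t * w ≤ log (t*n) := by
        rw [wn_eq ht hn0]; exact mul_le_mul_of_nonneg_left g3.le (by linarith)
      rw [show 0 - log t * d n * w = -(d n * (log t * w)) by ring, abs_neg, abs_mul, abs_of_pos (by nlinarith : 0 < log t * w)]
      exact (mul_le_mul_of_nonneg_left g4 (abs_nonneg _)).trans g1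

lemma KD.main_eq {ξ : Real → Real} {c p : Real} (h : KD ξ c p) : ∃ M : Real, 0 ≤ M ∧ ∀ t, 2 ≤ t → ∃ β, |β| ≤ M ∧ ∀ w, 1 ≤ w →
    |fD t w + MC (kap ξ) (fD t) w - log t * (w-1) - β * w| ≤ M := by
  obtain ⟨C, hC, hK⟩ := h.KS_as
  obtain ⟨C2, hC2, b, hb, hD⟩ := dense_as h.toXC
  obtain ⟨C1, hC1, hS⟩ := aD_sum h.toXC
  refine ⟨C + C2 + C2 * C1, by positivity, fun t ht => ?_⟩
  obtain ⟨I, hI, hIw⟩ := hK t ht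
  obtain ⟨J, hJ, hJw⟩ := b_as hC2 hC1 b hb ht (hS t ht)
  refine ⟨-I - J, ?_, fun w hw => ?_⟩
  · rw [abs_le] at *
    constructor <;> linarith [hI.2]
  · have a1 := abs_le.1 (hIw w hw)
    have a2 := abs_le.1 (hJw w hw)
    have a3 := abs_le.1 (hD t ht w hw)
    rw [abs_le]
    constructor <;> linarith [a1.2]

lemma IsDense.two {n k : ℕ} {t : Real} (h : IsDense n t) (hk : t ≤ 2^k) : IsDense (2^k*n) 2 := by
  obtain ⟨hn, hd⟩ := h
  refine ⟨by positivity, fun d hdv hlt => ?_⟩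
  have hd0 : 0 < d := Nat.pos_of_dvd_of_pos hdv bP
  by_cases h2 : 2 * d ∣ 2^k*n
  · exact ⟨2*d, h2, by omega, by push_cast; exact le_rfl⟩
  obtain ⟨q, hq⟩ := hdv
  have hq2 : ¬ 2 ∣ q := by
    rintro ⟨r, rfl⟩
    exact h2 ⟨r, by rw [hq]; ring⟩
  have hco : Nat.Coprime (2^k) q := Nat.Coprime.pow_left k ((Nat.Prime.coprime_iff_not_dvd Nat.prime_two).2 hq2)
  have : 2^k ∣ d := hco.dvd_of_dvd_mul_right (hq ▸ Dvd.intro n rfl)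
  obtain ⟨m, rfl⟩ := this
  have hmn : n = m * q := by
    have : 2^k * n = 2^k * (m*q) := by rw [hq]; ring
    exact Nat.eq_of_mul_eq_mul_left bP this
  obtain ⟨e, he, hme, het⟩ := hd m ⟨q, hmn⟩ (Nat.lt_of_mul_lt_mul_left hlt)
  have hex : ∃ j, 2^k*m < 2^j*e := ⟨k, Nat.mul_lt_mul_of_pos_left hme bP⟩
  classical
  set j := Nat.find hex with hj
  have h1 : 2^k*m < 2^j*e := Nat.find_spec hex
  have h3 : j ≤ k := Nat.find_min' hex (Nat.mul_lt_mul_of_pos_left hme bP)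
  have hek : (e:Real) ≤ 2^k * m := het.trans (mnr hk bP)
  have hek' : e ≤ 2^k * m := by exact_mod_cast hek
  have hj0 : j ≠ 0 := by
    intro h0; rw [h0] at h1; simp at h1; omega
  obtain ⟨i, hi⟩ := Nat.exists_eq_succ_of_ne_zero hj0
  have h4 : ¬ 2^k*m < 2^i*e := Nat.find_min hex (by omega)
  refine ⟨2^j*e, Nat.mul_dvd_mul (pow_dvd_pow 2 h3) he, h1, ?_⟩
  have h5 : 2^j*e ≤ 2*(2^k*m) := by
    rw [hi, Nat.succ_eq_add_one, pow_succ]; push Not at h4; linarith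
  exact_mod_cast h5

lemma IsDense.mono {n : ℕ} {t s : Real} (h : IsDense n t) (hk : t ≤ s) : IsDense n s := by
  refine ⟨h.1, fun d hd hl => ?_⟩
  obtain ⟨e, h1, h2, h3⟩ := h.2 d hd hl
  exact ⟨e, h1, h2, h3.trans (mnr hk bP)⟩

lemma T_comp {t t0 y : Real} {k : ℕ} (ht : 2 ≤ t) (hk : t0 ≤ 2^k) (hy : 0 ≤ y) : SM (aD t0) y ≤ SM (aD t) (2^k*y) := by
  unfold SM
  have hinj : InjOn (fun n : ℕ => 2^k*n) (Finset.Ioc 0 ⌊y⌋₊) := fun a _ b _ e => Nat.eq_of_mul_eq_mul_left bP e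
  calc _ ≤ ∑ n ∈ Finset.Ioc 0 ⌊y⌋₊, aD t (2^k*n) := by
        refine Finset.sum_le_sum fun n hn => ?_
        have hn0 := (Finset.mem_Ioc.1 hn).1
        by_cases hd : IsDense n t0
        · have h2 := (hd.two hk).mono ht
          rw [aD, aD, if_pos hd, if_pos h2]
          have : n.divisors ⊆ (2^k*n).divisors := Nat.divisors_subset_of_dvd bP (Dvd.intro_left _ rfl)
          exact_mod_cast Finset.card_le_card this
        · rw [aD, if_neg hd]; exact aD_nn _ _
    _ = ∑ m ∈ (Finset.Ioc 0 ⌊y⌋₊).image (fun n => 2^k*n), aD t m := (Finset.sum_image hinj).symm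
    _ ≤ _ := by
        refine Finset.sum_le_sum_of_subset_of_nonneg ?_ fun n _ _ => aD_nn _ _
        intro m hm
        obtain ⟨n, hn, rfl⟩ := Finset.mem_image.1 hm
        have hn0 := Finset.mem_Ioc.1 hn
        have hny : n ≤ y := (Nat.le_floor_iff hy).1 hn0.2
        refine Finset.mem_Ioc.2 ⟨Nat.mul_pos bP hn0.1, Nat.le_floor ?_⟩
        push_cast
        gcongr

open Filter Topology in
lemma L_lim {L : Real → Real} {A K p m q : Real} (hp : 0 < p) (hL : ∀ w, 1 ≤ w → |L w - A * w^p| ≤ K) (hm : 0 < m) (hq : 0 ≤ q) :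
    Tendsto (fun u : Real => L ((u+q)/m + 1) / u^p) atTop (𝓝 (A * (1/m)^p)) := by
  have h1 : Tendsto (fun u : Real => 1/m + (q/m+1)/u) atTop (𝓝 (1/m)) := by
    simpa using (tendsto_const_nhds).div_atTop tendsto_id |>.const_add (1/m)
  have h2 : Tendsto (fun u : Real => A * (1/m + (q/m+1)/u)^p) atTop (𝓝 (A * (1/m)^p)) :=
    (h1.rpow_const (Or.inr hp.le)).const_mul A
  have h3 : Tendsto (fun u : Real => K / u^p) atTop (𝓝 0) := tendsto_const_nhds.div_atTop (tendsto_rpow_atTop hp)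
  have h4 : Tendsto (fun u : Real => L ((u+q)/m + 1) / u^p - A * (1/m + (q/m+1)/u)^p) atTop (𝓝 0) := by
    refine squeeze_zero_norm' ?_ h3
    filter_upwards [eventually_gt_atTop 0] with u hu
    have e : (1/m + (q/m+1)/u)^p = ((u+q)/m+1)^p / u^p := by
      rw [← div_rpow bP hu.le]; congr 1; field_simp; ring
    have hup : 0 < u^p := rpow_pos_of_pos hu p
    rw [e, norm_eq_abs, show L ((u+q)/m + 1) / u^p - A * (((u+q)/m+1)^p / u^p) = (L ((u+q)/m + 1) - A * ((u+q)/m+1)^p) / u^p by ring, abs_div, abs_of_pos hup]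
    gcongr
    apply hL
    have : 0 ≤ (u+q)/m := bP
    linarith
  simpa using h4.add h2

open Filter Topology in
lemma alpha_lo {L : Real → Real} {A K p C a a0 l l0 q P : Real} (hp : 0 < p) (hp1 : p < 1) (hA : 0 < A) (hL : ∀ w, 1 ≤ w → |L w - A * w^p| ≤ K)
    (hl : 0 < l) (hl0 : l ≤ l0) (hq : 0 ≤ q) (hP : 0 < P) (ha : 1/2 ≤ a0)
    (h : ∀ u, 0 ≤ u → a0 * l0 * L (u/l0 + 1) - C ≤ P * (a * l * L ((u+q)/l + 1) + C)) : 1 / (2*P) ≤ a := by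
  have hl00 : 0 < l0 := bL
  have h1 := L_lim hp hL hl00 le_rfl
  have h2 := L_lim hp hL hl hq
  have h3 : ∀ D : Real, Tendsto (fun u : Real => D / u^p) atTop (𝓝 0) := fun D => tendsto_const_nhds.div_atTop (tendsto_rpow_atTop hp)
  have h4 := (h1.const_mul (a0*l0)).sub (h3 C)
  have h5 := ((h2.const_mul (a*l)).add (h3 C)).const_mul P
  have h6 := le_of_tendsto_of_tendsto h4 h5 (by
    filter_upwards [eventually_gt_atTop 0] with u hu
    have := h u hu.le
    have hup : 0 < u^p := rpow_pos_of_pos hu p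
    simp only [add_zero]
    have g := div_le_div_of_nonneg_right this hup.le
    calc _ = (a0 * l0 * L (u/l0 + 1) - C) / u^p := by ring
      _ ≤ _ := g
      _ = _ := by ring)
  have e : ∀ m : Real, 0 < m → m * (1/m)^p = m^(1-p) := by
    intro m hm
    rw [one_div, inv_rpow hm.le, rpow_sub hm, rpow_one, div_eq_mul_inv]
  have e1 := e l hl
  have e2 := e l0 hl00
  have h7 : a0 * l0^(1-p) * A ≤ P * a * l^(1-p) * A := by rw [← e1, ← e2]; linarith
  have h8 := le_of_mul_le_mul_right h7 hA
  have h9 : l^(1-p) ≤ l0^(1-p) := rpow_le_rpow hl.le hl0 bL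
  have h10 : 0 < l^(1-p) := rpow_pos_of_pos hl _
  have h11 : 0 < l0^(1-p) := rpow_pos_of_pos hl00 _
  have h12 : 0 < P * a := by
    by_contra hc
    push Not at hc
    have : P * a * l^(1-p) ≤ 0 := mul_nonpos_of_nonpos_of_nonneg hc h10.le
    have : 0 < a0 * l0^(1-p) := bP
    linarith
  have h13 : a0 * l0^(1-p) ≤ P * a * l0^(1-p) := h8.trans (mnl h9 h12.le)
  have h14 := le_of_mul_le_mul_right h13 h11
  rw [div_le_iff₀ bP]
  linarith

theorem thm2_dense_divisor_sum (ξ lam : ℝ → ℝ)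
    (hξ0 : ∀ u : ℝ, u < 1 → ξ u = 0)
    (hξ : ∀ u : ℝ, 1 ≤ u → u * ξ u = 2 + 2 * ∫ t in (1:ℝ)..(u - 1), ξ t)
    (hlam0 : ∀ v : ℝ, v < 0 → lam v = 0)
    (hlam : ∀ v : ℝ, 0 ≤ v →
      lam v = v - ∫ u in (0:ℝ)..((v - 1) / 2), lam u * ξ ((v - u) / (u + 1)) / (u + 1)) :
    ∃ α₀ : ℝ, 0 < α₀ ∧ ∃ C : ℝ, ∀ t : ℝ, 2 ≤ t → ∃ α : ℝ, α₀ ≤ α ∧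
      |α - 1| ≤ C / Real.log t ∧
      ∀ x : ℝ, 1 ≤ x →
        |T x t - x * α * Real.log t * lam (Real.log x / Real.log t)| ≤ C * x := by
  have hX : XI ξ := ⟨hξ0, hξ⟩
  obtain ⟨c, p, h⟩ := hX.exKD
  obtain ⟨hL, eL⟩ := h.lamL hlam0 hlam
  set L : ℝ → ℝ := fun w => lam (w-1) with hLd
  obtain ⟨C0, hC0, hinv⟩ := h.inv
  obtain ⟨M, hM0, hM⟩ := h.main_eq
  obtain ⟨A, K, hA, hAK⟩ := h.lamas hL eL
  set C := C0 * M with hC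
  have hC' : 0 ≤ C := by positivity
  have key : ∀ t : ℝ, 2 ≤ t → ∃ α : ℝ, |α - 1| ≤ C / log t ∧ ∀ x : ℝ, 1 ≤ x →
        |T x t - x * α * log t * lam (log x / log t)| ≤ C * x := by
    intro t ht
    have hl := log2h ht
    obtain ⟨β, hβ, hw⟩ := hM t ht
    have hf := fD_LB ht
    have hmc := MC_LB h.kapLB hf
    obtain ⟨a, ha, hfa⟩ := hinv (fD t) L (fun w => fD t w + MC (kap ξ) (fD t) w - log t * (w-1) - β * w) (log t) β M hf hL
      (((hf.m.add hmc.m).sub (by fun_prop)).sub (by fun_prop)) hβ hw eL (fun w _ => by ring)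
    refine ⟨1 + a / log t, ?_, fun x hx => ?_⟩
    · rw [add_sub_cancel_left, abs_div, abs_of_pos (by linarith : 0 < log t)]
      gcongr
    · have hv : 0 ≤ log x / log t := div_nonneg (log_nonneg hx) (by linarith)
      have g := hfa (log x / log t + 1) (by linarith)
      have e := fD_eq (t := t) (s := log x / log t + 1) (by linarith)
      rw [add_sub_cancel_right, mul_div_cancel₀ _ (by linarith : log t ≠ 0), exp_log (by linarith)] at e
      simp only [hLd, add_sub_cancel_right] at g
      rw [T_eq, e]
      have e2 : fD t (log x / log t + 1) * x - x * (1 + a / log t) * log t * lam (log x / log t) = (fD t (log x / log t + 1) - (log t + a) * lam (log x / log t)) * x := by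
        field_simp
      rw [e2, abs_mul, abs_of_pos (by linarith : 0 < x)]
      gcongr
  set t0 := exp (2*C+1) with ht0
  have ht02 : 2 ≤ t0 := by have := add_one_le_exp (2*C+1); linarith
  have hl0 : log t0 = 2*C+1 := log_exp _
  have half : ∀ t, t0 ≤ t → ∀ α : ℝ, |α - 1| ≤ C / log t → 1/2 ≤ α := by
    intro t ht α hα
    have g : 2*C+1 ≤ log t := by rw [← hl0]; exact log_le_log (by linarith) ht
    have : C / log t ≤ 1/2 := by rw [div_le_iff₀ (by linarith)]; linarith
    linarith [(abs_le.1 hα).1]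
  obtain ⟨a0, ha0, hT0⟩ := key t0 ht02
  have ha0' := half t0 le_rfl a0 ha0
  obtain ⟨k, hk⟩ := pow_unbounded_of_one_lt t0 (by norm_num : (1:ℝ) < 2)
  have hP : (1:ℝ) ≤ 2^k := one_le_pow₀ (by norm_num)
  refine ⟨1 / (2 * 2^k), by positivity, C, fun t ht => ?_⟩
  obtain ⟨α, hα, hT⟩ := key t ht
  refine ⟨α, ?_, hα, hT⟩
  rcases le_total t0 t with g | g
  · refine le_trans ?_ (half t g α hα)
    gcongr; linarith
  have hl := log2h ht
  refine alpha_lo (L := L) (A := A) (K := K) (p := p) (C := C) (a0 := a0) (l := log t) (l0 := log t0) (q := log (2^k)) (by linarith [h.p1]) (by linarith [h.p2]) hA hAK (by linarith) (log_le_log (by linarith) g) (log_nonneg hP) (by positivity) ha0' fun u hu => ?_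
  have h1 := abs_le.1 (hT0 (exp u) (one_le_exp hu))
  have h2 := abs_le.1 (hT (2^k * exp u) (by nlinarith [one_le_exp hu]))
  have h3 := T_comp (t := t) (y := exp u) ht hk.le (exp_pos u).le
  rw [← T_eq, ← T_eq] at h3
  rw [log_exp u] at h1
  rw [log_mul (by positivity) (exp_pos u).ne', log_exp, add_comm (log (2^k))] at h2
  simp only [hLd, add_sub_cancel_right]
  refine le_of_mul_le_mul_left ?_ (exp_pos u)
  linarith [h1.1, h2.2]
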